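/- (Erdős, inequality (1).) There exist a constant c > 0 and a threshold N₀ such that for every highly composite number n ≥ N₀ there exists a highly composite number n₁ with n < n₁ < n + n·(log n)^{-c}. -/

import Mathlib

/-- `n` is a highly composite number: `d(m) < d(n)` for all positive `m < n`. -/
def HighlyComposite (n : ℕ) : Prop :=
  0 < n ∧ ∀ m : ℕ, 0 < m → m < n → m.divisors.card < n.divisors.card

open Finset
open ArithmeticFunction (vonMangoldt)

/-- `n` has no prime factor `≤ z`. -/
def IsRough (z n : ℕ) : Prop := ∀ p : ℕ, p.Prime → p ∣ n → z < p

/-- The indicator function of the `z`-rough numbers. -/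
noncomputable def roughInd (z n : ℕ) : ℝ := open Classical in if IsRough z n then 1 else 0

lemma roughInd_nonneg (z n : ℕ) : 0 ≤ roughInd z n := by
  unfold roughInd; split_ifs <;> norm_num

lemma card_multiples_Ioc (X h d : ℕ) (hd : 0 < d) :
    |(#{n ∈ Ioc X (X + h) | d ∣ n} : ℝ) - h / d| ≤ 1 := by
  have h1 : #{n ∈ Ioc X (X + h) | d ∣ n} + X / d = (X + h) / d := by
    rw [← Nat.Ioc_filter_dvd_card_eq_div X d, ← Nat.Ioc_filter_dvd_card_eq_div (X + h) d,
      ← card_union_of_disjoint]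
    · congr 1
      ext n
      simp only [mem_union, mem_filter, mem_Ioc]
      by_cases hn : d ∣ n
      · simp only [hn, and_true]; omega
      · simp [hn]
    · rw [disjoint_left]
      intro n hn hn'
      simp only [mem_filter, mem_Ioc] at hn hn'
      omega
  have hd' : (0 : ℝ) < d := by exact_mod_cast hd
  have e1 : ((X / d : ℕ) : ℝ) ≤ X / d := Nat.cast_div_le
  have e2 : (((X + h) / d : ℕ) : ℝ) ≤ (X + h) / d := by exact_mod_cast Nat.cast_div_le (α := ℝ)
  have e3 : (X : ℝ) / d < (X / d : ℕ) + 1 := by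
    rw [div_lt_iff₀ hd']; exact_mod_cast Nat.lt_mul_of_div_lt (Nat.lt_succ_self _) hd
  have e4 : ((X : ℝ) + h) / d < ((X + h) / d : ℕ) + 1 := by
    rw [div_lt_iff₀ hd']; exact_mod_cast Nat.lt_mul_of_div_lt (Nat.lt_succ_self _) hd
  have h2 : (#{n ∈ Ioc X (X + h) | d ∣ n} : ℝ) + (X / d : ℕ) = ((X + h) / d : ℕ) := by
    exact_mod_cast h1
  rw [add_div] at e2 e4
  rw [abs_le]; constructor <;> linarith

lemma sum_one_div_sq_le (z : ℕ) : ∑ k ∈ Icc 1 z, (1 : ℝ) / k ^ 2 ≤ 2 := by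
  have : ∀ z : ℕ, ∑ k ∈ Icc 1 (z + 1), (1 : ℝ) / k ^ 2 ≤ 2 - 1 / (z + 1) := by
    intro z
    induction z with
    | zero => norm_num
    | succ z ih =>
      rw [sum_Icc_succ_top (by omega)]
      push_cast
      have : (1 : ℝ) / (z + 1 + 1) ^ 2 ≤ 1 / (z + 1) - 1 / (z + 1 + 1) := by
        rw [div_sub_div _ _ (by positivity) (by positivity), div_le_div_iff₀ (by positivity) (by positivity)]
        have : (0 : ℝ) ≤ z := Nat.cast_nonneg z
        nlinarith
      linarith
  cases z with
  | zero => norm_num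
  | succ z => have := this z; have : (0 : ℝ) ≤ 1 / (z + 1) := by positivity
              linarith

lemma log_le_sum_one_div (z : ℕ) (hz : 0 < z) : Real.log z ≤ ∑ n ∈ Icc 1 z, (1 : ℝ) / n := by
  have h := log_add_one_le_harmonic z
  have h2 : ((harmonic z : ℚ) : ℝ) = ∑ n ∈ Icc 1 z, (1 : ℝ) / n := by
    rw [harmonic_eq_sum_Icc]; push_cast; simp
  rw [← h2]
  refine le_trans (Real.log_le_log (by exact_mod_cast hz) ?_) h
  push_cast; linarith

lemma sum_squarefree_one_div (z : ℕ) (hz : 0 < z) :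
    Real.log z ≤ 2 * ∑ m ∈ Icc 1 z with Squarefree m, (1 : ℝ) / m := by
  refine (log_le_sum_one_div z hz).trans ?_
  have key : ∑ n ∈ Icc 1 z, (1 : ℝ) / n ≤
      ∑ q ∈ (Icc 1 z).filter Squarefree ×ˢ Icc 1 z, (1 : ℝ) / q.1 * (1 / q.2 ^ 2) := by
    have hex : ∀ n : ℕ, ∃ q : ℕ × ℕ, q.2 ^ 2 * q.1 = n ∧ Squarefree q.1 := fun n => by
      obtain ⟨a, b, hab⟩ := Nat.sq_mul_squarefree n
      exact ⟨(a, b), hab⟩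
    choose f hf hf2 using hex
    have e : ∀ n, (1 : ℝ) / n = 1 / (f n).1 * (1 / (f n).2 ^ 2) := fun n => by
      conv_lhs => rw [← hf n]
      push_cast
      rw [one_div_mul_one_div, mul_comm]
    have hinj : Set.InjOn f (Icc 1 z : Finset ℕ) := fun a _ b _ hab => by
      rw [← hf a, ← hf b, hab]
    rw [sum_congr rfl (fun n _ => e n), ← sum_image (f := fun q : ℕ × ℕ => (1 : ℝ) / q.1 * (1 / q.2 ^ 2)) hinj]
    refine sum_le_sum_of_subset_of_nonneg ?_ (fun _ _ _ => by positivity)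
    intro q hq
    simp only [mem_image, mem_Icc] at hq
    obtain ⟨n, hn, rfl⟩ := hq
    have hfn := hf n
    have hpos : 0 < (f n).2 := Nat.pos_of_ne_zero (fun h0 => by rw [h0] at hfn; simp at hfn; omega)
    have hpos1 : 0 < (f n).1 := Nat.pos_of_ne_zero (fun h0 => by rw [h0] at hfn; simp at hfn; omega)
    simp only [mem_product, mem_filter, mem_Icc]
    have : 1 ≤ (f n).2 ^ 2 := Nat.one_le_pow _ _ hpos
    refine ⟨⟨⟨hpos1, ?_⟩, hf2 n⟩, hpos, ?_⟩
    · nlinarith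
    · nlinarith
  refine key.trans ?_
  rw [sum_product, mul_comm, sum_mul]
  refine sum_le_sum fun m _ => ?_
  simp only
  rw [← mul_sum]
  exact mul_le_mul_of_nonneg_left (sum_one_div_sq_le z) (by positivity)

/-- The Selberg-type weights `y_m`. -/
noncomputable def selY (z m : ℕ) : ℝ :=
  (ArithmeticFunction.moebius m : ℝ) / m / ∑ m ∈ Icc 1 z with Squarefree m, (1 : ℝ) / m

noncomputable def selLam (z d : ℕ) : ℝ :=
  d * ∑ m ∈ Icc 1 z with d ∣ m, (ArithmeticFunction.moebius (m / d) : ℝ) * selY z m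

lemma selD_ge_one (z : ℕ) (hz : 0 < z) :
    1 ≤ ∑ m ∈ Icc 1 z with Squarefree m, (1 : ℝ) / m := by
  have : ((1 : ℝ) / (1 : ℕ)) ≤ ∑ m ∈ Icc 1 z with Squarefree m, (1 : ℝ) / m :=
    single_le_sum (f := fun m : ℕ => (1 : ℝ) / m) (fun _ _ => by positivity)
      (by simp; omega)
  simpa using this

lemma abs_moebius_real_le (m : ℕ) : |(ArithmeticFunction.moebius m : ℝ)| ≤ 1 := by
  exact_mod_cast ArithmeticFunction.abs_moebius_le_one (n := m)

lemma abs_selY_le (z m : ℕ) (hz : 0 < z) (hm : 0 < m) : |selY z m| ≤ 1 / m := by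
  have hD := selD_ge_one z hz
  have hm' : (0 : ℝ) < m := by exact_mod_cast hm
  unfold selY
  rw [abs_div, abs_div, abs_of_pos hm', abs_of_pos (by linarith : (0 : ℝ) < ∑ m ∈ Icc 1 z with Squarefree m, (1 : ℝ) / m)]
  refine (div_le_self (by positivity) hD).trans ?_
  gcongr
  exact abs_moebius_real_le m

lemma abs_selLam_le (z d : ℕ) (hz : 0 < z) (hd : 0 < d) : |selLam z d| ≤ z := by
  unfold selLam
  rw [abs_mul, Nat.abs_cast]
  have hd' : (0 : ℝ) < d := by exact_mod_cast hd
  have : |∑ m ∈ Icc 1 z with d ∣ m, (ArithmeticFunction.moebius (m / d) : ℝ) * selY z m| ≤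
      ∑ m ∈ Icc 1 z with d ∣ m, (1 : ℝ) / d := by
    refine (abs_sum_le_sum_abs _ _).trans (sum_le_sum fun m hm => ?_)
    simp only [mem_filter, mem_Icc] at hm
    rw [abs_mul]
    have h1 := abs_selY_le z m hz (by omega)
    have h2 := abs_moebius_real_le (m / d)
    have h3 : (1 : ℝ) / m ≤ 1 / d := by
      have : d ≤ m := Nat.le_of_dvd (by omega) hm.2
      gcongr
    calc _ ≤ 1 * (1 / (d : ℝ)) := mul_le_mul h2 (h1.trans h3) (abs_nonneg _) (by norm_num)
      _ = _ := one_mul _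
  refine (mul_le_mul_of_nonneg_left this hd'.le).trans ?_
  rw [sum_const, nsmul_eq_mul]
  have hc : (#{m ∈ Icc 1 z | d ∣ m} : ℝ) ≤ z := by
    have := card_filter_le (Icc 1 z) (fun m => d ∣ m)
    simp only [Nat.card_Icc, Nat.add_sub_cancel] at this
    exact_mod_cast this
  calc (d : ℝ) * (#{m ∈ Icc 1 z | d ∣ m} * (1 / d)) = #{m ∈ Icc 1 z | d ∣ m} := by
        field_simp
    _ ≤ z := hc

lemma selLam_one (z : ℕ) (hz : 0 < z) : selLam z 1 = 1 := by
  have hD := selD_ge_one z hz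
  unfold selLam selY
  simp only [Nat.cast_one, one_dvd, filter_true, Nat.div_one, one_mul]
  have e : ∀ m ∈ Icc 1 z, (ArithmeticFunction.moebius m : ℝ) * ((ArithmeticFunction.moebius m : ℝ) / m /
      ∑ m ∈ Icc 1 z with Squarefree m, (1 : ℝ) / m) =
      (if Squarefree m then (1 : ℝ) / m else 0) / ∑ m ∈ Icc 1 z with Squarefree m, (1 : ℝ) / m := by
    intro m _
    rw [← mul_div_assoc, ← mul_div_assoc]
    congr 1
    have := ArithmeticFunction.moebius_sq (n := m)
    have h2 : (ArithmeticFunction.moebius m : ℝ) * ArithmeticFunction.moebius m = if Squarefree m then 1 else 0 := by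
      rw [← sq]; exact_mod_cast this
    rw [h2]; split_ifs <;> simp
  rw [sum_congr rfl e, ← sum_div, ← sum_filter]
  exact div_self (by linarith)

lemma sum_moebius_real (n : ℕ) :
    ∑ d ∈ n.divisors, (ArithmeticFunction.moebius d : ℝ) = if n = 1 then 1 else 0 := by
  have h := congrArg (fun f => f n) (ArithmeticFunction.coe_moebius_mul_coe_zeta (R := ℝ))
  simp only [ArithmeticFunction.coe_mul_zeta_apply, ArithmeticFunction.one_apply] at h
  simpa using h

lemma sum_moebius_between (m k : ℕ) (hm : 0 < m) (hk : 0 < k) (hmk : m ∣ k) :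
    ∑ d ∈ k.divisors with m ∣ d, (ArithmeticFunction.moebius (k / d) : ℝ) = if k = m then 1 else 0 := by
  obtain ⟨j, rfl⟩ := hmk
  have hj : 0 < j := Nat.pos_of_mul_pos_left hk
  have h1 : ∑ d ∈ (m * j).divisors with m ∣ d, (ArithmeticFunction.moebius (m * j / d) : ℝ) =
      ∑ e ∈ j.divisors, (ArithmeticFunction.moebius (j / e) : ℝ) := by
    symm
    refine sum_bij (fun e _ => m * e) ?_ ?_ ?_ ?_
    · intro e he
      simp only [Nat.mem_divisors] at he
      simp only [mem_filter, Nat.mem_divisors]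
      exact ⟨⟨mul_dvd_mul_left m he.1, by positivity⟩, dvd_mul_right _ _⟩
    · intro a _ b _ hab
      exact Nat.eq_of_mul_eq_mul_left hm hab
    · intro d hd
      simp only [mem_filter, Nat.mem_divisors] at hd
      obtain ⟨⟨h1, _⟩, e, rfl⟩ := hd
      exact ⟨e, by simp only [Nat.mem_divisors]; exact ⟨Nat.dvd_of_mul_dvd_mul_left hm h1, hj.ne'⟩, rfl⟩
    · intro e _
      rw [Nat.mul_div_mul_left _ _ hm]
  rw [h1, Nat.sum_div_divisors j (fun e => (ArithmeticFunction.moebius e : ℝ))]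
  rw [sum_moebius_real j]
  have : m * j = m ↔ j = 1 := by
    constructor
    · intro h; exact Nat.eq_of_mul_eq_mul_left hm (by rw [h, mul_one])
    · rintro rfl; rw [mul_one]
  simp [this]

lemma sum_selLam_div (z m : ℕ) (hm : m ∈ Icc 1 z) :
    ∑ d ∈ Icc 1 z with m ∣ d, selLam z d / d = selY z m := by
  have hm' := mem_Icc.1 hm
  have e1 : ∀ d ∈ (Icc 1 z).filter (m ∣ ·), selLam z d / d =
      ∑ k ∈ Icc 1 z, if d ∣ k then (ArithmeticFunction.moebius (k / d) : ℝ) * selY z k else 0 := by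
    intro d hd
    simp only [mem_filter, mem_Icc] at hd
    have : (d : ℝ) ≠ 0 := by exact_mod_cast (by omega : d ≠ 0)
    rw [selLam, mul_div_cancel_left₀ _ this, sum_filter]
  rw [sum_congr rfl e1, sum_comm]
  have e2 : ∀ k ∈ Icc 1 z, (∑ d ∈ Icc 1 z with m ∣ d,
      if d ∣ k then (ArithmeticFunction.moebius (k / d) : ℝ) * selY z k else 0) =
      if k = m then selY z k else 0 := by
    intro k hk
    have hk' := mem_Icc.1 hk
    have : (∑ d ∈ Icc 1 z with m ∣ d,
      if d ∣ k then (ArithmeticFunction.moebius (k / d) : ℝ) * selY z k else 0) =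
      (∑ d ∈ k.divisors with m ∣ d, (ArithmeticFunction.moebius (k / d) : ℝ)) * selY z k := by
      rw [← sum_filter, filter_filter, sum_mul]
      refine sum_congr ?_ (fun _ _ => rfl)
      ext d
      simp only [mem_filter, mem_Icc, Nat.mem_divisors]
      constructor
      · rintro ⟨⟨h1, h2⟩, h3, h4⟩
        exact ⟨⟨h4, by omega⟩, h3⟩
      · rintro ⟨⟨h1, h2⟩, h3⟩
        have := Nat.le_of_dvd (by omega) h1
        have := Nat.pos_of_dvd_of_pos h1 (by omega)
        exact ⟨⟨by omega, by omega⟩, h3, h1⟩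
    rw [this]
    by_cases hmk : m ∣ k
    · rw [sum_moebius_between m k (by omega) (by omega) hmk]
      split_ifs <;> simp
    · have : k ≠ m := fun h => hmk (h ▸ dvd_rfl)
      rw [if_neg this]
      have : (k.divisors.filter (fun d => m ∣ d)) = ∅ := by
        rw [filter_eq_empty_iff]
        intro d hd h
        exact hmk (h.trans (Nat.dvd_of_mem_divisors hd))
      rw [this]; simp
  rw [sum_congr rfl e2, sum_ite_eq' (Icc 1 z) m (selY z), if_pos hm]

lemma selberg_form (z : ℕ) (hz : 0 < z) :
    ∑ d ∈ Icc 1 z, ∑ e ∈ Icc 1 z, selLam z d * selLam z e / (Nat.lcm d e : ℝ) ≤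
      1 / ∑ m ∈ Icc 1 z with Squarefree m, (1 : ℝ) / m := by
  have e1 : ∀ d ∈ Icc 1 z, ∀ e ∈ Icc 1 z, selLam z d * selLam z e / (Nat.lcm d e : ℝ) =
      ∑ m ∈ Icc 1 z, (Nat.totient m : ℝ) * ((if m ∣ d then selLam z d / d else 0) *
        (if m ∣ e then selLam z e / e else 0)) := by
    intro d hd e he
    simp only [mem_Icc] at hd he
    have hg : 0 < Nat.gcd d e := Nat.gcd_pos_of_pos_left _ (by omega)
    have h1 : ((Nat.gcd d e : ℕ) : ℝ) = ∑ m ∈ Icc 1 z, if m ∣ d ∧ m ∣ e then (Nat.totient m : ℝ) else 0 := by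
      rw [← Nat.sum_totient (Nat.gcd d e), Nat.cast_sum, ← sum_filter]
      refine sum_congr ?_ (fun _ _ => rfl)
      ext m
      simp only [Nat.mem_divisors, mem_filter, mem_Icc, Nat.dvd_gcd_iff]
      constructor
      · rintro ⟨h, _⟩
        have := Nat.le_of_dvd (by omega) h.1
        have := Nat.pos_of_dvd_of_pos h.1 (by omega)
        exact ⟨⟨by omega, by omega⟩, h⟩
      · rintro ⟨_, h⟩
        exact ⟨h, hg.ne'⟩
    have h2 : (Nat.gcd d e : ℝ) * Nat.lcm d e = d * e := by exact_mod_cast Nat.gcd_mul_lcm d e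
    have hd0 : (d : ℝ) ≠ 0 := by exact_mod_cast (by omega : d ≠ 0)
    have he0 : (e : ℝ) ≠ 0 := by exact_mod_cast (by omega : e ≠ 0)
    have hl0 : (Nat.lcm d e : ℝ) ≠ 0 := by
      intro h; rw [h, mul_zero] at h2; exact mul_ne_zero hd0 he0 h2.symm
    have h3 : selLam z d * selLam z e / (Nat.lcm d e : ℝ) =
        (Nat.gcd d e : ℝ) * (selLam z d / d * (selLam z e / e)) := by
      rw [div_mul_div_comm, mul_div_assoc', div_eq_div_iff hl0 (mul_ne_zero hd0 he0)]
      rw [← h2]; ring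
    rw [h3, h1, sum_mul]
    refine sum_congr rfl fun m _ => ?_
    by_cases ha : m ∣ d <;> by_cases hb : m ∣ e <;> simp [ha, hb]
  rw [sum_congr rfl (fun d hd => sum_congr rfl (e1 d hd))]
  have e2 : ∑ d ∈ Icc 1 z, ∑ e ∈ Icc 1 z, ∑ m ∈ Icc 1 z, (Nat.totient m : ℝ) *
      ((if m ∣ d then selLam z d / d else 0) * (if m ∣ e then selLam z e / e else 0)) =
      ∑ m ∈ Icc 1 z, (Nat.totient m : ℝ) * selY z m ^ 2 := by
    rw [sum_congr rfl (fun d _ => sum_comm), sum_comm]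
    refine sum_congr rfl fun m hm => ?_
    have := sum_selLam_div z m hm
    rw [sum_filter] at this
    simp_rw [← mul_sum]
    rw [← sum_mul, this, sq]
  rw [e2]
  have hD := selD_ge_one z hz
  set D := ∑ m ∈ Icc 1 z with Squarefree m, (1 : ℝ) / m with hDdef
  have e3 : ∀ m ∈ Icc 1 z, (Nat.totient m : ℝ) * selY z m ^ 2 ≤
      (if Squarefree m then (1 : ℝ) / m else 0) / D ^ 2 := by
    intro m hm
    simp only [mem_Icc] at hm
    have hm0 : (0 : ℝ) < m := by exact_mod_cast (by omega : 0 < m)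
    have h2 : (ArithmeticFunction.moebius m : ℝ) ^ 2 = if Squarefree m then 1 else 0 := by
      exact_mod_cast ArithmeticFunction.moebius_sq (n := m)
    rw [selY, ← hDdef, div_pow, div_pow, h2, mul_div_assoc']
    gcongr
    have : (Nat.totient m : ℝ) ≤ m := by exact_mod_cast Nat.totient_le m
    split_ifs
    · rw [mul_div_assoc', div_le_div_iff₀ (by positivity) hm0]
      nlinarith
    · simp
  refine (sum_le_sum e3).trans ?_
  rw [← sum_div, ← sum_filter, ← hDdef, sq, ← div_div, div_self (by linarith)]

/-- Selberg's upper bound sieve for `z`-rough numbers in short intervals. -/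
theorem sum_roughInd_le (z X h : ℕ) (hz : 2 ≤ z) (hh : z ^ 5 ≤ h) :
    ∑ n ∈ Ioc X (X + h), roughInd z n ≤ 3 * h / Real.log z := by
  have hz0 : 0 < z := by omega
  have step1 : ∀ n ∈ Ioc X (X + h), roughInd z n ≤
      (∑ d ∈ Icc 1 z, if d ∣ n then selLam z d else 0) ^ 2 := by
    intro n hn
    unfold roughInd
    split_ifs with hr
    · have : (∑ d ∈ Icc 1 z, if d ∣ n then selLam z d else 0) = 1 := by
        rw [sum_eq_single 1]
        · simp [selLam_one z hz0]
        · intro d hd hd1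
          simp only [mem_Icc] at hd
          rw [if_neg]
          intro hdn
          have := hr d.minFac (Nat.minFac_prime hd1) ((Nat.minFac_dvd d).trans hdn)
          have := Nat.minFac_le (n := d) (by omega)
          omega
        · intro h; simp at h; omega
      rw [this]; norm_num
    · positivity
  refine (sum_le_sum step1).trans ?_
  have step2 : ∑ n ∈ Ioc X (X + h), (∑ d ∈ Icc 1 z, if d ∣ n then selLam z d else 0) ^ 2 =
      ∑ d ∈ Icc 1 z, ∑ e ∈ Icc 1 z, selLam z d * selLam z e *
        (#{n ∈ Ioc X (X + h) | Nat.lcm d e ∣ n} : ℝ) := by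
    simp_rw [sq, sum_mul_sum]
    rw [sum_comm]
    refine sum_congr rfl fun d _ => ?_
    rw [sum_comm]
    refine sum_congr rfl fun e _ => ?_
    rw [card_filter, Nat.cast_sum, mul_sum]
    refine sum_congr rfl fun n _ => ?_
    by_cases ha : d ∣ n <;> by_cases hb : e ∣ n <;> simp [ha, hb, Nat.lcm_dvd_iff]
  rw [step2]
  have step3 : ∀ d ∈ Icc 1 z, ∀ e ∈ Icc 1 z, selLam z d * selLam z e *
        (#{n ∈ Ioc X (X + h) | Nat.lcm d e ∣ n} : ℝ) ≤
      h * (selLam z d * selLam z e / (Nat.lcm d e : ℝ)) + z ^ 2 := by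
    intro d hd e he
    simp only [mem_Icc] at hd he
    have hl := card_multiples_Ioc X h (Nat.lcm d e) (Nat.lcm_pos (by omega) (by omega))
    set c := (#{n ∈ Ioc X (X + h) | Nat.lcm d e ∣ n} : ℝ)
    have h1 := abs_selLam_le z d hz0 (by omega)
    have h2 := abs_selLam_le z e hz0 (by omega)
    have h3 : |selLam z d * selLam z e * (c - h / (Nat.lcm d e : ℝ))| ≤ z * z * 1 := by
      rw [abs_mul, abs_mul]
      gcongr
    have h4 := (le_abs_self _).trans h3
    have h5 : selLam z d * selLam z e * (c - h / (Nat.lcm d e : ℝ)) =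
      selLam z d * selLam z e * c - h * (selLam z d * selLam z e / (Nat.lcm d e : ℝ)) := by ring
    nlinarith
  refine (sum_le_sum fun d hd => sum_le_sum (step3 d hd)).trans ?_
  simp_rw [sum_add_distrib, ← mul_sum]
  simp only [sum_const, Nat.card_Icc, Nat.add_sub_cancel, nsmul_eq_mul]
  have hform := selberg_form z hz0
  have hsq := sum_squarefree_one_div z hz0
  have hz1 : (1 : ℝ) < z := by exact_mod_cast (by omega : 1 < z)
  have hlog : 0 < Real.log z := Real.log_pos hz1
  have hloglt : Real.log z ≤ z := (Real.log_le_sub_one_of_pos (by linarith)).trans (by linarith)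
  have hinv : 1 / (∑ m ∈ Icc 1 z with Squarefree m, (1 : ℝ) / m) ≤ 2 / Real.log z := by
    rw [div_le_div_iff₀ (by linarith) hlog]; linarith
  have hh' : (z : ℝ) ^ 5 ≤ h := by exact_mod_cast hh
  have h4 : (z : ℝ) * (z * z ^ 2) ≤ h / Real.log z := by
    rw [le_div_iff₀ hlog]
    calc (z : ℝ) * ((z : ℝ) * (z : ℝ) ^ 2) * Real.log z ≤ (z : ℝ) * (z * (z : ℝ) ^ 2) * z := by gcongr
      _ = (z : ℝ) ^ 5 := by ring
      _ ≤ h := hh'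
  have h5 : (h : ℝ) * ∑ d ∈ Icc 1 z, ∑ e ∈ Icc 1 z, selLam z d * selLam z e / (Nat.lcm d e : ℝ) ≤
      h * (2 / Real.log z) := mul_le_mul_of_nonneg_left (hform.trans hinv) (Nat.cast_nonneg h)
  have e6 : 3 * (h : ℝ) / Real.log z = h * (2 / Real.log z) + h / Real.log z := by ring
  rw [e6]
  exact add_le_add h5 h4

lemma sum_log_le (n : ℕ) : ∑ m ∈ Ioc 0 n, Real.log m ≤ n * Real.log n := by
  calc _ ≤ ∑ m ∈ Ioc 0 n, Real.log n := sum_le_sum fun m hm => by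
        simp only [mem_Ioc] at hm
        exact Real.log_le_log (by exact_mod_cast hm.1) (by exact_mod_cast hm.2)
    _ = _ := by simp

lemma le_sum_log (n : ℕ) : n * Real.log n - n ≤ ∑ m ∈ Ioc 0 n, Real.log m := by
  induction n with
  | zero => simp
  | succ n ih =>
    rw [sum_Ioc_succ_top (Nat.zero_le n)]
    rcases Nat.eq_zero_or_pos n with rfl | hn
    · norm_num
    have hn' : (0 : ℝ) < n := by exact_mod_cast hn
    have h1 : Real.log (n + 1) - Real.log n ≤ 1 / n := by
      rw [← Real.log_div (by positivity) (by positivity)]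
      refine (Real.log_le_sub_one_of_pos (by positivity)).trans (le_of_eq ?_)
      field_simp; ring
    have h2 : n * (Real.log (n + 1) - Real.log n) ≤ 1 := by
      calc _ ≤ (n : ℝ) * (1 / n) := by gcongr
        _ = 1 := by field_simp
    push_cast
    nlinarith

lemma sum_vonMangoldt_mul_div (n : ℕ) :
    ∑ d ∈ Ioc 0 n, vonMangoldt d * ((n / d : ℕ) : ℝ) = ∑ m ∈ Ioc 0 n, Real.log m := by
  have := ArithmeticFunction.sum_Ioc_mul_zeta_eq_sum vonMangoldt n
  rw [← this, ArithmeticFunction.vonMangoldt_mul_zeta]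
  rfl

lemma psi_nat (n : ℕ) : Chebyshev.psi n = ∑ d ∈ Ioc 0 n, vonMangoldt d := by
  unfold Chebyshev.psi; simp

lemma psi_le_six (n : ℕ) : ∑ d ∈ Ioc 0 n, vonMangoldt d ≤ 6 * n := by
  rw [← psi_nat]
  refine (Chebyshev.psi_le_const_mul_self (Nat.cast_nonneg n)).trans ?_
  gcongr
  have : Real.log 4 = 2 * Real.log 2 := by
    rw [show (4 : ℝ) = 2 ^ 2 by norm_num, Real.log_pow]; norm_num
  have := Real.log_two_lt_d9
  linarith

/-- Mertens' first theorem. -/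
lemma sum_vonMangoldt_div_le (n : ℕ) (hn : 0 < n) :
    ∑ d ∈ Ioc 0 n, vonMangoldt d / d ≤ Real.log n + 6 := by
  have hn' : (0 : ℝ) < n := by exact_mod_cast hn
  have h1 : n * ∑ d ∈ Ioc 0 n, vonMangoldt d / d ≤
      ∑ d ∈ Ioc 0 n, (vonMangoldt d * ((n / d : ℕ) : ℝ) + vonMangoldt d) := by
    rw [mul_sum]
    refine sum_le_sum fun d hd => ?_
    simp only [mem_Ioc] at hd
    have hd' : (0 : ℝ) < d := by exact_mod_cast hd.1
    have e3 : (n : ℝ) / d ≤ (n / d : ℕ) + 1 := by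
      rw [div_le_iff₀ hd']; exact_mod_cast (Nat.lt_mul_of_div_lt (Nat.lt_succ_self _) hd.1).le
    calc (n : ℝ) * (vonMangoldt d / d) = vonMangoldt d * (n / d) := by ring
      _ ≤ vonMangoldt d * ((n / d : ℕ) + 1) :=
        mul_le_mul_of_nonneg_left e3 ArithmeticFunction.vonMangoldt_nonneg
      _ = _ := by ring
  rw [sum_add_distrib, sum_vonMangoldt_mul_div] at h1
  have h2 := sum_log_le n
  have h3 := psi_le_six n
  have h4 : (n : ℝ) * ∑ d ∈ Ioc 0 n, vonMangoldt d / d ≤ n * (Real.log n + 6) := by linarith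
  exact le_of_mul_le_mul_left h4 hn'

lemma le_sum_vonMangoldt_div (n : ℕ) (hn : 0 < n) :
    Real.log n - 1 ≤ ∑ d ∈ Ioc 0 n, vonMangoldt d / d := by
  have hn' : (0 : ℝ) < n := by exact_mod_cast hn
  have h1 : ∑ d ∈ Ioc 0 n, vonMangoldt d * ((n / d : ℕ) : ℝ) ≤
      n * ∑ d ∈ Ioc 0 n, vonMangoldt d / d := by
    rw [mul_sum]
    refine sum_le_sum fun d hd => ?_
    calc vonMangoldt d * ((n / d : ℕ) : ℝ) ≤ vonMangoldt d * (n / d) :=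
        mul_le_mul_of_nonneg_left Nat.cast_div_le ArithmeticFunction.vonMangoldt_nonneg
      _ = _ := by ring
  rw [sum_vonMangoldt_mul_div] at h1
  have h2 := le_sum_log n
  have h4 : (n : ℝ) * (Real.log n - 1) ≤ n * ∑ d ∈ Ioc 0 n, vonMangoldt d / d := by linarith
  exact le_of_mul_le_mul_left h4 hn'

lemma sum_one_div_le (z : ℕ) : ∑ n ∈ Icc 1 z, (1 : ℝ) / n ≤ 1 + Real.log z := by
  have h := harmonic_le_one_add_log z
  have h2 : ((harmonic z : ℚ) : ℝ) = ∑ n ∈ Icc 1 z, (1 : ℝ) / n := by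
    rw [harmonic_eq_sum_Icc]; push_cast; simp
  rwa [← h2]

lemma dvd_of_mul_eq_rough {z m k m' k' : ℕ} (hm0 : 0 < m) (hm : m ≤ z) (hk : IsRough z k')
    (h : m * k = m' * k') : m ∣ m' := by
  have hc : Nat.Coprime m k' := by
    rw [Nat.coprime_iff_gcd_eq_one]
    by_contra hne
    obtain ⟨p, hp, hd⟩ := Nat.exists_prime_and_dvd hne
    have := hk p hp (hd.trans (Nat.gcd_dvd_right _ _))
    have := Nat.le_of_dvd hm0 (hd.trans (Nat.gcd_dvd_left _ _))
    omega
  exact hc.dvd_of_dvd_mul_right (h ▸ dvd_mul_right m k)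

lemma sum_roughInd_div_le (z M : ℕ) (hz : 2 ≤ z) (hzM : z ≤ M) :
    ∑ k ∈ Icc 1 M, roughInd z k / k ≤ 4 * Real.log M / Real.log z := by
  classical
  have hz1 : (1 : ℝ) < z := by exact_mod_cast (by omega : 1 < z)
  have hM2 : (2 : ℝ) ≤ M := by exact_mod_cast (by omega : 2 ≤ M)
  have hzM' : (z : ℝ) ≤ M := by exact_mod_cast hzM
  have hlz : 0 < Real.log z := Real.log_pos hz1
  rw [le_div_iff₀ hlz]
  have e1 : ∑ k ∈ Icc 1 M, roughInd z k / k = ∑ k ∈ Icc 1 M with IsRough z k, (1 : ℝ) / k := by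
    rw [sum_filter]
    refine sum_congr rfl fun k _ => ?_
    unfold roughInd
    split_ifs <;> simp
  calc (∑ k ∈ Icc 1 M, roughInd z k / k) * Real.log z
      ≤ (∑ k ∈ Icc 1 M with IsRough z k, (1 : ℝ) / k) * ∑ n ∈ Icc 1 z, (1 : ℝ) / n := by
        rw [e1]
        exact mul_le_mul_of_nonneg_left (log_le_sum_one_div z (by omega))
          (sum_nonneg fun _ _ => by positivity)
    _ = ∑ q ∈ (Icc 1 M).filter (IsRough z) ×ˢ Icc 1 z, (1 : ℝ) / ((q.2 * q.1 : ℕ) : ℝ) := by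
        rw [sum_mul_sum, sum_product]
        refine sum_congr rfl fun a _ => sum_congr rfl fun b _ => ?_
        push_cast
        rw [one_div_mul_one_div, mul_comm]
    _ ≤ ∑ n ∈ Icc 1 (z * M), (1 : ℝ) / n := by
        rw [← sum_image (s := (Icc 1 M).filter (IsRough z) ×ˢ Icc 1 z)
          (g := fun q : ℕ × ℕ => q.2 * q.1) (f := fun n : ℕ => (1 : ℝ) / n)]
        · refine sum_le_sum_of_subset_of_nonneg ?_ (fun _ _ _ => by positivity)
          intro n hn
          simp only [mem_image, mem_product, mem_filter, mem_Icc] at hn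
          obtain ⟨q, ⟨⟨⟨h1, h2⟩, _⟩, h3, h4⟩, rfl⟩ := hn
          rw [mem_Icc]
          exact ⟨Nat.mul_pos h3 h1, Nat.mul_le_mul h4 h2⟩
        · rintro ⟨k, m⟩ hq ⟨k', m'⟩ hq' h
          simp only [coe_product, coe_filter, Set.mem_prod, Set.mem_ofPred_eq, mem_Icc, coe_Icc,
            Set.mem_Icc] at hq hq' h
          have h1 := dvd_of_mul_eq_rough hq.2.1 hq.2.2 hq'.1.2 h
          have h2 := dvd_of_mul_eq_rough hq'.2.1 hq'.2.2 hq.1.2 h.symm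
          have h3 := Nat.dvd_antisymm h1 h2
          subst h3
          have := Nat.eq_of_mul_eq_mul_left hq.2.1 h
          simp [this]
    _ ≤ 1 + Real.log ((z * M : ℕ) : ℝ) := sum_one_div_le _
    _ ≤ 4 * Real.log M := by
        push_cast
        rw [Real.log_mul (by positivity) (by positivity)]
        have h1 := Real.log_le_log (by positivity) hzM'
        have h2 := Real.log_le_log (by norm_num) hM2
        have := Real.log_two_gt_d9
        linarith

/-- On all intervals `(X, X+h]` with `h ≥ H`, the mean of `g` is at most `β`. -/
def AvgBd (g : ℕ → ℝ) (β : ℝ) (H : ℕ) : Prop :=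
  ∀ X h : ℕ, H ≤ h → ∑ n ∈ Ioc X (X + h), g n ≤ β * h

/-- Truncated Dirichlet convolution. -/
noncomputable def tconv (Y : ℕ) (u g : ℕ → ℝ) (n : ℕ) : ℝ :=
  ∑ m ∈ Icc 1 Y, if m ∣ n then u m * g (n / m) else 0

lemma tconv_nonneg {Y : ℕ} {u g : ℕ → ℝ} (hu : ∀ n, 0 ≤ u n) (hg : ∀ n, 0 ≤ g n) (n : ℕ) :
    0 ≤ tconv Y u g n :=
  sum_nonneg fun m _ => by split_ifs; exacts [mul_nonneg (hu _) (hg _), le_rfl]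

lemma le_tconv {Y : ℕ} {u g : ℕ → ℝ} (hu : ∀ n, 0 ≤ u n) (hg : ∀ n, 0 ≤ g n) {m k : ℕ}
    (hm : 0 < m) (hmY : m ≤ Y) : u m * g k ≤ tconv Y u g (m * k) := by
  have := single_le_sum (f := fun j => if j ∣ m * k then u j * g (m * k / j) else 0)
    (s := Icc 1 Y) (fun j _ => by split_ifs; exacts [mul_nonneg (hu _) (hg _), le_rfl])
    (mem_Icc.2 ⟨hm, hmY⟩)
  simpa [tconv, Nat.mul_div_cancel_left _ hm] using this

lemma sum_multiples (X h m : ℕ) (hm : 0 < m) (f : ℕ → ℝ) :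
    ∑ n ∈ Ioc X (X + h) with m ∣ n, f (n / m) = ∑ k ∈ Ioc (X / m) ((X + h) / m), f k := by
  refine sum_bij' (fun n _ => n / m) (fun k _ => m * k) ?_ ?_ ?_ ?_ ?_
  · intro n hn
    simp only [mem_filter, mem_Ioc] at hn ⊢
    obtain ⟨⟨h1, h2⟩, k, rfl⟩ := hn
    rw [Nat.mul_div_cancel_left _ hm]
    exact ⟨Nat.div_lt_of_lt_mul h1, (Nat.le_div_iff_mul_le hm).2 (by rw [mul_comm]; exact h2)⟩
  · intro k hk
    simp only [mem_filter, mem_Ioc] at hk ⊢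
    refine ⟨⟨?_, ?_⟩, dvd_mul_right _ _⟩
    · rw [mul_comm]; exact Nat.lt_mul_of_div_lt hk.1 hm
    · rw [mul_comm]; exact (Nat.le_div_iff_mul_le hm).1 hk.2
  · intro n hn
    simp only [mem_filter, mem_Ioc] at hn
    exact Nat.mul_div_cancel' hn.2
  · intro k _
    exact Nat.mul_div_cancel_left _ hm
  · intro n _; rfl

lemma AvgBd.tconv {g u : ℕ → ℝ} {β s : ℝ} {H Y : ℕ} (hg : AvgBd g β H) (hβ : 0 ≤ β) (hH : 1 ≤ H)
    (hu : ∀ n, 0 ≤ u n) (hs : ∑ m ∈ Icc 1 Y, u m / m ≤ s) :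
    AvgBd (tconv Y u g) (2 * s * β) (Y * H) := by
  intro X h hh
  unfold _root_.tconv
  rw [sum_comm]
  have key : ∀ m ∈ Icc 1 Y, (∑ n ∈ Ioc X (X + h), if m ∣ n then u m * g (n / m) else 0) ≤
      2 * β * h * (u m / m) := by
    intro m hm
    simp only [mem_Icc] at hm
    have hm0 : 0 < m := hm.1
    have hm' : (0 : ℝ) < m := by exact_mod_cast hm0
    rw [← sum_filter, ← mul_sum, sum_multiples X h m hm0 g]
    have h1 : H ≤ h / m := by
      rw [Nat.le_div_iff_mul_le hm0]
      nlinarith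
    have h3 : h / m ≤ (X + h) / m - X / m := by
      have : X / m + h / m ≤ (X + h) / m := Nat.div_add_div_le_add_div
      omega
    have h4 : X / m + ((X + h) / m - X / m) = (X + h) / m := by
      have := Nat.div_le_div_right (c := m) (Nat.le_add_right X h)
      omega
    have h5 := hg (X / m) ((X + h) / m - X / m) (h1.trans h3)
    rw [h4] at h5
    have h6 : (X + h) / m - X / m ≤ h / m + 1 := by
      have a1 := Nat.div_add_mod X m
      have a2 := Nat.div_add_mod h m
      have a3 := Nat.mod_lt X hm0
      have a4 := Nat.mod_lt h hm0
      have : (X + h) / m < X / m + h / m + 2 := by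
        rw [Nat.div_lt_iff_lt_mul hm0]
        nlinarith
      omega
    have h7 : (((X + h) / m - X / m : ℕ) : ℝ) ≤ 2 * (h / m) := by
      calc (((X + h) / m - X / m : ℕ) : ℝ) ≤ ((h / m + 1 : ℕ) : ℝ) := by exact_mod_cast h6
        _ ≤ ((2 * (h / m) : ℕ) : ℝ) := by exact_mod_cast (by omega)
        _ ≤ 2 * (h / m) := by
          push_cast
          gcongr
          exact Nat.cast_div_le
    calc u m * ∑ k ∈ Ioc (X / m) ((X + h) / m), g k ≤ u m * (β * (2 * (h / m))) := by
          refine mul_le_mul_of_nonneg_left (h5.trans ?_) (hu m)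
          gcongr
      _ = _ := by ring
  refine (sum_le_sum key).trans ?_
  rw [← mul_sum]
  calc 2 * β * h * ∑ m ∈ Icc 1 Y, u m / m ≤ 2 * β * h * s := by gcongr
    _ = _ := by ring

lemma avgBd_roughInd (z : ℕ) (hz : 2 ≤ z) : AvgBd (roughInd z) (3 / Real.log z) (z ^ 5) := by
  intro X h hh
  refine (sum_roughInd_le z X h hz hh).trans (le_of_eq (by ring))

lemma AvgBd.mono {g g' : ℕ → ℝ} {β β' : ℝ} {H H' : ℕ} (hg : AvgBd g β H) (h1 : β ≤ β')
    (h2 : H ≤ H') (h3 : ∀ n, g' n ≤ g n) : AvgBd g' β' H' := fun X h hh =>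
  (sum_le_sum fun n _ => h3 n).trans ((hg X h (h2.trans hh)).trans (by gcongr))

lemma AvgBd.add {g g' : ℕ → ℝ} {β β' : ℝ} {H : ℕ} (hg : AvgBd g β H) (hg' : AvgBd g' β' H) :
    AvgBd (fun n => g n + g' n) (β + β') H := fun X h hh => by
  rw [sum_add_distrib, add_mul]
  exact add_le_add (hg X h hh) (hg' X h hh)

lemma AvgBd.const_mul {g : ℕ → ℝ} {β c : ℝ} {H : ℕ} (hg : AvgBd g β H) (hc : 0 ≤ c) :
    AvgBd (fun n => c * g n) (c * β) H := fun X h hh => by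
  rw [← mul_sum, mul_assoc]
  exact mul_le_mul_of_nonneg_left (hg X h hh) hc

lemma AvgBd.sum {ι : Type*} {g : ι → ℕ → ℝ} {β : ι → ℝ} {H : ℕ} {s : Finset ι}
    (hg : ∀ i ∈ s, AvgBd (g i) (β i) H) :
    AvgBd (fun n => ∑ i ∈ s, g i n) (∑ i ∈ s, β i) H := fun X h hh => by
  rw [sum_comm, sum_mul]
  exact sum_le_sum fun i hi => hg i hi X h hh

/-- `∑_{d ∣ n} μ(d) F(log (n/d))`. -/
noncomputable def mobSum (F : ℝ → ℝ) (n : ℕ) : ℝ :=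
  ∑ d ∈ n.divisors, (ArithmeticFunction.moebius d : ℝ) * F (Real.log ((n / d : ℕ) : ℝ))

/-- Forward difference. -/
def fdiff (h : ℝ) (F : ℝ → ℝ) (w : ℝ) : ℝ := F (w + h) - F w

lemma mobSum_peel (F : ℝ → ℝ) {q b m : ℕ} (hq : q.Prime) (hm : 0 < m) (hqm : ¬ q ∣ m) :
    mobSum F (q ^ (b + 1) * m) =
      mobSum (fun w => fdiff (Real.log q) F (w + b * Real.log q)) m := by
  classical
  have hq0 : 0 < q := hq.pos
  set n := q ^ (b + 1) * m with hn
  have hn0 : n ≠ 0 := by positivity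
  have hcop : ∀ e, e ∣ m → Nat.Coprime q e := fun e he =>
    (Nat.Prime.coprime_iff_not_dvd hq).2 fun h => hqm (h.trans he)
  have hdis : Disjoint m.divisors (m.divisors.image (q * ·)) := by
    rw [disjoint_left]
    intro d hd hd'
    simp only [mem_image] at hd'
    obtain ⟨e, _, rfl⟩ := hd'
    exact hqm ((dvd_mul_right q e).trans (Nat.dvd_of_mem_divisors hd))
  have hsub : m.divisors ∪ m.divisors.image (q * ·) ⊆ n.divisors := by
    intro d hd
    rw [mem_union, mem_image] at hd
    rw [Nat.mem_divisors]
    refine ⟨?_, hn0⟩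
    rcases hd with hd | ⟨e, he, rfl⟩
    · exact (Nat.dvd_of_mem_divisors hd).trans (dvd_mul_left _ _)
    · rw [hn]
      exact mul_dvd_mul (dvd_pow_self q (by omega)) (Nat.dvd_of_mem_divisors he)
  unfold mobSum
  rw [← sum_subset hsub, sum_union hdis, sum_image, ← sum_add_distrib]
  · refine sum_congr rfl fun e he => ?_
    have hem := Nat.dvd_of_mem_divisors he
    have he0 : 0 < e := Nat.pos_of_dvd_of_pos hem hm
    have h1 : n / e = q ^ (b + 1) * (m / e) := by rw [hn, Nat.mul_div_assoc _ hem]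
    have h2 : n / (q * e) = q ^ b * (m / e) := by
      rw [hn, pow_succ, mul_comm (q ^ b) q, mul_assoc, Nat.mul_div_mul_left _ _ hq0,
        Nat.mul_div_assoc _ hem]
    have hme : ((m / e : ℕ) : ℝ) ≠ 0 := by
      have := Nat.div_pos (Nat.le_of_dvd hm hem) he0
      exact_mod_cast this.ne'
    have hqr : (q : ℝ) ≠ 0 := by exact_mod_cast hq0.ne'
    rw [h1, h2, ArithmeticFunction.isMultiplicative_moebius.map_mul_of_coprime (hcop e hem),
      ArithmeticFunction.moebius_apply_prime hq]
    push_cast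
    rw [Real.log_mul (by positivity) hme, Real.log_mul (by positivity) hme, Real.log_pow,
      Real.log_pow]
    unfold fdiff
    push_cast
    have e1 : (b + 1) * Real.log q + Real.log ((m / e : ℕ) : ℝ) =
      Real.log ((m / e : ℕ) : ℝ) + b * Real.log q + Real.log q := by ring
    have e2 : b * Real.log q + Real.log ((m / e : ℕ) : ℝ) =
      Real.log ((m / e : ℕ) : ℝ) + b * Real.log q := by ring
    rw [e1, e2]
    ring
  · intro a _ b _ hab
    exact Nat.eq_of_mul_eq_mul_left hq0 hab
  · intro d hd hd'
    rw [mem_union, mem_image, not_or] at hd'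
    have hdn := Nat.dvd_of_mem_divisors hd
    have : ArithmeticFunction.moebius d = 0 := by
      apply ArithmeticFunction.moebius_eq_zero_of_not_squarefree
      intro hsf
      by_cases hqd : q ∣ d
      · obtain ⟨e, rfl⟩ := hqd
        have hqe : ¬ q ∣ e := by
          intro h
          have := hsf q (mul_dvd_mul_left q h)
          exact hq.one_lt.ne' (Nat.isUnit_iff.1 this)
        refine hd'.2 ⟨e, ?_, rfl⟩
        rw [Nat.mem_divisors]
        refine ⟨?_, hm.ne'⟩
        have hc : Nat.Coprime e (q ^ (b + 1)) :=
          Nat.Coprime.pow_right _ ((Nat.Prime.coprime_iff_not_dvd hq).2 hqe).symm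
        exact hc.dvd_of_dvd_mul_left ((dvd_mul_left e q).trans hdn)
      · refine hd'.1 ?_
        rw [Nat.mem_divisors]
        refine ⟨?_, hm.ne'⟩
        have hc : Nat.Coprime d (q ^ (b + 1)) :=
          Nat.Coprime.pow_right _ ((Nat.Prime.coprime_iff_not_dvd hq).2 hqd).symm
        exact hc.dvd_of_dvd_mul_left hdn
    rw [this]; simp

lemma mobSum_eq_zero {F : ℝ → ℝ} (h : ∀ w, 0 ≤ w → F w = 0) (n : ℕ) : mobSum F n = 0 :=
  sum_eq_zero fun d _ => by rw [h _ (Real.log_natCast_nonneg _), mul_zero]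

/-- Iterated forward differences of `F` on `[0, ∞)` are bounded by the listed constants times the
product of the increments. -/
def DiffBd : List ℝ → (ℝ → ℝ) → Prop
  | [], _ => True
  | b :: bs, F => (∀ w, 0 ≤ w → |F w| ≤ b) ∧ ∀ h, 0 ≤ h → DiffBd (bs.map (h * ·)) (fdiff h F)
termination_by l => l.length

lemma DiffBd.nil (F : ℝ → ℝ) : DiffBd [] F := by rw [DiffBd]; trivial

lemma diffBd_cons {b : ℝ} {bs : List ℝ} {F : ℝ → ℝ} : DiffBd (b :: bs) F ↔
    (∀ w, 0 ≤ w → |F w| ≤ b) ∧ ∀ h, 0 ≤ h → DiffBd (bs.map (h * ·)) (fdiff h F) := by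
  rw [DiffBd]

lemma DiffBd.shift {bs : List ℝ} {F : ℝ → ℝ} (hF : DiffBd bs F) {s : ℝ} (hs : 0 ≤ s) :
    DiffBd bs (fun w => F (w + s)) := by
  induction hk : bs.length generalizing bs F with
  | zero => rw [List.length_eq_zero_iff.1 hk]; exact .nil _
  | succ k ih =>
    match bs, hk with
    | b :: bs, hk =>
    rw [diffBd_cons] at hF ⊢
    refine ⟨fun w hw => hF.1 _ (by positivity), fun h hh => ?_⟩
    have := ih (hF.2 h hh) (by simpa using hk)
    convert this using 2 with w
    simp only [fdiff]
    rw [add_right_comm]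

lemma DiffBd.integrate {bs : List ℝ} {F F' : ℝ → ℝ} (hF : ∀ w, HasDerivAt F (F' w) w)
    (hF' : DiffBd bs F') {b : ℝ} (hb : ∀ w, 0 ≤ w → |F w| ≤ b) : DiffBd (b :: bs) F := by
  induction hk : bs.length generalizing bs F F' b with
  | zero =>
    rw [List.length_eq_zero_iff.1 hk, diffBd_cons]
    exact ⟨hb, fun h _ => .nil _⟩
  | succ k ih =>
    match bs, hk with
    | c :: cs, hk =>
    rw [diffBd_cons]
    refine ⟨hb, fun h hh => ?_⟩
    rw [diffBd_cons] at hF'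
    refine ih (F' := fdiff h F') (fun w => ?_) (hF'.2 h hh) (fun w hw => ?_) (by simpa using hk)
    · exact ((hF (w + h)).comp_add_const w h).sub (hF w)
    · have := Convex.norm_image_sub_le_of_norm_hasDerivWithin_le (f := F) (f' := F') (s := Set.Ici 0)
        (C := c) (x := w) (y := w + h) (fun x _ => (hF x).hasDerivWithinAt)
        (fun x hx => hF'.1 x hx) (convex_Ici 0) hw (by simp only [Set.mem_Ici]; linarith)
      simp only [Real.norm_eq_abs, add_sub_cancel_left, abs_of_nonneg hh] at this
      simp only [fdiff]; linarith

lemma hasDerivAt_max_pow (k : ℕ) (x : ℝ) :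
    HasDerivAt (fun x : ℝ => max x 0 ^ (k + 2)) ((k + 2) * max x 0 ^ (k + 1)) x := by
  have hpos : HasDerivAt (fun x : ℝ => x ^ (k + 2)) ((k + 2) * x ^ (k + 1)) x := by
    have := hasDerivAt_pow (k + 2) x
    simpa using this
  rcases lt_trichotomy x 0 with h | h | h
  · have : max x 0 = 0 := max_eq_right h.le
    rw [this, zero_pow (by omega), mul_zero]
    refine (hasDerivAt_const x (0 : ℝ)).congr_of_eventuallyEq ?_
    filter_upwards [Iio_mem_nhds h] with y hy
    rw [max_eq_right (le_of_lt hy), zero_pow (by omega)]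
  · subst h
    rw [← hasDerivWithinAt_univ, ← Set.Iic_union_Ici (a := (0 : ℝ))]
    refine HasDerivWithinAt.union ?_ ?_
    · have := (hasDerivAt_const (0 : ℝ) (0 : ℝ)).hasDerivWithinAt (s := Set.Iic 0)
      simp only [max_self, ne_eq, Nat.succ_ne_zero, not_false_eq_true, zero_pow, mul_zero]
      refine this.congr (fun y hy => ?_) ?_
      · rw [max_eq_right hy, zero_pow (by omega)]
      · simp
    · have := hpos.hasDerivWithinAt (s := Set.Ici 0)
      rw [max_self]
      refine this.congr (fun y hy => ?_) ?_
      · rw [max_eq_left hy]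
      · simp
  · rw [max_eq_left h.le]
    refine hpos.congr_of_eventuallyEq ?_
    filter_upwards [Ioi_mem_nhds h] with y hy
    rw [max_eq_left (le_of_lt hy)]

lemma hasDerivAt_max_sub_pow (k : ℕ) (a w : ℝ) :
    HasDerivAt (fun w : ℝ => max (a - w) 0 ^ (k + 2)) (-((k + 2) * max (a - w) 0 ^ (k + 1))) w := by
  have := (hasDerivAt_max_pow k (a - w)).comp w ((hasDerivAt_id w).const_sub a)
  simpa [Function.comp_def] using this

/-- The truncated cube `(a - w)₊³`. -/
noncomputable def cubePart (a w : ℝ) : ℝ := max (a - w) 0 ^ 3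

lemma diffBd_cubePart {a l : ℝ} (ha : 0 ≤ a) (hal : a ≤ l) :
    DiffBd [l ^ 3, 3 * l ^ 2, 6 * l, 6] (cubePart a) := by
  have hm : ∀ w, 0 ≤ w → max (a - w) 0 ≤ l := fun w hw => max_le (by linarith) (ha.trans hal)
  have hn : ∀ w, 0 ≤ max (a - w) 0 := fun w => le_max_right _ _
  refine DiffBd.integrate (F' := fun w => -(3 * max (a - w) 0 ^ 2)) (fun w => ?_) ?_ fun w hw => ?_
  · have := hasDerivAt_max_sub_pow 1 a w
    norm_num at this
    exact this
  · refine DiffBd.integrate (F' := fun w => 6 * max (a - w) 0) (fun w => ?_) ?_ fun w hw => ?_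
    · have := ((hasDerivAt_max_sub_pow 0 a w).const_mul (-3))
      norm_num at this
      have e : 6 * max (a - w) 0 = 3 * (2 * max (a - w) 0) := by ring
      rw [e]
      exact this
    · rw [diffBd_cons]
      refine ⟨fun w hw => ?_, fun h hh => ?_⟩
      · rw [abs_of_nonneg (by have := hn w; positivity)]
        have := hm w hw
        linarith
      · simp only [List.map_cons, List.map_nil]
        rw [diffBd_cons]
        refine ⟨fun w hw => ?_, fun h hh => by simp [DiffBd.nil]⟩
        have h1 := abs_max_sub_max_le_abs (a - (w + h)) (a - w) 0
        have h2 : a - (w + h) - (a - w) = -h := by ring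
        rw [h2, abs_neg, abs_of_nonneg hh] at h1
        unfold fdiff
        rw [← mul_sub, abs_mul, abs_of_nonneg (by norm_num : (0 : ℝ) ≤ 6)]
        linarith
    · rw [abs_neg, abs_of_nonneg (by have := hn w; positivity)]
      have := pow_le_pow_left₀ (hn w) (hm w hw) 2
      linarith
  · unfold cubePart
    rw [abs_of_nonneg (by have := hn w; positivity)]
    exact pow_le_pow_left₀ (hn w) (hm w hw) 3

lemma roughInd_of_isRough {z n : ℕ} (h : IsRough z n) : roughInd z n = 1 := by
  unfold roughInd; rw [if_pos h]

lemma IsRough.of_dvd {z n m : ℕ} (h : IsRough z n) (hm : m ∣ n) : IsRough z m :=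
  fun p hp hpm => h p hp (hpm.trans hm)

lemma exists_peel {p M n : ℕ} (hn : 0 < n) (hp : IsRough p n) (hM : ¬ IsRough M n) :
    ∃ q b m : ℕ, q.Prime ∧ p < q ∧ q ≤ M ∧ 0 < m ∧ n = q ^ (b + 1) * m ∧ ¬ q ∣ m ∧ IsRough q m := by
  have hn1 : n ≠ 1 := by
    rintro rfl
    exact hM fun r hr h1 => absurd (Nat.dvd_one.1 h1) hr.one_lt.ne'
  have hq : n.minFac.Prime := Nat.minFac_prime hn1
  have hqn := Nat.minFac_dvd n
  obtain ⟨e, m, hqm, hnm⟩ := Nat.exists_eq_pow_mul_and_not_dvd hn.ne' n.minFac hq.one_lt.ne'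
  have he : e ≠ 0 := by
    rintro rfl
    rw [pow_zero, one_mul] at hnm
    exact hqm (hnm ▸ hqn)
  have hm : 0 < m := by
    rcases Nat.eq_zero_or_pos m with rfl | h
    · simp at hqm
    · exact h
  refine ⟨n.minFac, e - 1, m, hq, hp _ hq hqn, ?_, hm, ?_, hqm, ?_⟩
  · by_contra hlt
    refine hM fun r hr hrn => ?_
    have := Nat.minFac_le_of_dvd hr.two_le hrn
    omega
  · rw [Nat.sub_add_cancel (Nat.one_le_iff_ne_zero.2 he)]; exact hnm
  · intro r hr hrm
    have h1 := Nat.minFac_le_of_dvd hr.two_le (hrm.trans (hnm ▸ dvd_mul_left m _))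
    have h2 : r ≠ n.minFac := by rintro rfl; exact hqm hrm
    omega

lemma abs_mobSum_le_of_isRough {F : ℝ → ℝ} {M n : ℕ} {b : ℝ} (hM : 0 < M) (hn : 0 < n)
    (hr : IsRough M n) (hF : |F 0| ≤ b) (hv : ∀ w, Real.log M ≤ w → F w = 0) :
    |mobSum F n| ≤ b := by
  have : mobSum F n = ArithmeticFunction.moebius n * F 0 := by
    unfold mobSum
    rw [sum_eq_single n]
    · rw [Nat.div_self hn]; simp
    · intro d hd hdn
      have hdd := Nat.dvd_of_mem_divisors hd
      obtain ⟨e, he⟩ := hdd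
      have hd0 : 0 < d := Nat.pos_of_mem_divisors hd
      have h1 : n / d = e := by rw [he, Nat.mul_div_cancel_left _ hd0]
      have he1 : e ≠ 1 := by rintro rfl; exact hdn (by rw [he, mul_one])
      have he0 : 0 < e := Nat.pos_of_ne_zero (by rintro rfl; simp at he; omega)
      have h2 := hr e.minFac (Nat.minFac_prime he1) ((Nat.minFac_dvd e).trans (he ▸ dvd_mul_left e d))
      have h3 := Nat.minFac_le he0
      rw [h1, hv, mul_zero]
      exact Real.log_le_log (by exact_mod_cast hM) (by exact_mod_cast (by omega : M ≤ e))
    · intro h; exact absurd (Nat.mem_divisors_self n hn.ne') h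
  rw [this, abs_mul]
  calc _ ≤ 1 * |F 0| := mul_le_mul_of_nonneg_right (abs_moebius_real_le n) (abs_nonneg _)
    _ ≤ b := by rw [one_mul]; exact hF

lemma abs_mobSum_le_tconv {F : ℝ → ℝ} {M q n : ℕ} {b : ℝ} (hM : 0 < M) (hn : 0 < n)
    (hr : IsRough q n) (hF : ∀ w, 0 ≤ w → |F w| ≤ b) (hv : ∀ w, Real.log M ≤ w → F w = 0) :
    |mobSum F n| ≤ b * tconv M (roughInd q) (roughInd q) n := by
  have hb : 0 ≤ b := (abs_nonneg _).trans (hF 0 le_rfl)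
  calc |mobSum F n| ≤ ∑ d ∈ n.divisors, |F (Real.log ((n / d : ℕ) : ℝ))| := by
        refine (abs_sum_le_sum_abs _ _).trans (sum_le_sum fun d _ => ?_)
        rw [abs_mul]
        exact mul_le_of_le_one_left (abs_nonneg _) (abs_moebius_real_le d)
    _ = ∑ k ∈ n.divisors, |F (Real.log (k : ℝ))| :=
        Nat.sum_div_divisors n (fun k => |F (Real.log (k : ℝ))|)
    _ ≤ ∑ k ∈ (Icc 1 M).filter (· ∣ n), b := by
        have h0 : ∀ k ∈ n.divisors, k ∉ (Icc 1 M).filter (· ∣ n) → |F (Real.log (k : ℝ))| = 0 := by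
          intro k hk hk'
          have hk0 := Nat.pos_of_mem_divisors hk
          simp only [mem_filter, mem_Icc, Nat.dvd_of_mem_divisors hk, and_true] at hk'
          rw [hv, abs_zero]
          exact Real.log_le_log (by exact_mod_cast hM) (by exact_mod_cast (by omega : M ≤ k))
        have h1 : (Icc 1 M).filter (· ∣ n) ⊆ n.divisors := fun k hk => by
          rw [mem_filter] at hk
          exact Nat.mem_divisors.2 ⟨hk.2, hn.ne'⟩
        rw [← sum_subset h1 h0]
        exact sum_le_sum fun k _ => hF _ (Real.log_natCast_nonneg _)
    _ = b * tconv M (roughInd q) (roughInd q) n := by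
        unfold tconv
        rw [sum_filter, mul_sum]
        refine sum_congr rfl fun k _ => ?_
        split_ifs with hk
        · rw [roughInd_of_isRough (hr.of_dvd hk), roughInd_of_isRough (hr.of_dvd (Nat.div_dvd_of_dvd hk))]
          ring
        · simp

/-- `Λ` restricted to powers of the prime `q`. -/
noncomputable def mangoldtAt (q m : ℕ) : ℝ := if m.minFac = q then vonMangoldt m else 0

/-- `Λ` restricted to powers of primes less than `q`. -/
noncomputable def mangoldtBelow (q m : ℕ) : ℝ := if m.minFac < q then vonMangoldt m else 0

lemma mangoldtAt_nonneg (q m : ℕ) : 0 ≤ mangoldtAt q m := by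
  unfold mangoldtAt; split_ifs; exacts [ArithmeticFunction.vonMangoldt_nonneg, le_rfl]

lemma mangoldtBelow_nonneg (q m : ℕ) : 0 ≤ mangoldtBelow q m := by
  unfold mangoldtBelow; split_ifs; exacts [ArithmeticFunction.vonMangoldt_nonneg, le_rfl]

lemma vonMangoldt_prime_pow {q : ℕ} (hq : q.Prime) (b : ℕ) :
    vonMangoldt (q ^ (b + 1)) = Real.log q := by
  rw [ArithmeticFunction.vonMangoldt_apply_pow (by omega), ArithmeticFunction.vonMangoldt_apply_prime hq]

lemma mangoldtAt_pow {q : ℕ} (hq : q.Prime) (b : ℕ) : mangoldtAt q (q ^ (b + 1)) = Real.log q := by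
  unfold mangoldtAt
  rw [if_pos (hq.pow_minFac (by omega)), vonMangoldt_prime_pow hq]

lemma mangoldtBelow_pow {q r : ℕ} (hq : q.Prime) (hqr : q < r) (b : ℕ) :
    mangoldtBelow r (q ^ (b + 1)) = Real.log q := by
  unfold mangoldtBelow
  rw [if_pos (by rw [hq.pow_minFac (by omega)]; exact hqr), vonMangoldt_prime_pow hq]

lemma sum_mangoldtAt_div_le {q : ℕ} (hq : q.Prime) (Y : ℕ) :
    ∑ m ∈ Icc 1 Y, mangoldtAt q m / m ≤ 2 * Real.log q / q := by
  classical
  have hq2 : (2 : ℝ) ≤ q := by exact_mod_cast hq.two_le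
  have hlq : 0 ≤ Real.log q := Real.log_natCast_nonneg _
  calc ∑ m ∈ Icc 1 Y, mangoldtAt q m / m
      ≤ ∑ m ∈ (range Y).image (fun b => q ^ (b + 1)), mangoldtAt q m / m := by
        have h0 : ∀ m ∈ Icc 1 Y, m ∉ (Icc 1 Y).filter (fun m => mangoldtAt q m ≠ 0) →
            mangoldtAt q m / m = 0 := by
          intro m hm hm'
          simp only [mem_filter, hm, true_and, not_not] at hm'
          rw [hm', zero_div]
        rw [← sum_subset (filter_subset (fun m => mangoldtAt q m ≠ 0) _) h0]
        refine sum_le_sum_of_subset_of_nonneg ?_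
          (fun m _ _ => div_nonneg (mangoldtAt_nonneg _ _) (Nat.cast_nonneg _))
        intro m hm
        simp only [mem_filter, mem_Icc, mangoldtAt, ne_eq, ite_eq_right_iff, Classical.not_imp,
          ArithmeticFunction.vonMangoldt_eq_zero_iff, not_not] at hm
        obtain ⟨⟨hm1, hmY⟩, hmq, hpp⟩ := hm
        obtain ⟨k, hk0, hk⟩ := (isPrimePow_iff_minFac_pow_factorization_eq hpp.ne_one).1 hpp |> fun h =>
          (⟨m.factorization m.minFac, Nat.pos_of_ne_zero (fun h0 => by
            rw [h0, pow_zero] at h; exact hpp.ne_one h.symm), h⟩ :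
            ∃ k, 0 < k ∧ m.minFac ^ k = m)
        rw [mem_image]
        refine ⟨k - 1, ?_, ?_⟩
        · rw [mem_range]
          have : k < q ^ k := Nat.lt_pow_self hq.one_lt
          rw [hmq] at hk
          omega
        · rw [Nat.sub_add_cancel hk0, ← hmq, hk]
    _ = ∑ b ∈ range Y, Real.log q * (1 / q) * (1 / q) ^ b := by
        rw [sum_image]
        · refine sum_congr rfl fun b _ => ?_
          rw [mangoldtAt_pow hq]
          push_cast
          rw [pow_succ, one_div_pow]
          field_simp
        · intro a _ b _ hab
          have := Nat.pow_right_injective hq.two_le hab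
          omega
    _ ≤ Real.log q * (1 / q) * 2 := by
        rw [← mul_sum]
        refine mul_le_mul_of_nonneg_left ?_ (by positivity)
        have hr : (1 : ℝ) / q ≤ 1 / 2 := by gcongr
        calc ∑ b ∈ range Y, ((1 : ℝ) / q) ^ b ≤ ∑ b ∈ range Y, ((1 : ℝ) / 2) ^ b :=
            sum_le_sum fun b _ => by gcongr
          _ ≤ 2 := sum_geometric_two_le Y
    _ = _ := by ring

lemma sum_primes_log_div_le (q : ℕ) (hq : 0 < q) :
    ∑ p ∈ Icc 1 q with p.Prime, Real.log p / p ≤ Real.log q + 6 := by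
  refine le_trans ?_ (sum_vonMangoldt_div_le q hq)
  have : Ioc 0 q = Icc 1 q := by ext; simp; omega
  rw [this, sum_filter]
  refine sum_le_sum fun p _ => ?_
  split_ifs with hp
  · rw [ArithmeticFunction.vonMangoldt_apply_prime hp]
  · exact div_nonneg ArithmeticFunction.vonMangoldt_nonneg (Nat.cast_nonneg _)

lemma log_add_six_le {q : ℕ} (hq : 2 ≤ q) : Real.log q + 6 ≤ 10 * Real.log q := by
  have h1 := Real.log_le_log (by norm_num) (by exact_mod_cast hq : (2 : ℝ) ≤ q)
  have := Real.log_two_gt_d9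
  linarith

lemma sum_mangoldtBelow_div_le {q : ℕ} (hq : 2 ≤ q) (Y : ℕ) :
    ∑ m ∈ Icc 1 Y, mangoldtBelow q m / m ≤ 20 * Real.log q := by
  have h1 : ∀ m ∈ Icc 1 Y, mangoldtBelow q m / m ≤
      ∑ p ∈ Icc 1 q with p.Prime, mangoldtAt p m / m := by
    intro m hm
    by_cases h : m.minFac < q ∧ m ≠ 1
    · have := single_le_sum (f := fun p => mangoldtAt p m / m) (s := (Icc 1 q).filter Nat.Prime)
        (fun p _ => div_nonneg (mangoldtAt_nonneg _ _) (Nat.cast_nonneg _))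
        (a := m.minFac) (by
          rw [mem_filter, mem_Icc]
          exact ⟨⟨Nat.minFac_pos m, h.1.le⟩, Nat.minFac_prime h.2⟩)
      refine le_trans (le_of_eq ?_) this
      simp [mangoldtAt, mangoldtBelow, h.1]
    · have : mangoldtBelow q m = 0 := by
        unfold mangoldtBelow
        by_cases h1 : m = 1
        · simp [h1]
        · rw [if_neg]; tauto
      rw [this, zero_div]
      exact sum_nonneg fun p _ => div_nonneg (mangoldtAt_nonneg _ _) (Nat.cast_nonneg _)
  refine (sum_le_sum h1).trans ?_
  rw [sum_comm]
  calc _ ≤ ∑ p ∈ Icc 1 q with p.Prime, 2 * (Real.log p / p) := sum_le_sum fun p hp => by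
        rw [mem_filter] at hp
        refine (sum_mangoldtAt_div_le hp.2 Y).trans (le_of_eq (by ring))
    _ ≤ 2 * (10 * Real.log q) := by
        rw [← mul_sum]
        have := sum_primes_log_div_le q (by omega)
        have := log_add_six_le hq
        linarith
    _ = _ := by ring

/-- The data of one peeling step. -/
lemma exists_peel_mobSum {F : ℝ → ℝ} {p M n : ℕ} (hn : 0 < n) (hM : 1 ≤ M) (hp : IsRough p n)
    (hMn : ¬ IsRough M n) (hv : ∀ w, Real.log M ≤ w → F w = 0) :
    ∃ q b m : ℕ, ∃ G : ℝ → ℝ, q.Prime ∧ p < q ∧ q ≤ M ∧ 0 < m ∧ n = q ^ (b + 1) * m ∧ IsRough q m ∧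
      mobSum F n = mobSum G m ∧ (q ^ (b + 1) ≤ M ^ 2 ∨ mobSum G m = 0) ∧
      (∀ w, Real.log M ≤ w → G w = 0) ∧
      ∀ b₀ bs, DiffBd (b₀ :: bs) F → DiffBd (bs.map (Real.log q * ·)) G := by
  obtain ⟨q, b, m, hq, hpq, hqM, hm, hnm, hqm, hr⟩ := exists_peel hn hp hMn
  have hlq : 0 ≤ Real.log q := Real.log_natCast_nonneg _
  have hs : 0 ≤ b * Real.log q := by positivity
  refine ⟨q, b, m, fun w => fdiff (Real.log q) F (w + b * Real.log q), hq, hpq, hqM, hm, hnm, hr,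
    ?_, ?_, ?_, ?_⟩
  · rw [hnm, mobSum_peel F hq hm hqm]
  · by_cases hle : q ^ b ≤ M
    · left
      rw [pow_succ, sq]
      exact Nat.mul_le_mul hle hqM
    · right
      refine mobSum_eq_zero (fun w hw => ?_) m
      have h1 : Real.log M ≤ b * Real.log q := by
        rw [← Real.log_pow]
        exact Real.log_le_log (by exact_mod_cast hM) (by exact_mod_cast (not_le.1 hle).le)
      unfold fdiff
      rw [hv _ (by linarith), hv _ (by linarith), sub_zero]
  · intro w hw
    simp only [fdiff]
    rw [hv _ (by linarith), hv _ (by linarith), sub_zero]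
  · intro b₀ bs h
    rw [diffBd_cons] at h
    exact (h.2 _ hlq).shift hs

/-- One-level majorant. -/
lemma abs_mobSum_le_one {F : ℝ → ℝ} {p M n : ℕ} {b₀ b₁ : ℝ} (hn : 0 < n) (hM : 1 ≤ M)
    (hp : IsRough p n) (hv : ∀ w, Real.log M ≤ w → F w = 0) (hb₀ : 0 ≤ b₀) (hb₁ : 0 ≤ b₁)
    (hF : DiffBd [b₀, b₁] F) :
    |mobSum F n| ≤ b₀ * roughInd M n + b₁ * ∑ q ∈ Icc 1 M with q.Prime ∧ p < q,
      tconv (M ^ 2) (mangoldtAt q) (tconv M (roughInd q) (roughInd q)) n := by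
  have hτ : ∀ q n, 0 ≤ tconv M (roughInd q) (roughInd q) n := fun q =>
    tconv_nonneg (roughInd_nonneg q) (roughInd_nonneg q)
  have hT : ∀ q n, 0 ≤ tconv (M ^ 2) (mangoldtAt q) (tconv M (roughInd q) (roughInd q)) n :=
    fun q => tconv_nonneg (mangoldtAt_nonneg q) (hτ q)
  by_cases hMn : IsRough M n
  · rw [roughInd_of_isRough hMn, mul_one]
    have h1 := abs_mobSum_le_of_isRough hM hn hMn ((diffBd_cons.1 hF).1 0 le_rfl) hv
    have := mul_nonneg hb₁ (sum_nonneg (s := (Icc 1 M).filter (fun q => q.Prime ∧ p < q)) fun q _ => hT q n)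
    linarith
  · obtain ⟨q, b, m, G, hq, hpq, hqM, hm, hnm, hr, heq, hY, hG, hbd⟩ := exists_peel_mobSum hn hM hp hMn hv
    have h0 : 0 ≤ b₀ * roughInd M n := mul_nonneg hb₀ (roughInd_nonneg _ _)
    refine le_trans ?_ (le_add_of_nonneg_left h0)
    rw [heq]
    rcases hY with hY | hY
    · have h1 := hbd _ _ hF
      simp only [List.map_cons, List.map_nil] at h1
      have h2 := abs_mobSum_le_tconv hM hm hr (diffBd_cons.1 h1).1 hG
      have h3 := single_le_sum (f := fun q => tconv (M ^ 2) (mangoldtAt q) (tconv M (roughInd q) (roughInd q)) n)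
        (s := (Icc 1 M).filter (fun q => q.Prime ∧ p < q)) (fun q _ => hT q n) (a := q)
        (by rw [mem_filter, mem_Icc]; exact ⟨⟨hq.pos, hqM⟩, hq, hpq⟩)
      have h4 := le_tconv (Y := M ^ 2) (mangoldtAt_nonneg q) (hτ q) (k := m) (pow_pos hq.pos _) hY
      rw [← hnm, mangoldtAt_pow hq] at h4
      calc _ ≤ _ := h2
        _ = b₁ * (Real.log q * tconv M (roughInd q) (roughInd q) m) := by ring
        _ ≤ _ := mul_le_mul_of_nonneg_left (h4.trans h3) hb₁
    · rw [hY, abs_zero]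
      exact mul_nonneg hb₁ (sum_nonneg fun q _ => hT q n)

/-- Passing from a majorant after one peeling to a majorant before it. -/
lemma abs_mobSum_le_succ {F : ℝ → ℝ} {p M n : ℕ} {b₀ K : ℝ} {bs : List ℝ} {T : ℕ → ℝ} {S : ℕ → ℕ → ℝ}
    (hn : 0 < n) (hM : 1 ≤ M) (hp : IsRough p n) (hv : ∀ w, Real.log M ≤ w → F w = 0)
    (hb₀ : 0 ≤ b₀) (hK : 0 ≤ K) (hT : ∀ n, 0 ≤ T n) (hS : ∀ q n, 0 ≤ S q n)
    (hF : DiffBd (b₀ :: bs) F)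
    (ih : ∀ (G : ℝ → ℝ) (q m : ℕ), 0 < m → IsRough q m → (∀ w, Real.log M ≤ w → G w = 0) →
      DiffBd (bs.map (Real.log q * ·)) G →
      |mobSum G m| ≤ Real.log q * (T m + K * ∑ r ∈ Icc 1 M with r.Prime ∧ q < r, S r m)) :
    |mobSum F n| ≤ b₀ * roughInd M n + tconv (M ^ 2) vonMangoldt T n +
      K * ∑ r ∈ Icc 1 M with r.Prime ∧ p < r, tconv (M ^ 2) (mangoldtBelow r) (S r) n := by
  have hΛ : ∀ n, 0 ≤ vonMangoldt n := fun _ => ArithmeticFunction.vonMangoldt_nonneg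
  have hA : 0 ≤ tconv (M ^ 2) vonMangoldt T n := tconv_nonneg hΛ hT n
  have hB : ∀ r, 0 ≤ tconv (M ^ 2) (mangoldtBelow r) (S r) n := fun r =>
    tconv_nonneg (mangoldtBelow_nonneg r) (hS r) n
  have hB' := mul_nonneg hK (sum_nonneg (s := (Icc 1 M).filter (fun q => q.Prime ∧ p < q)) fun q _ => hB q)
  have h0 : 0 ≤ b₀ * roughInd M n := mul_nonneg hb₀ (roughInd_nonneg _ _)
  by_cases hMn : IsRough M n
  · rw [roughInd_of_isRough hMn, mul_one]
    have h1 := abs_mobSum_le_of_isRough hM hn hMn ((diffBd_cons.1 hF).1 0 le_rfl) hv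
    linarith
  · obtain ⟨q, b, m, G, hq, hpq, hqM, hm, hnm, hr, heq, hY, hG, hbd⟩ := exists_peel_mobSum hn hM hp hMn hv
    rw [heq]
    rcases hY with hY | hY
    · have h1 := ih G q m hm hr hG (hbd _ _ hF)
      have h2 := le_tconv (Y := M ^ 2) hΛ hT (k := m) (pow_pos hq.pos (b + 1)) hY
      rw [← hnm, vonMangoldt_prime_pow hq] at h2
      have h3 : Real.log q * ∑ r ∈ Icc 1 M with r.Prime ∧ q < r, S r m ≤
          ∑ r ∈ Icc 1 M with r.Prime ∧ p < r, tconv (M ^ 2) (mangoldtBelow r) (S r) n := by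
        rw [mul_sum]
        refine le_trans (sum_le_sum fun r hr => ?_) (sum_le_sum_of_subset_of_nonneg
          (fun r hr => ?_) fun r _ _ => hB r)
        · rw [mem_filter] at hr
          have h4 := le_tconv (Y := M ^ 2) (mangoldtBelow_nonneg r) (hS r) (k := m)
            (pow_pos hq.pos (b + 1)) hY
          rwa [← hnm, mangoldtBelow_pow hq hr.2.2] at h4
        · rw [mem_filter] at hr ⊢
          exact ⟨hr.1, hr.2.1, hpq.trans hr.2.2⟩
      have h5 := mul_le_mul_of_nonneg_left h3 hK
      nlinarith
    · rw [hY, abs_zero]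
      linarith

lemma tconv_const_mul (Y : ℕ) (u g : ℕ → ℝ) (c : ℝ) (n : ℕ) :
    tconv Y u (fun n => c * g n) n = c * tconv Y u g n := by
  unfold tconv
  rw [mul_sum]
  refine sum_congr rfl fun m _ => ?_
  split_ifs <;> ring

/-- The majorant kernel attached to a prime `q`, with `k` larger primes below it peeled off. -/
noncomputable def peelKernel (M q : ℕ) : ℕ → ℕ → ℝ
  | 0 => tconv (M ^ 2) (mangoldtAt q) (tconv M (roughInd q) (roughInd q))
  | k + 1 => tconv (M ^ 2) (mangoldtBelow q) (peelKernel M q k)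

lemma peelKernel_nonneg (M q k n : ℕ) : 0 ≤ peelKernel M q k n := by
  induction k generalizing n with
  | zero =>
    exact tconv_nonneg (mangoldtAt_nonneg q)
      (tconv_nonneg (roughInd_nonneg q) (roughInd_nonneg q)) n
  | succ k ih => exact tconv_nonneg (mangoldtBelow_nonneg q) ih n

lemma abs_mobSum_le_two {F : ℝ → ℝ} {p M n : ℕ} {b₀ b₁ b₂ : ℝ} (hn : 0 < n) (hM : 1 ≤ M)
    (hp : IsRough p n) (hv : ∀ w, Real.log M ≤ w → F w = 0) (hb₀ : 0 ≤ b₀) (hb₁ : 0 ≤ b₁)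
    (hb₂ : 0 ≤ b₂) (hF : DiffBd [b₀, b₁, b₂] F) :
    |mobSum F n| ≤ b₀ * roughInd M n + b₁ * tconv (M ^ 2) vonMangoldt (roughInd M) n +
      b₂ * ∑ r ∈ Icc 1 M with r.Prime ∧ p < r, peelKernel M r 1 n := by
  rw [← tconv_const_mul]
  refine abs_mobSum_le_succ (S := fun q => peelKernel M q 0) hn hM hp hv hb₀ hb₂
    (fun n => mul_nonneg hb₁ (roughInd_nonneg _ _)) (fun q n => peelKernel_nonneg _ _ _ _) hF ?_
  intro G q m hm hr hG hbd
  have hlq : 0 ≤ Real.log q := Real.log_natCast_nonneg _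
  simp only [List.map_cons, List.map_nil] at hbd
  refine (abs_mobSum_le_one hm hM hr hG (mul_nonneg hlq hb₁) (mul_nonneg hlq hb₂) hbd).trans ?_
  rw [mul_add, ← mul_assoc, ← mul_assoc]
  rfl

lemma abs_mobSum_le_three {F : ℝ → ℝ} {p M n : ℕ} {b₀ b₁ b₂ b₃ : ℝ} (hn : 0 < n) (hM : 1 ≤ M)
    (hp : IsRough p n) (hv : ∀ w, Real.log M ≤ w → F w = 0) (hb₀ : 0 ≤ b₀) (hb₁ : 0 ≤ b₁)
    (hb₂ : 0 ≤ b₂) (hb₃ : 0 ≤ b₃) (hF : DiffBd [b₀, b₁, b₂, b₃] F) :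
    |mobSum F n| ≤ b₀ * roughInd M n + tconv (M ^ 2) vonMangoldt (fun m =>
      b₁ * roughInd M m + b₂ * tconv (M ^ 2) vonMangoldt (roughInd M) m) n +
      b₃ * ∑ r ∈ Icc 1 M with r.Prime ∧ p < r, peelKernel M r 2 n := by
  have hΛ : ∀ n, 0 ≤ vonMangoldt n := fun _ => ArithmeticFunction.vonMangoldt_nonneg
  refine abs_mobSum_le_succ (S := fun q => peelKernel M q 1) hn hM hp hv hb₀ hb₃
    (fun n => add_nonneg (mul_nonneg hb₁ (roughInd_nonneg _ _))
      (mul_nonneg hb₂ (tconv_nonneg hΛ (roughInd_nonneg _) _)))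
    (fun q n => peelKernel_nonneg _ _ _ _) hF ?_
  intro G q m hm hr hG hbd
  have hlq : 0 ≤ Real.log q := Real.log_natCast_nonneg _
  simp only [List.map_cons, List.map_nil] at hbd
  refine (abs_mobSum_le_two hm hM hr hG (mul_nonneg hlq hb₁) (mul_nonneg hlq hb₂)
    (mul_nonneg hlq hb₃) hbd).trans (le_of_eq (by ring))

lemma avgBd_peelKernel {M q : ℕ} (hM : 2 ≤ M) (hq : q.Prime) (hqM : q ≤ M) :
    AvgBd (peelKernel M q 2) (153600 * Real.log M * (Real.log q / q)) (M ^ 12) := by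
  have hlq : 0 < Real.log q := Real.log_pos (by exact_mod_cast hq.one_lt)
  have hlM : 0 < Real.log M := Real.log_pos (by exact_mod_cast (by omega : 1 < M))
  have hq0 : (0 : ℝ) < q := by exact_mod_cast hq.pos
  have h1 := ((avgBd_roughInd q hq.two_le).tconv (by positivity) (Nat.one_le_pow _ _ hq.pos)
    (roughInd_nonneg q) (sum_roughInd_div_le q M hq.two_le hqM))
  have h2 := h1.tconv (by positivity) (Nat.mul_pos (by omega) (pow_pos hq.pos 5))
    (mangoldtAt_nonneg q) (sum_mangoldtAt_div_le hq (M ^ 2))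
  have h3 := h2.tconv (by positivity) (Nat.mul_pos (pow_pos (by omega) 2)
    (Nat.mul_pos (by omega) (pow_pos hq.pos 5)))
    (mangoldtBelow_nonneg q) (sum_mangoldtBelow_div_le hq.two_le (M ^ 2))
  have h4 := h3.tconv (by positivity) (Nat.mul_pos (pow_pos (by omega) 2)
    (Nat.mul_pos (pow_pos (by omega) 2) (Nat.mul_pos (by omega) (pow_pos hq.pos 5))))
    (mangoldtBelow_nonneg q) (sum_mangoldtBelow_div_le hq.two_le (M ^ 2))
  refine h4.mono (le_of_eq ?_) ?_ (fun n => le_rfl)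
  · field_simp; ring
  · calc M ^ 2 * (M ^ 2 * (M ^ 2 * (M * q ^ 5))) ≤ M ^ 2 * (M ^ 2 * (M ^ 2 * (M * M ^ 5))) := by
          gcongr
      _ = M ^ 12 := by ring

/-- The mean value of the smoothed Möbius sums on short intervals. -/
theorem sum_abs_mobSum_cubePart_le {M X h : ℕ} (hM : 2 ≤ M) (hh : M ^ 12 ≤ h) {a : ℕ → ℝ}
    (ha0 : ∀ n ∈ Ioc X (X + h), 0 ≤ a n) (ha : ∀ n ∈ Ioc X (X + h), a n ≤ Real.log M) :
    ∑ n ∈ Ioc X (X + h), |mobSum (cubePart (a n)) n| ≤ 10 ^ 7 * Real.log M ^ 2 * h := by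
  set l := Real.log M with hl
  have hM1 : (1 : ℝ) < M := by exact_mod_cast (by omega : 1 < M)
  have hl0 : 0 < l := Real.log_pos hM1
  have hΛ : ∀ n, 0 ≤ vonMangoldt n := fun _ => ArithmeticFunction.vonMangoldt_nonneg
  have hM5 : 1 ≤ M ^ 5 := Nat.one_le_pow _ _ (by omega)
  have hs : ∑ m ∈ Icc 1 (M ^ 2), vonMangoldt m / m ≤ 12 * l := by
    have e : Icc 1 (M ^ 2) = Ioc 0 (M ^ 2) := by ext; simp; omega
    have h1 := sum_vonMangoldt_div_le (M ^ 2) (by positivity)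
    have h2 := log_add_six_le hM
    rw [e]
    push_cast at h1
    rw [Real.log_pow] at h1
    push_cast at h1
    linarith
  have hρ := avgBd_roughInd M hM
  have t1 := hρ.tconv (by positivity) hM5 hΛ hs
  have t2 := ((hρ.mono le_rfl (Nat.le_mul_of_pos_left _ (by positivity : 0 < M ^ 2))
    (fun n => le_rfl)).const_mul (c := 3 * l ^ 2) (by positivity)).add
    (t1.const_mul (c := 6 * l) (by positivity))
  have t3 := t2.tconv (by positivity) (Nat.mul_pos (by positivity) hM5) hΛ hs
  have t4 : AvgBd (fun n => 6 * ∑ r ∈ Icc 1 M with r.Prime ∧ 1 < r, peelKernel M r 2 n)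
      (6 * ∑ r ∈ Icc 1 M with r.Prime ∧ 1 < r, 153600 * l * (Real.log r / r)) (M ^ 12) := by
    refine AvgBd.const_mul (AvgBd.sum fun r hr => ?_) (by norm_num)
    simp only [mem_filter, mem_Icc] at hr
    exact avgBd_peelKernel hM hr.2.1 hr.1.2
  have t5 := (((hρ.const_mul (c := l ^ 3) (by positivity)).mono le_rfl
    (Nat.pow_le_pow_right (by omega) (by norm_num : 5 ≤ 12)) (fun n => le_rfl)).add
    (t3.mono le_rfl (show _ ≤ M ^ 12 from ?_) (fun n => le_rfl))).add t4
  · have t6 := t5 X h hh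
    refine (sum_le_sum fun n hn => ?_).trans (t6.trans ?_)
    · have hn0 : 0 < n := by rw [mem_Ioc] at hn; omega
      exact abs_mobSum_le_three (p := 1) hn0 (by omega) (fun p hp _ => hp.one_lt)
        (fun w hw => by
          unfold cubePart
          rw [max_eq_right (by have := ha n hn; linarith), zero_pow (by norm_num)])
        (by positivity) (by positivity) (by positivity) (by norm_num)
        (diffBd_cubePart (ha0 n hn) (ha n hn))
    · refine mul_le_mul_of_nonneg_right ?_ (Nat.cast_nonneg _)
      have h1 : ∑ r ∈ Icc 1 M with r.Prime ∧ 1 < r, 153600 * l * (Real.log r / r) ≤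
          153600 * l * (10 * l) := by
        rw [← mul_sum]
        refine mul_le_mul_of_nonneg_left ?_ (by positivity)
        refine le_trans ?_ ((sum_primes_log_div_le M (by omega)).trans (log_add_six_le hM))
        refine sum_le_sum_of_subset_of_nonneg (fun r hr => ?_) fun r _ _ =>
          div_nonneg (Real.log_natCast_nonneg _) (Nat.cast_nonneg _)
        rw [mem_filter] at hr ⊢
        exact ⟨hr.1, hr.2.1⟩
      have e1 : l ^ 3 * (3 / l) = 3 * l ^ 2 := by field_simp
      have e2 : 2 * (12 * l) * (3 * l ^ 2 * (3 / l) + 6 * l * (2 * (12 * l) * (3 / l))) =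
          10584 * l ^ 2 := by field_simp; ring
      rw [e1, e2]
      nlinarith [sq_nonneg l]
  · calc M ^ 2 * (M ^ 2 * M ^ 5) = M ^ 9 := by ring
      _ ≤ M ^ 12 := Nat.pow_le_pow_right (by omega) (by norm_num)

/-- The summatory function of `Λ`. -/
noncomputable def psiSum (n : ℕ) : ℝ := ∑ d ∈ Ioc 0 n, vonMangoldt d

lemma psiSum_nonneg (n : ℕ) : 0 ≤ psiSum n :=
  sum_nonneg fun _ _ => ArithmeticFunction.vonMangoldt_nonneg

lemma sum_log_le_stirling {n : ℕ} (hn : 1 ≤ n) :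
    ∑ m ∈ Ioc 0 n, Real.log m ≤ (n + 1) * Real.log n - n + 1 := by
  induction n, hn using Nat.le_induction with
  | base => simp
  | succ n hn ih =>
    rw [sum_Ioc_succ_top (Nat.zero_le n)]
    have hn0 : (0 : ℝ) < n := by exact_mod_cast hn
    have h1 : 1 - ((n : ℝ) / (n + 1)) ≤ Real.log ((n + 1) / n) := by
      have := Real.one_sub_inv_le_log_of_pos (x := ((n : ℝ) + 1) / n) (by positivity)
      rwa [inv_div] at this
    rw [Real.log_div (by positivity) (by positivity)] at h1
    have h2 : 1 - ((n : ℝ) / (n + 1)) = 1 / (n + 1) := by field_simp; ring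
    rw [h2, div_le_iff₀ (by positivity)] at h1
    push_cast
    nlinarith

lemma sum_dvd_swap (x : ℕ) (f : ℕ → ℕ → ℝ) :
    ∑ d ∈ Ioc 0 x, ∑ n ∈ Ioc 0 (x / d), f d (d * n) = ∑ m ∈ Ioc 0 x, ∑ d ∈ m.divisors, f d m := by
  rw [sum_sigma', sum_sigma']
  refine sum_bij' (fun p _ => ⟨p.1 * p.2, p.1⟩) (fun p _ => ⟨p.2, p.1 / p.2⟩) ?_ ?_ ?_ ?_ ?_
  · rintro ⟨d, n⟩ h
    simp only [mem_sigma, mem_Ioc, Nat.mem_divisors] at h ⊢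
    obtain ⟨⟨h1, h2⟩, h3, h4⟩ := h
    have := (Nat.le_div_iff_mul_le h1).1 h4
    exact ⟨⟨by positivity, by rw [mul_comm]; exact this⟩, dvd_mul_right _ _, by positivity⟩
  · rintro ⟨m, d⟩ h
    simp only [mem_sigma, mem_Ioc, Nat.mem_divisors] at h ⊢
    obtain ⟨⟨h1, h2⟩, h3, h4⟩ := h
    have hd := Nat.pos_of_dvd_of_pos h3 h1
    have hle := Nat.le_of_dvd h1 h3
    exact ⟨⟨hd, hle.trans h2⟩, Nat.div_pos hle hd, Nat.div_le_div_right h2⟩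
  · rintro ⟨d, n⟩ h
    simp only [mem_sigma, mem_Ioc] at h
    simp [Nat.mul_div_cancel_left _ h.1.1]
  · rintro ⟨m, d⟩ h
    simp only [mem_sigma, mem_Ioc, Nat.mem_divisors] at h
    simp [Nat.mul_div_cancel' h.2.1]
  · rintro ⟨d, n⟩ h
    rfl

lemma sum_psiSum_div (n : ℕ) : ∑ k ∈ Ioc 0 n, psiSum (n / k) = ∑ m ∈ Ioc 0 n, Real.log m := by
  unfold psiSum
  have h := sum_dvd_swap n (fun d m => vonMangoldt (m / d))
  have h1 : ∀ d ∈ Ioc 0 n, ∑ k ∈ Ioc 0 (n / d), vonMangoldt (d * k / d) =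
      ∑ k ∈ Ioc 0 (n / d), vonMangoldt k := fun d hd => sum_congr rfl fun k _ => by
    rw [Nat.mul_div_cancel_left _ (mem_Ioc.1 hd).1]
  rw [← sum_congr rfl h1, h]
  refine sum_congr rfl fun m _ => ?_
  rw [Nat.sum_div_divisors m (fun d => vonMangoldt d), ArithmeticFunction.vonMangoldt_sum]

lemma sum_mul_sum_div_comm (x : ℕ) (f g : ℕ → ℝ) :
    ∑ d ∈ Ioc 0 x, f d * ∑ n ∈ Ioc 0 (x / d), g n =
      ∑ d ∈ Ioc 0 x, g d * ∑ n ∈ Ioc 0 (x / d), f n := by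
  have key : ∀ f g : ℕ → ℝ, ∑ d ∈ Ioc 0 x, f d * ∑ n ∈ Ioc 0 (x / d), g n =
      ∑ m ∈ Ioc 0 x, ∑ d ∈ m.divisors, f d * g (m / d) := by
    intro f g
    rw [← sum_dvd_swap x (fun d m => f d * g (m / d))]
    refine sum_congr rfl fun d hd => ?_
    rw [mul_sum]
    refine sum_congr rfl fun n _ => ?_
    rw [Nat.mul_div_cancel_left _ (mem_Ioc.1 hd).1]
  rw [key, key]
  refine sum_congr rfl fun m _ => ?_
  rw [← Nat.sum_div_divisors m (fun d => f d * g (m / d))]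
  refine sum_congr rfl fun d hd => ?_
  rw [Nat.div_div_self (Nat.dvd_of_mem_divisors hd) (Nat.ne_zero_of_mem_divisors hd), mul_comm]

lemma abs_sum_psiSum_error {N : ℕ} (hN : 1 ≤ N) {y : ℝ} (h1 : (N : ℝ) ≤ y) (h2 : y < N + 1) :
    |∑ n ∈ Ioc 0 N, (psiSum (N / n) - y / n + (Real.eulerMascheroniConstant + 1))| ≤
      3 * (1 + Real.log y) := by
  set γ := Real.eulerMascheroniConstant with hγ
  have hN0 : (1 : ℝ) ≤ N := by exact_mod_cast hN
  have hl0 : 0 ≤ Real.log N := Real.log_natCast_nonneg _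
  have hly : Real.log N ≤ Real.log y := Real.log_le_log (by linarith) h1
  have hγ0 : (1 : ℝ) / 2 < γ := Real.one_half_lt_eulerMascheroniConstant
  have hγ1 : γ < 2 / 3 := Real.eulerMascheroniConstant_lt_two_thirds
  have e : ∑ n ∈ Ioc 0 N, (psiSum (N / n) - y / n + (γ + 1)) =
      ∑ m ∈ Ioc 0 N, Real.log m - y * (harmonic N : ℝ) + (γ + 1) * N := by
    rw [sum_add_distrib, sum_sub_distrib, sum_psiSum_div, harmonic_eq_sum_Icc]
    have : Icc 1 N = Ioc 0 N := by ext; simp; omega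
    push_cast
    rw [this, mul_sum]
    simp [div_eq_mul_inv]
    ring
  have b1 := sum_log_le_stirling hN
  have b2 := le_sum_log N
  have b3 := Real.eulerMascheroniConstant_lt_eulerMascheroniSeq' N
  rw [Real.eulerMascheroniSeq', if_neg (by omega)] at b3
  have b4 := Real.eulerMascheroniSeq_lt_eulerMascheroniConstant N
  rw [Real.eulerMascheroniSeq] at b4
  have b5 : Real.log (N + 1) ≤ Real.log N + 1 / N := by
    have : Real.log ((N + 1) / N) ≤ (N + 1) / N - 1 := Real.log_le_sub_one_of_pos (by positivity)
    rw [Real.log_div (by positivity) (by positivity)] at this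
    have e : ((N : ℝ) + 1) / N - 1 = 1 / N := by field_simp; ring
    linarith
  have b6 : y * (harmonic N : ℝ) ≤ y * (Real.log N + γ) + 2 := by
    have : (harmonic N : ℝ) ≤ Real.log N + γ + 1 / N := by linarith
    have h3 : y * (1 / N) ≤ 2 := by
      rw [mul_one_div, div_le_iff₀ (by positivity)]; linarith
    nlinarith
  have b7 : y * (Real.log N + γ) ≤ y * (harmonic N : ℝ) := by
    have : Real.log N + γ ≤ (harmonic N : ℝ) := by linarith
    nlinarith
  rw [e, abs_le]
  have b8 : 0 ≤ (y - N) * (Real.log N + γ) := mul_nonneg (by linarith) (by linarith)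
  have b9 : 0 ≤ (N + 1 - y) * (Real.log N + γ) := mul_nonneg (by linarith) (by linarith)
  constructor <;> nlinarith

lemma sum_inv_sqrt_le (x : ℕ) : ∑ d ∈ Ioc 0 x, 1 / √(d : ℝ) ≤ 2 * √(x : ℝ) := by
  induction x with
  | zero => simp
  | succ n ih =>
    rw [sum_Ioc_succ_top (Nat.zero_le n)]
    have h0 : (0 : ℝ) < √((n + 1 : ℕ) : ℝ) := Real.sqrt_pos.2 (by positivity)
    have h1 : √((n : ℝ)) ^ 2 = n := Real.sq_sqrt (Nat.cast_nonneg _)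
    have h2 : √((n + 1 : ℕ) : ℝ) ^ 2 = (n : ℝ) + 1 := by
      rw [Real.sq_sqrt (Nat.cast_nonneg _)]; push_cast; rfl
    have h3 : 1 / √((n + 1 : ℕ) : ℝ) ≤ 2 * √((n + 1 : ℕ) : ℝ) - 2 * √(n : ℝ) := by
      rw [div_le_iff₀ h0]
      nlinarith [sq_nonneg (√((n + 1 : ℕ) : ℝ) - √(n : ℝ))]
    linarith

lemma log_mul_one_add_log_le {u : ℝ} (hu : 1 ≤ u) : Real.log u * (1 + Real.log u) ≤ 16 * √u := by
  have h0 : 0 ≤ Real.log u := Real.log_nonneg hu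
  set v := √(√u) with hv
  have hv1 : v ^ 2 = √u := Real.sq_sqrt (Real.sqrt_nonneg _)
  have hv2 : v ^ 4 = u := by
    rw [show v ^ 4 = (v ^ 2) ^ 2 by ring, hv1, Real.sq_sqrt (by linarith)]
  have hv0 : 1 ≤ v := by
    rw [hv, Real.one_le_sqrt, Real.one_le_sqrt]; exact hu
  have h1 : Real.log u = 4 * Real.log v := by rw [← hv2, Real.log_pow]; norm_num
  have h2 := Real.log_le_sub_one_of_pos (by linarith : 0 < v)
  rw [← hv1]
  nlinarith

lemma sum_log_mul_one_add_log_le (x : ℕ) :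
    ∑ d ∈ Ioc 0 x, Real.log (x / d) * (1 + Real.log (x / d)) ≤ 32 * x := by
  calc _ ≤ ∑ d ∈ Ioc 0 x, 16 * √(x : ℝ) * (1 / √(d : ℝ)) := sum_le_sum fun d hd => by
        rw [mem_Ioc] at hd
        have hd0 : (0 : ℝ) < d := by exact_mod_cast hd.1
        refine (log_mul_one_add_log_le ?_).trans (le_of_eq ?_)
        · rw [le_div_iff₀ hd0, one_mul]; exact_mod_cast hd.2
        · rw [Real.sqrt_div (Nat.cast_nonneg _)]; ring
    _ ≤ 16 * √(x : ℝ) * (2 * √(x : ℝ)) := by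
        rw [← mul_sum]
        exact mul_le_mul_of_nonneg_left (sum_inv_sqrt_le x) (by positivity)
    _ = _ := by
        have := Real.mul_self_sqrt (Nat.cast_nonneg (α := ℝ) x)
        linear_combination 32 * this

lemma sum_moebius_log_div {x : ℕ} (hx : 0 < x) (m : ℕ) :
    ∑ d ∈ m.divisors, (ArithmeticFunction.moebius d : ℝ) * Real.log ((x : ℝ) / d) =
      (if m = 1 then Real.log x else 0) + vonMangoldt m := by
  have h1 := ArithmeticFunction.sum_moebius_mul_log_eq (n := m)
  have h2 := sum_moebius_real m
  have : ∀ d ∈ m.divisors, (ArithmeticFunction.moebius d : ℝ) * Real.log ((x : ℝ) / d) =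
      Real.log x * ArithmeticFunction.moebius d -
        (ArithmeticFunction.moebius d : ℝ) * ArithmeticFunction.log d := by
    intro d hd
    have hd0 := Nat.pos_of_mem_divisors hd
    rw [Real.log_div (by positivity) (by positivity), ArithmeticFunction.log_apply]
    ring
  rw [sum_congr rfl this, sum_sub_distrib, h1, ← mul_sum, h2]
  split_ifs <;> ring

lemma abs_selberg_error {x : ℕ} (hx : 1 ≤ x) :
    |Real.log x * (psiSum x - x + (Real.eulerMascheroniConstant + 1)) +
      ∑ m ∈ Ioc 0 x, vonMangoldt m * (psiSum (x / m) - x / m + (Real.eulerMascheroniConstant + 1))|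
      ≤ 96 * x := by
  set γ := Real.eulerMascheroniConstant with hγ
  have h := sum_dvd_swap x (fun d m => (ArithmeticFunction.moebius d : ℝ) * Real.log ((x : ℝ) / d) *
    (psiSum (x / m) - x / m + (γ + 1)))
  have e1 : ∑ m ∈ Ioc 0 x, ∑ d ∈ m.divisors, (ArithmeticFunction.moebius d : ℝ) *
      Real.log ((x : ℝ) / d) * (psiSum (x / m) - x / m + (γ + 1)) =
      Real.log x * (psiSum x - x + (γ + 1)) +
      ∑ m ∈ Ioc 0 x, vonMangoldt m * (psiSum (x / m) - x / m + (γ + 1)) := by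
    have : ∀ m ∈ Ioc 0 x, ∑ d ∈ m.divisors, (ArithmeticFunction.moebius d : ℝ) *
        Real.log ((x : ℝ) / d) * (psiSum (x / m) - x / m + (γ + 1)) =
        (if m = 1 then Real.log x * (psiSum x - x + (γ + 1)) else 0) +
          vonMangoldt m * (psiSum (x / m) - x / m + (γ + 1)) := by
      intro m _
      rw [← sum_mul, sum_moebius_log_div (by omega)]
      split_ifs with h1
      · subst h1; simp
      · ring
    rw [sum_congr rfl this, sum_add_distrib, sum_ite_eq' (Ioc 0 x) 1, if_pos (by simp; omega)]
  rw [← e1, ← h]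
  refine (abs_sum_le_sum_abs _ _).trans ?_
  calc _ ≤ ∑ d ∈ Ioc 0 x, 3 * (Real.log (x / d) * (1 + Real.log (x / d))) := by
        refine sum_le_sum fun d hd => ?_
        rw [mem_Ioc] at hd
        have hd0 : (0 : ℝ) < d := by exact_mod_cast hd.1
        have hN : 1 ≤ x / d := Nat.div_pos hd.2 hd.1
        have hxd : (1 : ℝ) ≤ x / d := by
          rw [le_div_iff₀ hd0, one_mul]; exact_mod_cast hd.2
        have hl := Real.log_nonneg hxd
        have key := abs_sum_psiSum_error hN (y := (x : ℝ) / d) Nat.cast_div_le (by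
          rw [div_lt_iff₀ hd0]
          rw [mul_comm]
          exact_mod_cast Nat.lt_mul_div_succ x hd.1)
        have e2 : ∑ n ∈ Ioc 0 (x / d), (ArithmeticFunction.moebius d : ℝ) *
            Real.log ((x : ℝ) / d) * (psiSum (x / (d * n)) - x / ((d * n : ℕ) : ℝ) + (γ + 1)) =
            (ArithmeticFunction.moebius d : ℝ) * Real.log ((x : ℝ) / d) *
            ∑ n ∈ Ioc 0 (x / d), (psiSum (x / d / n) - (x : ℝ) / d / n + (γ + 1)) := by
          rw [mul_sum]
          refine sum_congr rfl fun n _ => ?_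
          rw [Nat.div_div_eq_div_mul, div_div]; push_cast; rfl
        rw [e2, abs_mul, abs_mul, abs_of_nonneg hl]
        calc _ ≤ 1 * Real.log ((x : ℝ) / d) * (3 * (1 + Real.log (x / d))) := by
              gcongr
              exact abs_moebius_real_le d
          _ = _ := by ring
    _ ≤ _ := by
        rw [← mul_sum]
        have := sum_log_mul_one_add_log_le x
        linarith

/-- Selberg's function `Λ log + Λ * Λ`. -/
noncomputable def selbergLam (n : ℕ) : ℝ :=
  vonMangoldt n * Real.log n + (vonMangoldt * vonMangoldt) n

lemma convLam_nonneg (n : ℕ) : 0 ≤ (vonMangoldt * vonMangoldt) n := by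
  rw [ArithmeticFunction.mul_apply]
  exact sum_nonneg fun p _ => mul_nonneg ArithmeticFunction.vonMangoldt_nonneg
    ArithmeticFunction.vonMangoldt_nonneg

lemma selbergLam_nonneg (n : ℕ) : 0 ≤ selbergLam n :=
  add_nonneg (mul_nonneg ArithmeticFunction.vonMangoldt_nonneg (Real.log_natCast_nonneg _))
    (convLam_nonneg n)

lemma sum_vonMangoldt_log_div_le (x : ℕ) :
    ∑ n ∈ Ioc 0 x, vonMangoldt n * Real.log (x / n) ≤ 12 * x := by
  calc _ ≤ ∑ n ∈ Ioc 0 x, vonMangoldt n * ∑ k ∈ Ioc 0 (x / n), 1 / (k : ℝ) := by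
        refine sum_le_sum fun n hn => ?_
        rw [mem_Ioc] at hn
        refine mul_le_mul_of_nonneg_left ?_ ArithmeticFunction.vonMangoldt_nonneg
        have hn0 : (0 : ℝ) < n := by exact_mod_cast hn.1
        have hx0 : (0 : ℝ) < x := by exact_mod_cast hn.1.trans_le hn.2
        have h1 := log_add_one_le_harmonic (x / n)
        have h2 : ((harmonic (x / n) : ℚ) : ℝ) = ∑ k ∈ Ioc 0 (x / n), (1 : ℝ) / k := by
          have : Icc 1 (x / n) = Ioc 0 (x / n) := by ext; simp; omega
          rw [harmonic_eq_sum_Icc, this]; push_cast; simp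
        rw [← h2]
        refine le_trans (Real.log_le_log (by positivity) ?_) h1
        rw [div_le_iff₀ hn0, mul_comm]
        exact_mod_cast (Nat.lt_mul_div_succ x hn.1).le
    _ = ∑ k ∈ Ioc 0 x, 1 / (k : ℝ) * psiSum (x / k) := sum_mul_sum_div_comm x _ _
    _ ≤ ∑ k ∈ Ioc 0 x, 6 * x * ((k : ℝ) ^ 2)⁻¹ := by
        refine sum_le_sum fun k hk => ?_
        have hk0 : (0 : ℝ) < k := by exact_mod_cast (mem_Ioc.1 hk).1
        have h1 : psiSum (x / k) ≤ 6 * ((x / k : ℕ) : ℝ) := psi_le_six _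
        have h2 : ((x / k : ℕ) : ℝ) ≤ x / k := Nat.cast_div_le
        calc _ ≤ 1 / (k : ℝ) * (6 * (x / k)) := by gcongr; linarith
          _ = _ := by field_simp
    _ ≤ 6 * x * 2 := by
        rw [← mul_sum]
        have := sum_Ioo_inv_sq_le (α := ℝ) 0 (x + 1)
        have e : Ioo 0 (x + 1) = Ioc 0 x := by ext; simp
        rw [e] at this
        refine mul_le_mul_of_nonneg_left ?_ (by positivity)
        norm_num at this ⊢
        exact this
    _ = _ := by ring

theorem abs_sum_selbergLam_sub_le {x : ℕ} (hx : 1 ≤ x) :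
    |∑ n ∈ Ioc 0 x, selbergLam n - 2 * x * Real.log x| ≤ 150 * x := by
  have hx0 : (1 : ℝ) ≤ x := by exact_mod_cast hx
  have h1 := abs_selberg_error hx
  set γ := Real.eulerMascheroniConstant with hγ
  have hγ0 : (1 : ℝ) / 2 < γ := Real.one_half_lt_eulerMascheroniConstant
  have hγ1 : γ < 2 / 3 := Real.eulerMascheroniConstant_lt_two_thirds
  have e1 : ∑ n ∈ Ioc 0 x, selbergLam n = ∑ n ∈ Ioc 0 x, vonMangoldt n * Real.log n +
      ∑ m ∈ Ioc 0 x, vonMangoldt m * psiSum (x / m) := by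
    unfold selbergLam psiSum
    rw [sum_add_distrib, ArithmeticFunction.sum_Ioc_mul_eq_sum_sum]
  have e2 : ∑ m ∈ Ioc 0 x, vonMangoldt m * (psiSum (x / m) - x / m + (γ + 1)) =
      ∑ m ∈ Ioc 0 x, vonMangoldt m * psiSum (x / m) - x * ∑ m ∈ Ioc 0 x, vonMangoldt m / m +
      (γ + 1) * psiSum x := by
    unfold psiSum
    rw [mul_sum, mul_sum, ← sum_sub_distrib, ← sum_add_distrib]
    exact sum_congr rfl fun m _ => by ring
  have e3 : ∑ n ∈ Ioc 0 x, vonMangoldt n * Real.log (x / n) =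
      psiSum x * Real.log x - ∑ n ∈ Ioc 0 x, vonMangoldt n * Real.log n := by
    unfold psiSum
    rw [sum_mul, ← sum_sub_distrib]
    refine sum_congr rfl fun n hn => ?_
    have : (0 : ℝ) < n := by exact_mod_cast (mem_Ioc.1 hn).1
    rw [Real.log_div (by positivity) (by positivity)]; ring
  have h2 := sum_vonMangoldt_log_div_le x
  have h3 : 0 ≤ ∑ n ∈ Ioc 0 x, vonMangoldt n * Real.log (x / n) :=
    sum_nonneg fun n hn => mul_nonneg ArithmeticFunction.vonMangoldt_nonneg (Real.log_nonneg (by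
      have : (0 : ℝ) < n := by exact_mod_cast (mem_Ioc.1 hn).1
      rw [le_div_iff₀ this, one_mul]; exact_mod_cast (mem_Ioc.1 hn).2))
  have h4 := sum_vonMangoldt_div_le x hx
  have h5 := le_sum_vonMangoldt_div x hx
  have h6 : psiSum x ≤ 6 * x := psi_le_six x
  have h7 := psiSum_nonneg x
  have h8 : Real.log x ≤ x - 1 := Real.log_le_sub_one_of_pos (by linarith)
  have h9 : 0 ≤ Real.log x := Real.log_natCast_nonneg _
  have h10 := mul_le_mul_of_nonneg_left h4 (by linarith : (0 : ℝ) ≤ x)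
  have h11 := mul_le_mul_of_nonneg_left h5 (by linarith : (0 : ℝ) ≤ x)
  have h12 : (γ + 1) * psiSum x ≤ 2 * (6 * x) := by gcongr; linarith
  have h13 : 0 ≤ (γ + 1) * psiSum x := by positivity
  have h14 : (γ + 1) * Real.log x ≤ 2 * x := by gcongr <;> linarith
  have h15 : 0 ≤ (γ + 1) * Real.log x := by positivity
  rw [e2] at h1
  rw [e3] at h2 h3
  rw [e1]
  rw [abs_le] at h1 ⊢
  constructor <;> nlinarith

lemma sum_divisors_selbergLam {n : ℕ} (hn : 0 < n) :
    ∑ d ∈ n.divisors, selbergLam d = Real.log n ^ 2 := by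
  unfold selbergLam
  have h1 : ∑ d ∈ n.divisors, (vonMangoldt * vonMangoldt) d =
      ∑ d ∈ n.divisors, vonMangoldt d * Real.log ((n / d : ℕ) : ℝ) := by
    rw [← ArithmeticFunction.coe_mul_zeta_apply, mul_assoc, ArithmeticFunction.vonMangoldt_mul_zeta,
      ArithmeticFunction.mul_apply, Nat.sum_divisorsAntidiagonal
        (fun a b => vonMangoldt a * ArithmeticFunction.log b)]
    rfl
  rw [sum_add_distrib, h1, ← sum_add_distrib, sq, ← ArithmeticFunction.vonMangoldt_sum, sum_mul]
  refine sum_congr rfl fun d hd => ?_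
  have hd0 := Nat.pos_of_mem_divisors hd
  have hdn := Nat.dvd_of_mem_divisors hd
  rw [ArithmeticFunction.vonMangoldt_sum, Nat.cast_div hdn (by positivity),
    Real.log_div (by positivity) (by positivity)]
  ring

lemma mobSum_sq {n : ℕ} (hn : 0 < n) : mobSum (fun w => w ^ 2) n = selbergLam n := by
  have h := (ArithmeticFunction.sum_eq_iff_sum_mul_moebius_eq (f := selbergLam)
    (g := fun n : ℕ => Real.log n ^ 2)).1 (fun n hn => sum_divisors_selbergLam hn) n hn
  rw [← h, Nat.sum_divisorsAntidiagonal
    (fun a b => (ArithmeticFunction.moebius a : ℝ) * Real.log (b : ℝ) ^ 2)]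
  rfl

lemma mobSum_id {n : ℕ} (hn : 0 < n) : mobSum (fun w => w) n = vonMangoldt n := by
  have h := (ArithmeticFunction.sum_eq_iff_sum_mul_moebius_eq (f := fun n => vonMangoldt n)
    (g := fun n : ℕ => Real.log n)).1 (fun n _ => ArithmeticFunction.vonMangoldt_sum) n hn
  rw [← h, Nat.sum_divisorsAntidiagonal
    (fun a b => (ArithmeticFunction.moebius a : ℝ) * Real.log (b : ℝ))]
  rfl

lemma mobSum_const {n : ℕ} (hn : 1 < n) (c : ℝ) : mobSum (fun _ => c) n = 0 := by
  unfold mobSum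
  rw [← sum_mul, sum_moebius_real, if_neg (by omega), zero_mul]

/-- A twice differentiable approximation of `w²` supported on `w ≥ l`. -/
noncomputable def smoothSq (l w : ℝ) : ℝ := (max (w - l) 0 ^ 3 - max (w - 2 * l) 0 ^ 3) / (3 * l)

lemma max_cube_sub (u : ℝ) : max u 0 ^ 3 - max (-u) 0 ^ 3 = u ^ 3 := by
  rcases le_total 0 u with h | h
  · rw [max_eq_left h, max_eq_right (by linarith)]; ring
  · rw [max_eq_right h, max_eq_left (by linarith)]; ring

lemma smoothSq_sub {l : ℝ} (hl : 0 < l) (t w : ℝ) : smoothSq l (w - t) =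
    w ^ 2 - (2 * t + 3 * l) * w + (t ^ 2 + 3 * l * t + 7 * l ^ 2 / 3) -
      (cubePart (2 * l + t) w - cubePart (l + t) w) / (3 * l) := by
  unfold smoothSq cubePart
  have h1 := max_cube_sub (w - t - l)
  have h2 := max_cube_sub (w - t - 2 * l)
  have e1 : -(w - t - l) = l + t - w := by ring
  have e2 : -(w - t - 2 * l) = 2 * l + t - w := by ring
  rw [e1] at h1
  rw [e2] at h2
  generalize max (w - t - l) 0 ^ 3 = A at *
  generalize max (l + t - w) 0 ^ 3 = B at *
  generalize max (w - t - 2 * l) 0 ^ 3 = C at *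
  generalize max (2 * l + t - w) 0 ^ 3 = D at *
  field_simp
  linear_combination h1 - h2

lemma smoothSq_eq_zero {l w : ℝ} (hl : 0 ≤ l) (hw : w ≤ l) : smoothSq l w = 0 := by
  unfold smoothSq
  rw [max_eq_right (by linarith), max_eq_right (by linarith)]
  simp

lemma abs_smoothSq_le {l w : ℝ} (hl : 0 < l) (hw : 0 ≤ w) : |smoothSq l w| ≤ w ^ 2 := by
  unfold smoothSq
  set a := max (w - l) 0 with ha
  set b := max (w - 2 * l) 0 with hb
  have hb0 : 0 ≤ b := le_max_right _ _
  have hba : b ≤ a := max_le_max (by linarith) le_rfl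
  have haw : a ≤ w := max_le (by linarith) hw
  have hab : a - b ≤ l := by
    have : a ≤ b + l := by
      refine max_le ?_ (by linarith)
      have : w - 2 * l ≤ b := le_max_left _ _
      linarith
    linarith
  have h3 : a ^ 3 - b ^ 3 = (a - b) * (a ^ 2 + a * b + b ^ 2) := by ring
  have h4 : a ^ 2 + a * b + b ^ 2 ≤ 3 * w ^ 2 := by nlinarith
  have h5 : 0 ≤ a ^ 2 + a * b + b ^ 2 := by nlinarith [mul_nonneg (hb0.trans hba) hb0, sq_nonneg a, sq_nonneg b]
  rw [abs_of_nonneg (div_nonneg (by rw [h3]; exact mul_nonneg (by linarith) h5) (by linarith)),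
    div_le_iff₀ (by positivity), h3]
  calc (a - b) * (a ^ 2 + a * b + b ^ 2) ≤ l * (3 * w ^ 2) := by gcongr
    _ = _ := by ring

lemma selbergLam_eq {l : ℝ} (hl : 0 < l) {X n : ℕ} (hX : 0 < X) (hn : 1 < n) :
    selbergLam n = (∑ d ∈ n.divisors, (ArithmeticFunction.moebius d : ℝ) *
      smoothSq l (Real.log (X / d))) + (2 * Real.log (n / X) + 3 * l) * vonMangoldt n +
      (mobSum (cubePart (2 * l + Real.log (n / X))) n -
        mobSum (cubePart (l + Real.log (n / X))) n) / (3 * l) := by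
  set t := Real.log ((n : ℝ) / X) with ht
  have hn0 : 0 < n := by omega
  have e1 : ∑ d ∈ n.divisors, (ArithmeticFunction.moebius d : ℝ) *
      smoothSq l (Real.log (X / d)) = mobSum (fun w => smoothSq l (w - t)) n := by
    refine sum_congr rfl fun d hd => ?_
    have hd0 := Nat.pos_of_mem_divisors hd
    have hdn := Nat.dvd_of_mem_divisors hd
    have : Real.log ((X : ℝ) / d) = Real.log ((n / d : ℕ) : ℝ) - t := by
      rw [Nat.cast_div hdn (by positivity), ht, Real.log_div (by positivity) (by positivity),
        Real.log_div (by positivity) (by positivity), Real.log_div (by positivity) (by positivity)]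
      ring
    rw [this]
  have e2 : mobSum (fun w => smoothSq l (w - t)) n = mobSum (fun w => w ^ 2) n -
      (2 * t + 3 * l) * mobSum (fun w => w) n +
      mobSum (fun _ => t ^ 2 + 3 * l * t + 7 * l ^ 2 / 3) n -
      (mobSum (cubePart (2 * l + t)) n - mobSum (cubePart (l + t)) n) / (3 * l) := by
    unfold mobSum
    rw [mul_sum, ← sum_sub_distrib, ← sum_add_distrib, ← sum_sub_distrib, sum_div,
      ← sum_sub_distrib]
    refine sum_congr rfl fun d _ => ?_
    beta_reduce
    rw [smoothSq_sub hl]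
    ring
  rw [e1, e2, mobSum_sq hn0, mobSum_id hn0, mobSum_const hn]
  ring

/-- The density of the smooth part of `selbergLam` near `X`. -/
noncomputable def smoothDensity (X M : ℕ) : ℝ :=
  ∑ d ∈ Icc 1 (X / M), (ArithmeticFunction.moebius d : ℝ) *
    smoothSq (Real.log M) (Real.log (X / d)) / d

lemma abs_sum_smooth_sub_le {X M h : ℕ} (hX : 1 ≤ X) (hM : 2 ≤ M) :
    |∑ n ∈ Ioc X (X + h), ∑ d ∈ n.divisors, (ArithmeticFunction.moebius d : ℝ) *
      smoothSq (Real.log M) (Real.log (X / d)) - h * smoothDensity X M| ≤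
      X / M * Real.log X ^ 2 := by
  have hl : 0 < Real.log M := Real.log_pos (by exact_mod_cast (by omega : 1 < M))
  set f : ℕ → ℝ := fun d => (ArithmeticFunction.moebius d : ℝ) *
      smoothSq (Real.log M) (Real.log (X / d)) with hf
  have e1 : ∀ n ∈ Ioc X (X + h), ∑ d ∈ n.divisors, f d =
      ∑ d ∈ Icc 1 (X / M), if d ∣ n then f d else 0 := by
    intro n hn
    have hn0 : 0 < n := by rw [mem_Ioc] at hn; omega
    rw [← sum_filter]
    symm
    refine sum_subset (fun d hd => ?_) fun d hd hd' => ?_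
    · rw [mem_filter] at hd
      exact Nat.mem_divisors.2 ⟨hd.2, hn0.ne'⟩
    · have hd0 := Nat.pos_of_mem_divisors hd
      have hdn := Nat.dvd_of_mem_divisors hd
      simp only [mem_filter, mem_Icc, hdn, and_true] at hd'
      have h1 : X < M * d := by
        rw [mul_comm]
        exact (Nat.div_lt_iff_lt_mul (by omega)).1 (by omega)
      simp only [hf]
      rw [smoothSq_eq_zero hl.le, mul_zero]
      refine Real.log_le_log (by positivity) ?_
      rw [div_le_iff₀ (by positivity)]
      exact_mod_cast h1.le
  rw [sum_congr rfl e1, sum_comm]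
  unfold smoothDensity
  rw [mul_sum, ← sum_sub_distrib]
  refine (abs_sum_le_sum_abs _ _).trans ?_
  calc _ ≤ ∑ d ∈ Icc 1 (X / M), Real.log X ^ 2 := by
        refine sum_le_sum fun d hd => ?_
        rw [mem_Icc] at hd
        have hdX : d ≤ X := hd.2.trans (Nat.div_le_self _ _)
        have hd0 : (0 : ℝ) < d := by exact_mod_cast hd.1
        have h1 := card_multiples_Ioc X h d hd.1
        rw [← sum_filter, sum_const, nsmul_eq_mul]
        have e2 : (#{n ∈ Ioc X (X + h) | d ∣ n} : ℝ) * f d - h * (f d / d) =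
            (#{n ∈ Ioc X (X + h) | d ∣ n} - (h : ℝ) / d) * f d := by ring
        change |(#{n ∈ Ioc X (X + h) | d ∣ n} : ℝ) * f d - h * (f d / d)| ≤ _
        have hxd : (1 : ℝ) ≤ X / d := by
          rw [le_div_iff₀ hd0, one_mul]; exact_mod_cast hdX
        have hl2 : Real.log ((X : ℝ) / d) ≤ Real.log X := by
          refine Real.log_le_log (by linarith) (div_le_self (Nat.cast_nonneg _) ?_)
          exact_mod_cast hd.1
        have hl3 := Real.log_nonneg hxd
        rw [e2, abs_mul]
        have h2 : |f d| ≤ Real.log X ^ 2 := by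
          simp only [hf]
          rw [abs_mul]
          calc _ ≤ 1 * Real.log ((X : ℝ) / d) ^ 2 :=
                mul_le_mul (abs_moebius_real_le d) (abs_smoothSq_le hl hl3) (abs_nonneg _) zero_le_one
            _ ≤ _ := by rw [one_mul]; gcongr
        calc _ ≤ 1 * Real.log X ^ 2 := mul_le_mul h1 h2 (abs_nonneg _) zero_le_one
          _ = _ := one_mul _
    _ = ((X / M : ℕ) : ℝ) * Real.log X ^ 2 := by simp
    _ ≤ _ := by gcongr; exact Nat.cast_div_le

lemma sum_vonMangoldt_mul_log_le (X h : ℕ) (hX : 1 ≤ X) :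
    (∑ n ∈ Ioc X (X + h), vonMangoldt n) * Real.log X ≤ ∑ n ∈ Ioc X (X + h), selbergLam n := by
  rw [sum_mul]
  refine sum_le_sum fun n hn => ?_
  rw [mem_Ioc] at hn
  have h1 : Real.log X ≤ Real.log n :=
    Real.log_le_log (by exact_mod_cast hX) (by exact_mod_cast hn.1.le)
  have h2 := convLam_nonneg n
  have h3 := mul_le_mul_of_nonneg_left h1 (ArithmeticFunction.vonMangoldt_nonneg (n := n))
  unfold selbergLam
  linarith

lemma abs_sum_selbergLam_sub_density_le {X M h : ℕ} (hX : 2 ≤ X) (hM : 2 ≤ M) (hhX : h ≤ X)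
    (hMh : M ^ 36 ≤ h) :
    |∑ n ∈ Ioc X (X + h), selbergLam n - h * smoothDensity X M| ≤ X / M * Real.log X ^ 2 +
      10 ^ 8 * Real.log M * h +
      6 * Real.log M / Real.log X * ∑ n ∈ Ioc X (X + h), selbergLam n := by
  set l := Real.log M with hl
  set L := Real.log X with hL
  have hM1 : (2 : ℝ) ≤ M := by exact_mod_cast hM
  have hl2 : Real.log 2 ≤ l := Real.log_le_log (by norm_num) hM1
  have hlog2 := Real.log_two_gt_d9
  have hl0 : 0 < l := by linarith
  have hX1 : (1 : ℝ) < X := by exact_mod_cast hX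
  have hL0 : 0 < L := Real.log_pos hX1
  have ht0 : ∀ n ∈ Ioc X (X + h), 0 ≤ Real.log ((n : ℝ) / X) := fun n hn => by
    rw [mem_Ioc] at hn
    refine Real.log_nonneg ?_
    rw [le_div_iff₀ (by linarith), one_mul]; exact_mod_cast hn.1.le
  have ht : ∀ n ∈ Ioc X (X + h), Real.log ((n : ℝ) / X) ≤ l := fun n hn => by
    rw [mem_Ioc] at hn
    refine le_trans (Real.log_le_log (div_pos (by exact_mod_cast (by omega : 0 < n)) (by linarith)) ?_) hl2
    rw [div_le_iff₀ (by linarith)]; exact_mod_cast (by omega : n ≤ 2 * X)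
  have hl3 : Real.log ((M ^ 3 : ℕ) : ℝ) = 3 * l := by
    push_cast; rw [Real.log_pow, ← hl]; norm_num
  have hM3 : 2 ≤ M ^ 3 := hM.trans (Nat.le_self_pow (by norm_num) M)
  have hM36 : (M ^ 3) ^ 12 ≤ h := by rw [← pow_mul]; exact hMh
  have c1 := sum_abs_mobSum_cubePart_le hM3 hM36 (X := X) (a := fun n : ℕ => 2 * l + Real.log ((n : ℝ) / X))
    (fun n hn => by have := ht0 n hn; positivity) (fun n hn => by rw [hl3]; have := ht n hn; linarith)
  have c2 := sum_abs_mobSum_cubePart_le hM3 hM36 (X := X) (a := fun n : ℕ => l + Real.log ((n : ℝ) / X))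
    (fun n hn => by have := ht0 n hn; positivity) (fun n hn => by rw [hl3]; have := ht n hn; linarith)
  rw [hl3] at c1 c2
  have c3 := abs_sum_smooth_sub_le (X := X) (M := M) (h := h) (by omega) hM
  have c4 := sum_vonMangoldt_mul_log_le X h (by omega)
  have e : ∑ n ∈ Ioc X (X + h), selbergLam n - h * smoothDensity X M =
      (∑ n ∈ Ioc X (X + h), ∑ d ∈ n.divisors, (ArithmeticFunction.moebius d : ℝ) *
        smoothSq l (Real.log (X / d)) - h * smoothDensity X M) +
      ∑ n ∈ Ioc X (X + h), (2 * Real.log (n / X) + 3 * l) * vonMangoldt n +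
      ∑ n ∈ Ioc X (X + h), (mobSum (cubePart (2 * l + Real.log (n / X))) n -
        mobSum (cubePart (l + Real.log (n / X))) n) / (3 * l) := by
    have : ∀ n ∈ Ioc X (X + h), selbergLam n = _ := fun n hn =>
      selbergLam_eq hl0 (X := X) (by omega) (by rw [mem_Ioc] at hn; omega)
    rw [sum_congr rfl this, sum_add_distrib, sum_add_distrib]
    ring
  have d2 : |∑ n ∈ Ioc X (X + h), (2 * Real.log (n / X) + 3 * l) * vonMangoldt n| ≤
      6 * l / L * ∑ n ∈ Ioc X (X + h), selbergLam n := by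
    have h1 : ∀ n ∈ Ioc X (X + h), 0 ≤ (2 * Real.log ((n : ℝ) / X) + 3 * l) * vonMangoldt n :=
      fun n hn => mul_nonneg (by have := ht0 n hn; positivity) ArithmeticFunction.vonMangoldt_nonneg
    rw [abs_of_nonneg (sum_nonneg h1)]
    calc _ ≤ ∑ n ∈ Ioc X (X + h), 6 * l * vonMangoldt n := by
          refine sum_le_sum fun n hn => mul_le_mul_of_nonneg_right ?_
            ArithmeticFunction.vonMangoldt_nonneg
          have := ht n hn
          linarith
      _ = 6 * l / L * ((∑ n ∈ Ioc X (X + h), vonMangoldt n) * L) := by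
          rw [← mul_sum]; field_simp
      _ ≤ _ := by gcongr
  have d3 : |∑ n ∈ Ioc X (X + h), (mobSum (cubePart (2 * l + Real.log (n / X))) n -
        mobSum (cubePart (l + Real.log (n / X))) n) / (3 * l)| ≤ 10 ^ 8 * l * h := by
    rw [← sum_div, abs_div, abs_of_pos (by positivity : 0 < 3 * l), div_le_iff₀ (by positivity)]
    refine (abs_sum_le_sum_abs _ _).trans ?_
    have : ∀ n ∈ Ioc X (X + h), |mobSum (cubePart (2 * l + Real.log (n / X))) n -
        mobSum (cubePart (l + Real.log (n / X))) n| ≤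
        |mobSum (cubePart (2 * l + Real.log (n / X))) n| +
        |mobSum (cubePart (l + Real.log (n / X))) n| := fun n _ => abs_sub _ _
    refine (sum_le_sum this).trans ?_
    rw [sum_add_distrib]
    have h0 : 0 ≤ l ^ 2 * h := by positivity
    nlinarith
  rw [e]
  refine (abs_add_le _ _).trans ?_
  have := abs_add_le (∑ n ∈ Ioc X (X + h), ∑ d ∈ n.divisors, (ArithmeticFunction.moebius d : ℝ) *
        smoothSq l (Real.log (X / d)) - h * smoothDensity X M)
      (∑ n ∈ Ioc X (X + h), (2 * Real.log (n / X) + 3 * l) * vonMangoldt n)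
  linarith

lemma abs_sum_selbergLam_dyadic {X : ℕ} (hX : 1 ≤ X) :
    |∑ n ∈ Ioc X (X + X), selbergLam n - 2 * X * Real.log X| ≤ 500 * X := by
  have h1 := abs_sum_selbergLam_sub_le hX
  have h2 := abs_sum_selbergLam_sub_le (x := X + X) (by omega)
  have e : ∑ n ∈ Ioc 0 (X + X), selbergLam n =
      ∑ n ∈ Ioc 0 X, selbergLam n + ∑ n ∈ Ioc X (X + X), selbergLam n := by
    rw [sum_Ioc_consecutive _ (Nat.zero_le _) (by omega)]
  have hX0 : (0 : ℝ) < X := by exact_mod_cast hX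
  have e2 : Real.log ((X + X : ℕ) : ℝ) = Real.log 2 + Real.log X := by
    push_cast
    rw [← two_mul, Real.log_mul (by norm_num) hX0.ne']
  have h3 := Real.log_two_lt_d9
  have h4 := Real.log_two_gt_d9
  rw [e, e2] at h2
  push_cast at h2
  rw [abs_le] at *
  constructor <;> nlinarith

lemma abs_sub_two_mul_le_of_density {SI SJ T l L x h e : ℝ}
    (a1 : |SI - h * T| ≤ e + 10 ^ 8 * l * h + 6 * l / L * SI)
    (a2 : |SJ - x * T| ≤ e + 10 ^ 8 * l * x + 6 * l / L * SJ)
    (a3 : |SJ - 2 * x * L| ≤ 500 * x) (hh0 : 0 < h) (hhx : h ≤ x) (hl : 1 / 2 ≤ l)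
    (hL : 1000 ≤ L) (hlL : 10 ^ 9 * l ≤ L) (he : e ≤ l * h) (hSI0 : 0 ≤ SI) :
    |SI - 2 * h * L| ≤ 10 ^ 9 * l * h := by
  have hx0 : 0 < x := hh0.trans_le hhx
  have b2 : l * h ≤ l * x := by gcongr
  have hxL : 1000 * x ≤ L * x := by gcongr
  have hlx : 1 / 2 * x ≤ l * x := by gcongr
  obtain ⟨a3l, a3u⟩ := abs_le.1 a3
  have hSJ : SJ ≤ 3 * x * L := by linarith
  have c1 : 6 * l / L * SJ ≤ 18 * l * x := by
    calc 6 * l / L * SJ ≤ 6 * l / L * (3 * x * L) := by gcongr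
      _ = _ := by field_simp; ring
  obtain ⟨a2l, a2u⟩ := abs_le.1 a2
  have hT : |x * (T - 2 * L)| ≤ x * ((2 * 10 ^ 8) * l) := by
    rw [abs_le]
    constructor <;> linarith
  have hT1 : |T - 2 * L| ≤ (2 * 10 ^ 8) * l := by
    rw [abs_mul, abs_of_pos hx0] at hT
    exact le_of_mul_le_mul_left hT hx0
  have hη : 6 * l / L ≤ 1 / 2 := by rw [div_le_iff₀ (by linarith)]; linarith
  have d0 : 6 * l / L * SI ≤ 1 / 2 * SI := by gcongr
  have hTh : |h * (T - 2 * L)| ≤ h * ((2 * 10 ^ 8) * l) := by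
    rw [abs_mul, abs_of_pos hh0]; gcongr
  obtain ⟨tl, tu⟩ := abs_le.1 hTh
  obtain ⟨a1l, a1u⟩ := abs_le.1 a1
  have hlh : 10 ^ 9 * l * h ≤ L * h := by gcongr
  have hLh : 0 ≤ L * h := by positivity
  have d1 : SI ≤ 8 * h * L := by linarith
  have d2 : 6 * l / L * SI ≤ 48 * l * h := by
    calc 6 * l / L * SI ≤ 6 * l / L * (8 * h * L) := by gcongr
      _ = _ := by field_simp; ring
  have hlh0 : 0 ≤ l * h := by positivity
  rw [abs_le]
  constructor <;> linarith

theorem abs_sum_selbergLam_short_le {X M h : ℕ} (hM : 2 ≤ M) (hhX : h ≤ X) (hMh : M ^ 36 ≤ h)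
    (hL : 1000 ≤ Real.log X) (hlL : 10 ^ 9 * Real.log M ≤ Real.log X)
    (hXM : X * Real.log X ^ 2 ≤ Real.log M * h * M) :
    |∑ n ∈ Ioc X (X + h), selbergLam n - 2 * h * Real.log X| ≤ 10 ^ 9 * Real.log M * h := by
  have hX : 2 ≤ X := hM.trans ((Nat.le_pow (by norm_num : 0 < 36)).trans (hMh.trans hhX))
  have hM1 : (2 : ℝ) ≤ M := by exact_mod_cast hM
  have hl2 : Real.log 2 ≤ Real.log M := Real.log_le_log (by norm_num) hM1
  have hlog2 := Real.log_two_gt_d9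
  have h0 : 0 < h := lt_of_lt_of_le (Nat.pow_pos (by omega)) hMh
  refine abs_sub_two_mul_le_of_density (abs_sum_selbergLam_sub_density_le hX hM hhX hMh)
    (abs_sum_selbergLam_sub_density_le hX hM le_rfl (hMh.trans hhX))
    (abs_sum_selbergLam_dyadic (X := X) (by omega)) (by exact_mod_cast h0)
    (by exact_mod_cast hhX) (by linarith) hL hlL ?_ (sum_nonneg fun n _ => selbergLam_nonneg n)
  rw [div_mul_eq_mul_div, div_le_iff₀ (by linarith)]
  exact hXM

/-- Selberg's formula in short intervals. -/
theorem exists_selberg_short {ε : ℝ} (hε : 0 < ε) : ∃ δ : ℝ, 0 < δ ∧ δ < 1 ∧ ∃ X₀ : ℕ, ∀ X h : ℕ,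
    X₀ ≤ X → h ≤ X → (X : ℝ) ^ (1 - δ) ≤ h →
    |∑ n ∈ Ioc X (X + h), selbergLam n - 2 * h * Real.log X| ≤ ε * h * Real.log X := by
  wlog hε1 : ε ≤ 1 generalizing ε
  · obtain ⟨δ, h0, h1, X₀, h2⟩ := this zero_lt_one le_rfl
    refine ⟨δ, h0, h1, X₀, fun X h a b c => (h2 X h a b c).trans ?_⟩
    have := Real.log_natCast_nonneg X
    gcongr
    linarith
  set η := ε / (2 * 10 ^ 9) with hη
  have hη0 : 0 < η := by positivity
  have hη1 : η ≤ 1 / (2 * 10 ^ 9) := by rw [hη]; gcongr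
  refine ⟨η / 2, by positivity, by linarith, ⌈Real.exp (8 / η ^ 3)⌉₊, fun X h hX hhX hXh => ?_⟩
  set L := Real.log X with hL
  have hX1 : Real.exp (8 / η ^ 3) ≤ X := (Nat.le_ceil _).trans (by exact_mod_cast hX)
  have hX0 : (0 : ℝ) < X := (Real.exp_pos _).trans_le hX1
  have hL1 : 8 / η ^ 3 ≤ L := (Real.le_log_iff_exp_le hX0).2 hX1
  have hηL : 8 ≤ η ^ 3 * L := by rwa [div_le_iff₀' (by positivity)] at hL1
  have hL0 : 0 < L := (by positivity : 0 < 8 / η ^ 3).trans_le hL1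
  have hηL1 : 8 ≤ η ^ 2 * L := hηL.trans (by
    have : η ^ 3 ≤ η ^ 2 := pow_le_pow_of_le_one hη0.le (by linarith) (by norm_num)
    gcongr)
  have hηL2 : 8 ≤ η * L := hηL1.trans (by
    have : η ^ 2 ≤ η := pow_le_of_le_one hη0.le (by linarith) (by norm_num)
    gcongr)
  have hL3 : 1000 ≤ L := by nlinarith
  set M := ⌈(X : ℝ) ^ η⌉₊ with hM
  have hXη : (X : ℝ) ^ η = Real.exp (η * L) := by
    rw [Real.rpow_def_of_pos hX0, mul_comm]
  have hM1 : (X : ℝ) ^ η ≤ M := Nat.le_ceil _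
  have he8 : 9 ≤ Real.exp (η * L) := by
    have := Real.add_one_le_exp (η * L); linarith
  have hM2 : 2 ≤ M := by
    have : (2 : ℝ) ≤ M := by rw [hXη] at hM1; linarith
    exact_mod_cast this
  have hM3 : (M : ℝ) ≤ Real.exp (2 * η * L) := by
    have h1 : (M : ℝ) ≤ Real.exp (η * L) + 1 := by
      rw [← hXη]; exact (Nat.ceil_lt_add_one (by positivity)).le
    have h2 : Real.exp (2 * η * L) = Real.exp (η * L) * Real.exp (η * L) := by
      rw [← Real.exp_add]; ring_nf
    rw [h2]
    nlinarith
  have hM0 : (0 : ℝ) < M := by positivity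
  have hl1 : η * L ≤ Real.log M := by
    rw [Real.le_log_iff_exp_le hM0, ← hXη]; exact hM1
  have hl2 : Real.log M ≤ 2 * η * L := by
    rw [Real.log_le_iff_le_exp hM0]; exact hM3
  have hXe : (X : ℝ) = Real.exp L := (Real.exp_log hX0).symm
  have hMh : M ^ 36 ≤ h := by
    have : (M : ℝ) ^ 36 ≤ h := by
      refine le_trans ?_ hXh
      calc (M : ℝ) ^ 36 ≤ Real.exp (2 * η * L) ^ 36 := by gcongr
        _ = Real.exp (72 * η * L) := by rw [← Real.exp_nat_mul]; ring_nf
        _ ≤ Real.exp (L * (1 - η / 2)) := by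
            refine Real.exp_le_exp.2 ?_
            have : 72 * η ≤ 1 - η / 2 := by linarith
            nlinarith
        _ = _ := by rw [Real.rpow_def_of_pos hX0]
    exact_mod_cast this
  have key := abs_sum_selbergLam_short_le hM2 hhX hMh hL3 (by nlinarith) (by
    have h1 : L ≤ η * Real.exp (η / 2 * L) := by
      have := Real.quadratic_le_exp_of_nonneg (x := η / 2 * L) (by positivity)
      have h2 : (η / 2 * L) ^ 2 / 2 ≤ Real.exp (η / 2 * L) := by
        have : 0 ≤ η / 2 * L := by positivity
        linarith
      calc L ≤ (η ^ 3 * L) * L / 8 := by nlinarith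
        _ = η * ((η / 2 * L) ^ 2 / 2) := by ring
        _ ≤ _ := by gcongr
    have h3 : X * Real.exp (η / 2 * L) ≤ h * M := by
      calc X * Real.exp (η / 2 * L) = Real.exp (L * (1 - η / 2)) * Real.exp (η * L) := by
            rw [hXe, ← Real.exp_add, ← Real.exp_add]; ring_nf
        _ ≤ h * M := by
            rw [← hXη, ← Real.rpow_def_of_pos hX0]
            gcongr
    calc X * L ^ 2 = X * L * L := by ring
      _ ≤ X * L * (η * Real.exp (η / 2 * L)) := by gcongr
      _ = (η * L) * (X * Real.exp (η / 2 * L)) := by ring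
      _ ≤ Real.log M * (h * M) := by gcongr
      _ = _ := by ring)
  refine key.trans ?_
  have e : ε = 2 * 10 ^ 9 * η := by rw [hη]; field_simp
  calc _ ≤ 10 ^ 9 * (2 * η * L) * h := by gcongr
    _ = _ := by rw [e]; ring

/-- The average of `a` over the window `[i, i + K)`. -/
noncomputable def windowAvg (a : ℕ → ℝ) (K i : ℕ) : ℝ := (∑ l ∈ range K, a (i + l)) / K

lemma windowAvg_nonneg {a : ℕ → ℝ} (h0 : ∀ j, 0 ≤ a j) (K i : ℕ) : 0 ≤ windowAvg a K i :=
  div_nonneg (sum_nonneg fun _ _ => h0 _) (Nat.cast_nonneg _)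

lemma windowAvg_le {a : ℕ → ℝ} {B : ℝ} {K i : ℕ} (hK : 0 < K) (h : ∀ j < i + K, a j ≤ B) :
    windowAvg a K i ≤ B := by
  unfold windowAvg
  rw [div_le_iff₀ (by exact_mod_cast hK)]
  calc _ ≤ ∑ l ∈ range K, B := sum_le_sum fun l hl => h _ (by rw [mem_range] at hl; omega)
    _ = _ := by simp [mul_comm]

lemma windowAvg_succ_le {a : ℕ → ℝ} (h0 : ∀ j, 0 ≤ a j) {B : ℝ} {K i : ℕ}
    (h : a (i + K) ≤ B) : windowAvg a K (i + 1) ≤ windowAvg a K i + B / K := by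
  unfold windowAvg
  rw [← add_div]
  gcongr
  have h1 : ∑ l ∈ range K, a (i + 1 + l) + a i = ∑ l ∈ range K, a (i + l) + a (i + K) := by
    rw [← sum_range_succ (fun l => a (i + l)), sum_range_succ' (fun l => a (i + l))]
    congr 1
    exact sum_congr rfl fun l _ => by congr 1; ring
  linarith [h0 i]

lemma sum_windowAvg_le {a : ℕ → ℝ} (h0 : ∀ j, 0 ≤ a j) {K w : ℕ} {c : ℝ} (hK : 0 < K)
    (h : ∀ v ≤ w + K, ∑ i ∈ range v, a i ≤ v + c) :
    ∑ i ∈ range w, windowAvg a K i ≤ w + K + c := by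
  unfold windowAvg
  rw [← sum_div, sum_comm, div_le_iff₀ (by exact_mod_cast hK)]
  calc _ ≤ ∑ l ∈ range K, ((w : ℝ) + K + c) := by
        refine sum_le_sum fun l hl => ?_
        rw [mem_range] at hl
        have h1 := h (l + w) (by omega)
        rw [sum_range_add] at h1
        have h2 : 0 ≤ ∑ x ∈ range l, a x := sum_nonneg fun _ _ => h0 _
        have h3 : ∑ i ∈ range w, a (i + l) = ∑ x ∈ range w, a (l + x) :=
          sum_congr rfl fun x _ => by rw [add_comm]
        have h4 : (l : ℝ) ≤ K := by exact_mod_cast hl.le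
        push_cast at h1
        rw [h3]
        linarith
    _ = _ := by simp; ring

/-- If `0 ≤ f, g ≤ B` then `f(B-g)` and `g(B-f)` control both `|f-g|` and `f(B-f)`. -/
lemma mul_abs_sub_le {B f g : ℝ} (hf0 : 0 ≤ f) (hg0 : 0 ≤ g) (hf : f ≤ B) (hg : g ≤ B) :
    B * |f - g| ≤ f * (B - g) + g * (B - f) := by
  have h1 : 0 ≤ f * (B - g) := mul_nonneg hf0 (by linarith)
  have h2 : 0 ≤ g * (B - f) := mul_nonneg hg0 (by linarith)
  rcases abs_cases (f - g) with h | h <;> rw [h.1] <;> nlinarith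

lemma mul_sub_self_le {B f g : ℝ} (hf0 : 0 ≤ f) (hg0 : 0 ≤ g) (hf : f ≤ B) (hg : g ≤ B) :
    f * (B - f) ≤ 2 * (f * (B - g)) + g * (B - f) := by
  have h1 := mul_abs_sub_le hf0 hg0 hf hg
  have h2 : f * (g - f) ≤ B * |f - g| := by
    rw [abs_sub_comm]
    exact (mul_le_mul_of_nonneg_left (le_abs_self _) hf0).trans
      (mul_le_mul_of_nonneg_right hf (abs_nonneg _))
  nlinarith

section Window

variable {a : ℕ → ℝ} {m K W : ℕ} {ε : ℝ}

/-- The local hypotheses satisfied by a rescaled prime-counting sequence. -/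
structure PrimeLike (a : ℕ → ℝ) (m K W : ℕ) (ε : ℝ) : Prop where
  eps_pos : 0 < ε
  eps_le : ε ≤ 1 / 10 ^ 6
  one_le : 1 ≤ ε * m
  one_le_K : 1 ≤ ε * K
  K_le : (K : ℝ) ≤ ε * m
  W_pos : 0 < W
  W_le : (W : ℝ) ≤ ε * m
  nonneg : ∀ j, 0 ≤ a j
  le_two : ∀ j < 16 * m, a j ≤ 2 + ε
  sum_le : ∀ w ≤ 16 * m, ∑ i ∈ range w, a i ≤ w + ε * m
  sum_window : ∀ j ∈ Ico m (2 * m), |∑ l ∈ range W, a (j + l) - W| ≤ ε * W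
  sum_block : ∑ j ∈ Ico m (2 * m), a j ≤ m + ε * m
  conv : ∀ k, 4 * m ≤ k → k ≤ 8 * m + 1 → 2 * k - ε * m ≤
    k * windowAvg a K k + ∑ i ∈ range (k + 1), windowAvg a K i * a (k - i)

namespace PrimeLike

lemma K_pos (H : PrimeLike a m K W ε) : 0 < K := by
  have h := H.one_le_K
  rcases Nat.eq_zero_or_pos K with h0 | h0
  · rw [h0] at h; norm_num at h
  · exact h0

lemma m_large (H : PrimeLike a m K W ε) : (10 : ℝ) ^ 6 ≤ m := by
  have h1 := H.one_le
  have h2 := H.eps_le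
  have h3 : ε * m ≤ 1 / 10 ^ 6 * m := by gcongr
  linarith

lemma m_large_nat (H : PrimeLike a m K W ε) : 10 ^ 6 ≤ m := by exact_mod_cast H.m_large

lemma small (H : PrimeLike a m K W ε) : ε * m ≤ m / 10 ^ 6 := by
  have h2 := H.eps_le
  have h3 : ε * m ≤ 1 / 10 ^ 6 * m := by gcongr
  linarith

lemma K_le_m (H : PrimeLike a m K W ε) : K ≤ m := by
  have h1 := H.K_le
  have h2 := H.small
  have h3 := H.m_large
  have : (K : ℝ) ≤ m := by linarith
  exact_mod_cast this

lemma W_le_m (H : PrimeLike a m K W ε) : W ≤ m := by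
  have h1 := H.W_le
  have h2 := H.small
  have h3 := H.m_large
  have : (W : ℝ) ≤ m := by linarith
  exact_mod_cast this

lemma avg_le (H : PrimeLike a m K W ε) {i : ℕ} (hi : i ≤ 9 * m) : windowAvg a K i ≤ 2 + ε :=
  windowAvg_le H.K_pos fun j hj => H.le_two j (by
    have := H.K_le_m; have := H.m_large_nat; omega)

lemma sum_avg_mul_le (H : PrimeLike a m K W ε) {θ : ℝ} {w : ℕ} (hw1 : 4 * m ≤ w)
    (hw2 : w ≤ 8 * m + 1) (hθ : windowAvg a K w ≤ θ) :
    ∑ i ∈ range (w + 1), windowAvg a K i * (2 + ε - a (w - i)) ≤ 20 * (ε * m) + 9 * θ * m ∧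
    ∑ i ∈ range (w + 1), a (w - i) * (2 + ε - windowAvg a K i) ≤ 20 * (ε * m) + 9 * θ * m := by
  have hm := H.m_large_nat
  have hKm := H.K_le_m
  have h1 := H.conv w hw1 hw2
  have h2 := H.sum_le (w + 1) (by omega)
  have h3 := sum_windowAvg_le H.nonneg (w := w + 1) (c := ε * m) H.K_pos
    fun v hv => H.sum_le v (by omega)
  rw [← sum_range_reflect] at h2
  have h2' : ∑ i ∈ range (w + 1), a (w - i) ≤ (w + 1 : ℕ) + ε * m := by
    simpa using h2
  have hw : (w : ℝ) ≤ 9 * m := by exact_mod_cast (by omega : w ≤ 9 * m)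
  have e1 : ∑ i ∈ range (w + 1), windowAvg a K i * (2 + ε - a (w - i)) =
      (2 + ε) * ∑ i ∈ range (w + 1), windowAvg a K i -
      ∑ i ∈ range (w + 1), windowAvg a K i * a (w - i) := by
    rw [mul_sum, ← sum_sub_distrib]; exact sum_congr rfl fun _ _ => by ring
  have e2 : ∑ i ∈ range (w + 1), a (w - i) * (2 + ε - windowAvg a K i) =
      (2 + ε) * ∑ i ∈ range (w + 1), a (w - i) -
      ∑ i ∈ range (w + 1), windowAvg a K i * a (w - i) := by
    rw [mul_sum, ← sum_sub_distrib]; exact sum_congr rfl fun _ _ => by ring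
  have h4 : w * windowAvg a K w ≤ 9 * m * θ := mul_le_mul hw hθ (windowAvg_nonneg H.nonneg _ _) (by positivity)
  have hE := H.one_le
  have hK := H.K_le
  have he := H.eps_le
  have he0 := H.eps_pos
  push_cast at h2' h3
  have hb : ∀ s : ℝ, s ≤ w + 3 * (ε * m) → (2 + ε) * s ≤ 2 * w + 19 * (ε * m) := by
    intro s hs
    calc (2 + ε) * s ≤ (2 + ε) * (w + 3 * (ε * m)) := by gcongr
      _ = 2 * w + ε * w + (6 + 3 * ε) * (ε * m) := by ring
      _ ≤ 2 * w + ε * (9 * m) + (6 + 4) * (ε * m) := by gcongr; linarith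
      _ = _ := by ring
  have b1 := hb _ (h3.trans (by linarith))
  have b2 := hb _ (h2'.trans (by linarith))
  rw [e1, e2]
  constructor <;> linarith

lemma sum_abs_avg_sub_le (H : PrimeLike a m K W ε) {θ : ℝ} {w : ℕ} (hw1 : 4 * m ≤ w)
    (hw2 : w ≤ 8 * m + 1) (hθ : windowAvg a K w ≤ θ) :
    ∑ i ∈ range (w + 1), |windowAvg a K i - a (w - i)| ≤ 20 * (ε * m) + 9 * θ * m := by
  obtain ⟨h1, h2⟩ := H.sum_avg_mul_le hw1 hw2 hθ
  have he0 := H.eps_pos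
  have h3 : (2 + ε) * ∑ i ∈ range (w + 1), |windowAvg a K i - a (w - i)| ≤
      ∑ i ∈ range (w + 1), windowAvg a K i * (2 + ε - a (w - i)) +
      ∑ i ∈ range (w + 1), a (w - i) * (2 + ε - windowAvg a K i) := by
    rw [mul_sum, ← sum_add_distrib]
    refine sum_le_sum fun i hi => ?_
    rw [mem_range] at hi
    have := H.m_large_nat
    exact mul_abs_sub_le (windowAvg_nonneg H.nonneg _ _) (H.nonneg _) (H.avg_le (by omega))
      (H.le_two _ (by omega))
  have h4 : 0 ≤ ∑ i ∈ range (w + 1), |windowAvg a K i - a (w - i)| :=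
    sum_nonneg fun _ _ => abs_nonneg _
  have h5 : 0 ≤ ε * ∑ i ∈ range (w + 1), |windowAvg a K i - a (w - i)| := by positivity
  linarith

/-- Two vanishing windows at distance `h` force near-periodicity with period `h`. -/
lemma shift_le (H : PrimeLike a m K W ε) {θ : ℝ} {w h : ℕ} (hw1 : 4 * m ≤ w)
    (hw2 : w + h ≤ 8 * m + 1) (hθ : windowAvg a K w ≤ θ)
    (hθ' : windowAvg a K (w + h) ≤ θ) :
    ∑ j ∈ range (4 * m), |a (j + h) - a j| ≤ 40 * (ε * m) + 18 * θ * m := by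
  have h1 := H.sum_abs_avg_sub_le hw1 (by omega) hθ
  have h2 := H.sum_abs_avg_sub_le (by omega) hw2 hθ'
  rw [← sum_range_reflect] at h1
  have h3 : ∑ i ∈ range (w + 1), |windowAvg a K (w - i) - a (i + h)| ≤
      20 * (ε * m) + 9 * θ * m := by
    refine le_trans ?_ h2
    rw [← sum_range_reflect]
    rw [show w + h + 1 = (w + 1) + h by ring, sum_range_add _ (w + 1) h]
    refine le_trans ?_ (le_add_of_nonneg_right (sum_nonneg fun _ _ => abs_nonneg _))
    refine le_of_eq (sum_congr rfl fun i hi => ?_)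
    rw [mem_range] at hi
    congr 3 <;> omega
  have h4 : ∑ i ∈ range (w + 1), |windowAvg a K (w - i) - a i| ≤ 20 * (ε * m) + 9 * θ * m := by
    refine le_trans (le_of_eq (sum_congr rfl fun i hi => ?_)) h1
    rw [mem_range] at hi
    congr 3
    omega
  calc _ ≤ ∑ j ∈ range (w + 1), |a (j + h) - a j| :=
        sum_le_sum_of_subset_of_nonneg (range_subset_range.2 (by omega)) fun _ _ _ => abs_nonneg _
    _ ≤ ∑ j ∈ range (w + 1), (|windowAvg a K (w - j) - a (j + h)| +
          |windowAvg a K (w - j) - a j|) := by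
        refine sum_le_sum fun j _ => ?_
        rw [abs_sub_comm (windowAvg a K (w - j)) (a (j + h))]
        exact abs_sub_le _ _ _
    _ ≤ _ := by rw [sum_add_distrib]; linarith

end PrimeLike

end Window

lemma sum_comp_le_of_injOn {J s : Finset ℕ} {g : ℕ → ℝ} {φ : ℕ → ℕ} (hg : ∀ i ∈ s, 0 ≤ g i)
    (hφ : ∀ j ∈ J, φ j ∈ s) (hinj : Set.InjOn φ J) : ∑ j ∈ J, g (φ j) ≤ ∑ i ∈ s, g i := by
  rw [← sum_image (f := g) hinj]
  refine sum_le_sum_of_subset_of_nonneg (image_subset_iff.2 hφ) fun i hi _ => hg i hi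

namespace PrimeLike

variable {a : ℕ → ℝ} {m K W : ℕ} {ε : ℝ}

lemma avg_succ_le (H : PrimeLike a m K W ε) (hA : windowAvg a K (8 * m) ≤ ε) :
    windowAvg a K (8 * m + 1) ≤ 4 * ε := by
  have hm := H.m_large_nat
  have hKm := H.K_le_m
  have h1 := windowAvg_succ_le H.nonneg (H.le_two (8 * m + K) (by omega))
  have hK : (0 : ℝ) < K := by exact_mod_cast H.K_pos
  have he := H.eps_pos
  have h2 : (2 + ε) / K ≤ 3 * ε := by
    rw [div_le_iff₀ hK]
    have := H.one_le_K
    have := H.eps_le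
    linarith
  linarith

lemma shift_one_le (H : PrimeLike a m K W ε) (hA : windowAvg a K (8 * m) ≤ ε) :
    ∑ j ∈ range (4 * m), |a (j + 1) - a j| ≤ 112 * (ε * m) := by
  have he := H.eps_pos
  have := H.shift_le (w := 8 * m) (h := 1) (θ := 4 * ε) (by omega) le_rfl (by linarith)
    (H.avg_succ_le hA)
  linarith

lemma block_bounds (H : PrimeLike a m K W ε) (hA : windowAvg a K (8 * m) ≤ ε) {h : ℕ}
    (hh : h ≤ m) :
    ∑ j ∈ Ico m (2 * m), windowAvg a K (8 * m - (j + h)) * (2 + ε - a (j + h)) ≤ 29 * (ε * m) ∧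
    ∑ j ∈ Ico m (2 * m), a (j + h) * (2 + ε - a (j + h)) ≤ 87 * (ε * m) := by
  have hm := H.m_large_nat
  have he := H.eps_pos
  obtain ⟨s1, s2⟩ := H.sum_avg_mul_le (w := 8 * m) (by omega) (by omega) hA
  have hAB : ∀ i ∈ range (8 * m + 1), windowAvg a K i ≤ 2 + ε := fun i hi =>
    H.avg_le (by rw [mem_range] at hi; omega)
  have haB : ∀ i ∈ range (8 * m + 1), a (8 * m - i) ≤ 2 + ε := fun i hi =>
    H.le_two _ (by omega)
  have hφ : ∀ j ∈ Ico m (2 * m), 8 * m - (j + h) ∈ range (8 * m + 1) := fun j _ => by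
    rw [mem_range]; omega
  have hinj : Set.InjOn (fun j => 8 * m - (j + h)) (Ico m (2 * m) : Finset ℕ) := by
    intro i hi j hj hij
    simp only [coe_Ico, Set.mem_Ico] at hi hj hij
    omega
  have e : ∀ j ∈ Ico m (2 * m), 8 * m - (8 * m - (j + h)) = j + h := fun j hj => by
    rw [mem_Ico] at hj; omega
  have t1 := sum_comp_le_of_injOn
    (g := fun i => windowAvg a K i * (2 + ε - a (8 * m - i)))
    (fun i hi => mul_nonneg (windowAvg_nonneg H.nonneg _ _) (by have := haB i hi; linarith)) hφ hinj
  have t2 := sum_comp_le_of_injOn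
    (g := fun i => a (8 * m - i) * (2 + ε - windowAvg a K i))
    (fun i hi => mul_nonneg (H.nonneg _) (by have := hAB i hi; linarith)) hφ hinj
  have t1' : ∑ j ∈ Ico m (2 * m), windowAvg a K (8 * m - (j + h)) * (2 + ε - a (j + h)) ≤
      29 * (ε * m) := by
    refine le_trans (le_of_eq (sum_congr rfl fun j hj => ?_)) (t1.trans (by linarith))
    rw [e j hj]
  have t2' : ∑ j ∈ Ico m (2 * m), a (j + h) * (2 + ε - windowAvg a K (8 * m - (j + h))) ≤
      29 * (ε * m) := by
    refine le_trans (le_of_eq (sum_congr rfl fun j hj => ?_)) (t2.trans (by linarith))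
    rw [e j hj]
  refine ⟨t1', ?_⟩
  calc _ ≤ ∑ j ∈ Ico m (2 * m), (2 * (a (j + h) * (2 + ε - windowAvg a K (8 * m - (j + h)))) +
        windowAvg a K (8 * m - (j + h)) * (2 + ε - a (j + h))) := by
        refine sum_le_sum fun j hj => ?_
        refine mul_sub_self_le (H.nonneg _) (windowAvg_nonneg H.nonneg _ _)
          (H.le_two _ ?_) (H.avg_le (by omega))
        rw [mem_Ico] at hj
        omega
    _ ≤ _ := by rw [sum_add_distrib, ← mul_sum]; linarith

lemma reset (H : PrimeLike a m K W ε) (hA : windowAvg a K (8 * m) ≤ ε) {h : ℕ} (hh : h ≤ m)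
    (hQ : ∑ j ∈ range (4 * m), |a (j + h) - a j| ≤ m / 10) :
    ∑ j ∈ range (4 * m), |a (j + h) - a j| ≤ 3172 * (ε * m) := by
  have hm := H.m_large_nat
  have hmR := H.m_large
  have he := H.eps_pos
  have he1 := H.eps_le
  have hs := H.small
  obtain ⟨p1, p2⟩ := H.block_bounds hA (h := 0) (Nat.zero_le _)
  obtain ⟨q1, -⟩ := H.block_bounds hA hh
  simp only [add_zero] at p1 p2
  have hE0 : 0 ≤ ε * m := by positivity
  have ha : ∀ j ∈ Ico m (2 * m), a j ≤ 2 + ε := fun j hj => H.le_two _ (by rw [mem_Ico] at hj; omega)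
  have hah : ∀ j ∈ Ico m (2 * m), a (j + h) ≤ 2 + ε := fun j hj =>
    H.le_two _ (by rw [mem_Ico] at hj; omega)
  have hQ' : ∑ j ∈ Ico m (2 * m), |a (j + h) - a j| ≤ m / 10 :=
    le_trans (sum_le_sum_of_subset_of_nonneg (fun j hj => by
      rw [mem_Ico] at hj; rw [mem_range]; omega) fun _ _ _ => abs_nonneg _) hQ
  have hcard : ((Ico m (2 * m)).card : ℝ) = m := by rw [Nat.card_Ico]; congr 1; omega
  have weight : (m : ℝ) ≤ ∑ j ∈ Ico m (2 * m), (2 + ε - a j) * (2 + ε - a (j + h)) := by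
    calc (m : ℝ) ≤ (2 + ε) ^ 2 * m - (2 + ε) * (m + ε * m) - 87 * (ε * m) -
          (2 + ε) * (m / 10) := by nlinarith
      _ ≤ (2 + ε) ^ 2 * m - (2 + ε) * ∑ j ∈ Ico m (2 * m), a j -
          ∑ j ∈ Ico m (2 * m), a j * (2 + ε - a j) -
          (2 + ε) * ∑ j ∈ Ico m (2 * m), |a (j + h) - a j| := by
          have := H.sum_block
          gcongr
      _ = ∑ j ∈ Ico m (2 * m), ((2 + ε) ^ 2 - (2 + ε) * a j - a j * (2 + ε - a j) -
          (2 + ε) * |a (j + h) - a j|) := by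
          rw [sum_sub_distrib, sum_sub_distrib, sum_sub_distrib, sum_const, nsmul_eq_mul, hcard,
            mul_sum, mul_sum]
          ring
      _ ≤ _ := by
          refine sum_le_sum fun j hj => ?_
          have h1 : (2 + ε - a j) * (a (j + h) - a j) ≤ (2 + ε) * |a (j + h) - a j| :=
            (mul_le_mul_of_nonneg_left (le_abs_self _) (by have := ha j hj; linarith)).trans
              (mul_le_mul_of_nonneg_right (by have := H.nonneg j; linarith) (abs_nonneg _))
          linarith
  obtain ⟨j, hj, hjA⟩ : ∃ j ∈ Ico m (2 * m),
      windowAvg a K (8 * m - j) + windowAvg a K (8 * m - (j + h)) ≤ 174 * ε := by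
    by_contra! hcon
    have h1 : 174 * ε * m ≤ 3 * (29 * (ε * m)) + (2 + ε) * (29 * (ε * m)) - 0 := by
      calc 174 * ε * m ≤ 174 * ε *
            ∑ j ∈ Ico m (2 * m), (2 + ε - a j) * (2 + ε - a (j + h)) := by gcongr
        _ ≤ ∑ j ∈ Ico m (2 * m), ((2 + ε) * (windowAvg a K (8 * m - j) * (2 + ε - a j)) +
            (2 + ε) * (windowAvg a K (8 * m - (j + h)) * (2 + ε - a (j + h)))) := by
            rw [mul_sum]
            refine sum_le_sum fun j hj => ?_
            have u1 : 0 ≤ 2 + ε - a j := by have := ha j hj; linarith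
            have u2 : 0 ≤ 2 + ε - a (j + h) := by have := hah j hj; linarith
            have u3 := H.nonneg j
            have u4 := H.nonneg (j + h)
            have v1 := windowAvg_nonneg H.nonneg K (8 * m - j)
            have v2 := windowAvg_nonneg H.nonneg K (8 * m - (j + h))
            calc _ ≤ (windowAvg a K (8 * m - j) + windowAvg a K (8 * m - (j + h))) *
                  ((2 + ε - a j) * (2 + ε - a (j + h))) := by
                  have := (hcon j hj).le
                  gcongr
              _ = (2 + ε - a (j + h)) * (windowAvg a K (8 * m - j) * (2 + ε - a j)) +
                  (2 + ε - a j) * (windowAvg a K (8 * m - (j + h)) * (2 + ε - a (j + h))) := by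
                  ring
              _ ≤ _ := by gcongr <;> linarith
        _ ≤ _ := by
            rw [sum_add_distrib, ← mul_sum, ← mul_sum]
            have : (2 + ε) * ∑ j ∈ Ico m (2 * m), windowAvg a K (8 * m - j) * (2 + ε - a j) ≤
              3 * (29 * (ε * m)) := by
                refine (mul_le_mul_of_nonneg_left p1 (by linarith)).trans ?_
                gcongr
                linarith
            have h2 := mul_le_mul_of_nonneg_left q1 (by linarith : 0 ≤ 2 + ε)
            linarith
    have h3 : 0 < ε * m := by positivity
    have h4 : (2 + ε) * (29 * (ε * m)) ≤ 2.5 * (29 * (ε * m)) := by gcongr; linarith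
    linarith
  rw [mem_Ico] at hj
  have v1 := windowAvg_nonneg H.nonneg K (8 * m - j)
  have v2 := windowAvg_nonneg H.nonneg K (8 * m - (j + h))
  have := H.shift_le (w := 8 * m - (j + h)) (h := h) (θ := 174 * ε) (by omega) (by omega)
    (by linarith) (by rw [show 8 * m - (j + h) + h = 8 * m - j by omega]; linarith)
  linarith

lemma shift_all (H : PrimeLike a m K W ε) (hA : windowAvg a K (8 * m) ≤ ε) {h : ℕ} (hh : h ≤ m) :
    ∑ j ∈ range (4 * m), |a (j + h) - a j| ≤ 3172 * (ε * m) := by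
  have hm := H.m_large_nat
  have he := H.eps_pos
  have he1 := H.eps_le
  have hs := H.small
  induction h with
  | zero => simp; positivity
  | succ h ih =>
    have ih := ih (by omega)
    refine H.reset hA hh ?_
    have h1 := H.shift_one_le hA
    have h2 : ∑ j ∈ range (4 * m), |a (j + 1 + h) - a (j + 1)| + |a (0 + h) - a 0| =
        ∑ j ∈ range (4 * m), |a (j + h) - a j| + |a (4 * m + h) - a (4 * m)| := by
      rw [← sum_range_succ (fun j => |a (j + h) - a j|), sum_range_succ' (fun j => |a (j + h) - a j|)]
    have h3 : |a (4 * m + h) - a (4 * m)| ≤ 2 + ε := by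
      have b1 := H.nonneg (4 * m + h)
      have b2 := H.nonneg (4 * m)
      have b3 := H.le_two (4 * m + h) (by omega)
      have b4 := H.le_two (4 * m) (by omega)
      rw [abs_le]
      constructor <;> linarith
    have h4 : ∑ j ∈ range (4 * m), |a (j + (h + 1)) - a j| ≤
        ∑ j ∈ range (4 * m), |a (j + 1 + h) - a (j + 1)| +
        ∑ j ∈ range (4 * m), |a (j + 1) - a j| := by
      rw [← sum_add_distrib]
      refine sum_le_sum fun j _ => ?_
      rw [show j + (h + 1) = j + 1 + h by ring]
      exact abs_sub_le _ _ _
    have h5 := abs_nonneg (a (0 + h) - a 0)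
    have h6 := H.one_le
    linarith

theorem lt_windowAvg (H : PrimeLike a m K W ε) : ε < windowAvg a K (8 * m) := by
  by_contra! hA
  have hm := H.m_large_nat
  have hmR := H.m_large
  have he := H.eps_pos
  have he1 := H.eps_le
  have hs := H.small
  have hW : (0 : ℝ) < W := by exact_mod_cast H.W_pos
  have hWm := H.W_le_m
  have hcard : ((Ico m (2 * m)).card : ℝ) = m := by rw [Nat.card_Ico]; congr 1; omega
  obtain ⟨-, p2⟩ := H.block_bounds hA (h := 0) (Nat.zero_le _)
  simp only [add_zero] at p2
  have lower : (m : ℝ) - 87 * (ε * m) ≤ 2 * ∑ j ∈ Ico m (2 * m), |a j - 1| := by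
    calc (m : ℝ) - 87 * (ε * m) ≤ ∑ j ∈ Ico m (2 * m), (1 - a j * (2 + ε - a j)) := by
          rw [sum_sub_distrib, sum_const, nsmul_eq_mul, hcard, mul_one]; linarith
      _ ≤ ∑ j ∈ Ico m (2 * m), 2 * |a j - 1| := by
          refine sum_le_sum fun j hj => ?_
          have h1 := H.nonneg j
          have h2 := H.le_two j (by rw [mem_Ico] at hj; omega)
          have h3 : |a j - 1| ≤ 2 := by rw [abs_le]; constructor <;> linarith
          have h4 : 0 ≤ ε * a j := by positivity
          have h5 : |a j - 1| * |a j - 1| = (a j - 1) ^ 2 := by rw [abs_mul_abs_self]; ring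
          have h6 := mul_le_mul_of_nonneg_right h3 (abs_nonneg (a j - 1))
          linarith
      _ = _ := by rw [mul_sum]
  have upper : W * ∑ j ∈ Ico m (2 * m), |a j - 1| ≤ W * (3173 * (ε * m)) := by
    calc _ ≤ ∑ j ∈ Ico m (2 * m), (∑ h ∈ range W, |a (j + h) - a j| + ε * W) := by
          rw [mul_sum]
          refine sum_le_sum fun j hj => ?_
          have h1 := H.sum_window j hj
          have h2 : (W : ℝ) * (a j - 1) =
              (∑ h ∈ range W, a (j + h) - W) - ∑ h ∈ range W, (a (j + h) - a j) := by
            rw [sum_sub_distrib, sum_const, card_range, nsmul_eq_mul]; ring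
          rw [← abs_of_pos hW, ← abs_mul, abs_of_pos hW, h2]
          refine (abs_sub _ _).trans ?_
          have h3 := abs_sum_le_sum_abs (fun h => a (j + h) - a j) (range W)
          linarith
      _ = ∑ h ∈ range W, ∑ j ∈ Ico m (2 * m), |a (j + h) - a j| + m * (ε * W) := by
          rw [sum_add_distrib, sum_comm, sum_const, nsmul_eq_mul, hcard]
      _ ≤ ∑ h ∈ range W, 3172 * (ε * m) + m * (ε * W) := by
          gcongr with h hh
          rw [mem_range] at hh
          refine le_trans (sum_le_sum_of_subset_of_nonneg (fun j hj => ?_)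
            fun _ _ _ => abs_nonneg _) (H.shift_all hA (h := h) (by omega))
          rw [mem_Ico] at hj
          rw [mem_range]
          omega
      _ = _ := by rw [sum_const, card_range, nsmul_eq_mul]; ring
  have := le_of_mul_le_mul_left upper hW
  linarith

end PrimeLike

/-- The sum of `f n / n` over `s < log n ≤ t`. -/
noncomputable def logSum (f : ℕ → ℝ) (s t : ℝ) : ℝ :=
  ∑ n ∈ Ioc ⌊Real.exp s⌋₊ ⌊Real.exp t⌋₊, f n / n

lemma mem_Ioc_floor_exp {s t : ℝ} {n : ℕ} :
    n ∈ Ioc ⌊Real.exp s⌋₊ ⌊Real.exp t⌋₊ ↔ Real.exp s < n ∧ (n : ℝ) ≤ Real.exp t := by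
  rw [mem_Ioc, Nat.floor_lt (Real.exp_pos _).le, Nat.le_floor_iff (Real.exp_pos _).le]

lemma floor_exp_mono {s t : ℝ} (h : s ≤ t) : ⌊Real.exp s⌋₊ ≤ ⌊Real.exp t⌋₊ :=
  Nat.floor_mono (Real.exp_le_exp.2 h)

lemma logSum_add_logSum (f : ℕ → ℝ) {s t u : ℝ} (h1 : s ≤ t) (h2 : t ≤ u) :
    logSum f s t + logSum f t u = logSum f s u :=
  sum_Ioc_consecutive _ (floor_exp_mono h1) (floor_exp_mono h2)

lemma logSum_nonneg {f : ℕ → ℝ} (hf : ∀ n, 0 ≤ f n) (s t : ℝ) : 0 ≤ logSum f s t :=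
  sum_nonneg fun n _ => div_nonneg (hf n) (Nat.cast_nonneg _)

lemma logSum_mono {f g : ℕ → ℝ} {s t : ℝ}
    (h : ∀ n : ℕ, Real.exp s < n → (n : ℝ) ≤ Real.exp t → f n ≤ g n) :
    logSum f s t ≤ logSum g s t :=
  sum_le_sum fun n hn => by
    rw [mem_Ioc_floor_exp] at hn
    exact div_le_div_of_nonneg_right (h n hn.1 hn.2) (Nat.cast_nonneg _)

lemma two_sub_le_cube_mul {σ : ℝ} (h0 : 0 ≤ σ) (h1 : σ ≤ 1 / 100) :
    2 - 100 * σ ≤ (1 - σ) * (2 - 100 * σ / 10) * (1 - σ) * (1 - σ) := by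
  have h2 : 1 - 3 * σ ≤ (1 - σ) ^ 3 := by nlinarith [mul_nonneg h0 h0]
  have h3 := mul_le_mul_of_nonneg_right h2 (by linarith : 0 ≤ 2 - 10 * σ)
  nlinarith [mul_nonneg h0 h0]

lemma sum_div_nat_le {f : ℕ → ℝ} (hf : ∀ n, 0 ≤ f n) {E : ℝ} (hE0 : 0 < E) {X Y : ℕ}
    (hEX : E < X + 1) : ∑ n ∈ Ioc X Y, f n / n ≤ 1 / E * ∑ n ∈ Ioc X Y, f n := by
  rw [mul_sum]
  refine sum_le_sum fun n hn => ?_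
  rw [mem_Ioc] at hn
  rw [one_div_mul_eq_div]
  refine div_le_div_of_nonneg_left (hf n) hE0 ?_
  have : (X : ℝ) + 1 ≤ n := by exact_mod_cast hn.1
  linarith

lemma le_sum_div_nat {f : ℕ → ℝ} (hf : ∀ n, 0 ≤ f n) {E l : ℝ} (hE0 : 0 < E) {X Y : ℕ}
    (hYE : (Y : ℝ) ≤ E * Real.exp l) :
    (1 - l) / E * ∑ n ∈ Ioc X Y, f n ≤ ∑ n ∈ Ioc X Y, f n / n := by
  rw [mul_sum]
  refine sum_le_sum fun n hn => ?_
  rw [mem_Ioc] at hn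
  have hn0 : (0 : ℝ) < n := by exact_mod_cast (by omega : 0 < n)
  rw [div_eq_mul_inv (f n), mul_comm]
  refine mul_le_mul_of_nonneg_left ?_ (hf n)
  rw [div_le_iff₀ hE0, inv_mul_eq_div, le_div_iff₀ hn0]
  have h2 : (n : ℝ) ≤ E * Real.exp l := le_trans (by exact_mod_cast hn.2) hYE
  have h3 : (1 - l) ≤ Real.exp (-l) := by have := Real.add_one_le_exp (-l); linarith
  calc (1 - l) * n ≤ Real.exp (-l) * (E * Real.exp l) := by gcongr
    _ = E * (Real.exp (-l) * Real.exp l) := by ring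
    _ = E := by rw [← Real.exp_add]; simp

set_option maxHeartbeats 1000000 in
/-- Selberg's formula in short intervals, on the logarithmic scale. -/
theorem exists_selberg_log {ε : ℝ} (hε : 0 < ε) (hε1 : ε ≤ 1) : ∃ δ : ℝ, 0 < δ ∧ ∃ y₀ : ℝ, 0 < y₀ ∧
    ∀ y l : ℝ, y₀ ≤ y → Real.exp (-(δ * y)) ≤ l → l ≤ ε / 100 →
    (2 - ε) * y * l ≤ logSum selbergLam y (y + l) ∧
    logSum selbergLam y (y + l) ≤ (2 + ε) * y * l := by
  obtain ⟨δ, hδ, hδ1, X₀, hS⟩ := exists_selberg_short (ε := ε / 10) (by positivity)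
  set σ := ε / 100 with hσ
  have hσ0 : 0 < σ := by positivity
  have hσ1 : σ ≤ 1 / 100 := by rw [hσ]; linarith
  refine ⟨δ / 2, by positivity, X₀ + 2 / δ + 2 / σ + 1, by positivity, fun y l hy hl hl1 => ?_⟩
  have q1 : 0 ≤ 2 / δ := by positivity
  have q2 : 0 ≤ 2 / σ := by positivity
  have q3 : (0 : ℝ) ≤ X₀ := Nat.cast_nonneg _
  have hyX : (X₀ : ℝ) + 1 ≤ y := by linarith
  have hyδ : 2 ≤ δ * y := by
    have : 2 / δ ≤ y := by linarith
    rwa [div_le_iff₀' hδ] at this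
  have hyσ : 2 ≤ σ * y := by
    have : 2 / σ ≤ y := by linarith
    rwa [div_le_iff₀' hσ0] at this
  have hy1 : 1 ≤ y := by linarith
  have hl0 : 0 < l := (Real.exp_pos _).trans_le hl
  set E := Real.exp y with hE
  have hE0 : 0 < E := Real.exp_pos _
  have hEy : y + 1 ≤ E := Real.add_one_le_exp y
  have hEl : 1 ≤ σ * (E * l) := by
    have h1 : Real.exp (y / 2) ≤ E * l := by
      calc Real.exp (y / 2) ≤ Real.exp (y + -(δ / 2 * y)) := Real.exp_le_exp.2 (by nlinarith)
        _ = E * Real.exp (-(δ / 2 * y)) := Real.exp_add _ _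
        _ ≤ _ := by gcongr
    have h2 := Real.add_one_le_exp (y / 2)
    have h3 : σ * (y / 2) ≤ σ * (E * l) := by gcongr; linarith
    linarith
  set X := ⌊E⌋₊ with hX
  have hXE : (X : ℝ) ≤ E := Nat.floor_le hE0.le
  have hEX : E < X + 1 := Nat.lt_floor_add_one _
  set Y := ⌊Real.exp (y + l)⌋₊ with hY
  have hee : Real.exp (y + l) = E * Real.exp l := Real.exp_add _ _
  have hYE : (Y : ℝ) ≤ E * Real.exp l := by rw [← hee]; exact Nat.floor_le (Real.exp_pos _).le
  have hEY : E * Real.exp l < Y + 1 := by rw [← hee]; exact Nat.lt_floor_add_one _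
  have hXY : X ≤ Y := floor_exp_mono (by linarith)
  have hexp1 : Real.exp l ≤ 1 + l + σ * l := by
    have := Real.abs_exp_sub_one_sub_id_le (x := l) (by rw [abs_of_pos hl0]; linarith)
    have h2 := (abs_le.1 this).2
    have h3 : l * l ≤ σ * l := mul_le_mul_of_nonneg_right hl1 hl0.le
    linarith
  have hexp2 := Real.add_one_le_exp l
  obtain ⟨h, hh⟩ : ∃ h, Y = X + h := ⟨Y - X, by omega⟩
  have hYr : (Y : ℝ) = X + h := by exact_mod_cast hh
  have u1 : E * Real.exp l ≤ E * (1 + l + σ * l) := by gcongr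
  have u2 : E * (l + 1) ≤ E * Real.exp l := by gcongr
  have hhu : (h : ℝ) ≤ (1 + 2 * σ) * (E * l) := by linarith
  have hhl : (1 - σ) * (E * l) ≤ h := by linarith
  have hEl0 : 0 < E * l := by positivity
  have hX0 : (1 : ℝ) ≤ X := by linarith
  have hhX : h ≤ X := by
    have h1 : E * l ≤ E * (1 / 100) := by gcongr; linarith
    have h2 : (1 + 2 * σ) * (E * l) ≤ 2 * (E * l) := by gcongr; linarith
    have : (h : ℝ) ≤ X := by linarith
    exact_mod_cast this
  have hlogX : Real.log X ≤ y := by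
    rw [Real.log_le_iff_le_exp (by linarith)]; exact hXE
  have hlogX' : (1 - σ) * y ≤ Real.log X := by
    rw [Real.le_log_iff_exp_le (by linarith)]
    calc Real.exp ((1 - σ) * y) ≤ Real.exp (y - 1) := Real.exp_le_exp.2 (by linarith)
      _ = E * Real.exp (-1) := by rw [sub_eq_add_neg, Real.exp_add]
      _ ≤ E * (1 / 2) := by
        gcongr
        rw [Real.exp_neg, ← one_div]
        have := Real.add_one_le_exp (1 : ℝ)
        exact one_div_le_one_div_of_le (by norm_num) (by linarith)
      _ ≤ X := by linarith
  have hXh : (X : ℝ) ^ (1 - δ) ≤ h := by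
    calc (X : ℝ) ^ (1 - δ) ≤ E ^ (1 - δ) := Real.rpow_le_rpow (by linarith) hXE (by linarith)
      _ = Real.exp (y + -(δ / 2 * y)) * Real.exp (-(δ / 2 * y)) := by
        rw [hE, ← Real.exp_mul, ← Real.exp_add]; ring_nf
      _ ≤ (E * l) * (1 - σ) := by
        rw [Real.exp_add]
        gcongr
        rw [Real.exp_neg]
        have h1 := Real.add_one_le_exp (δ / 2 * y)
        have h2 : (Real.exp (δ / 2 * y))⁻¹ ≤ 2⁻¹ := by
          apply inv_anti₀ (by norm_num); linarith
        norm_num at h2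
        linarith
      _ ≤ h := by linarith
  have hX₀ : X₀ ≤ X := by
    have : (X₀ : ℝ) ≤ X := by linarith
    exact_mod_cast this
  have hmain := abs_le.1 (hS X h hX₀ hhX hXh)
  have hlogX0 : 0 ≤ Real.log X := Real.log_nonneg hX0
  have hhlog : h * Real.log X ≤ (1 + 2 * σ) * (E * l) * y := by gcongr
  have hhlog' : (1 - σ) * (E * l) * ((1 - σ) * y) ≤ h * Real.log X := by
    exact mul_le_mul hhl hlogX' (mul_nonneg (by linarith) (by linarith)) (Nat.cast_nonneg _)
  unfold logSum
  change _ ≤ ∑ n ∈ Ioc X Y, selbergLam n / n ∧ ∑ n ∈ Ioc X Y, selbergLam n / n ≤ _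
  have hyl : 0 < y * l := by positivity
  have e : ε = 100 * σ := by rw [hσ]; ring
  rw [hh] at hYE ⊢
  generalize hS : ∑ n ∈ Ioc X (X + h), selbergLam n = S at hmain
  constructor
  · refine le_trans ?_ (le_sum_div_nat selbergLam_nonneg hE0 hYE)
    rw [hS]
    have h2 : (2 - ε / 10) * ((1 - σ) * (E * l) * ((1 - σ) * y)) ≤ S := by
      have := mul_le_mul_of_nonneg_left hhlog' (by linarith : 0 ≤ 2 - ε / 10)
      linarith [hmain.1]
    have hS0 : 0 ≤ S := by rw [← hS]; exact sum_nonneg fun n _ => selbergLam_nonneg n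
    calc (2 - ε) * y * l = (2 - ε) * (y * l) := by ring
      _ ≤ ((1 - σ) * (2 - ε / 10) * (1 - σ) * (1 - σ)) * (y * l) := by
          refine mul_le_mul_of_nonneg_right ?_ hyl.le
          rw [e]
          have h3 := two_sub_le_cube_mul hσ0.le hσ1
          linarith
      _ = (1 - σ) / E * ((2 - ε / 10) * ((1 - σ) * (E * l) * ((1 - σ) * y))) := by
          field_simp
      _ ≤ (1 - σ) / E * S := mul_le_mul_of_nonneg_left h2 (div_nonneg (by linarith) hE0.le)
      _ ≤ _ := mul_le_mul_of_nonneg_right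
          (div_le_div_of_nonneg_right (by linarith) hE0.le) hS0
  · refine (sum_div_nat_le selbergLam_nonneg hE0 hEX).trans ?_
    rw [hS]
    have h2 : S ≤ (2 + ε / 10) * ((1 + 2 * σ) * (E * l) * y) := by
      have := mul_le_mul_of_nonneg_left hhlog (by linarith : 0 ≤ 2 + ε / 10)
      linarith [hmain.2]
    calc _ ≤ 1 / E * ((2 + ε / 10) * ((1 + 2 * σ) * (E * l) * y)) :=
          mul_le_mul_of_nonneg_left h2 (by positivity)
      _ = ((2 + ε / 10) * (1 + 2 * σ)) * (y * l) := by field_simp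
      _ ≤ (2 + ε) * (y * l) := by
          refine mul_le_mul_of_nonneg_right ?_ hyl.le
          rw [e]
          have h3 : σ * σ ≤ σ * (1 / 100) := mul_le_mul_of_nonneg_left hσ1 hσ0.le
          linarith
      _ = _ := by ring

lemma sum_le_sum_of_support {s t : Finset ℕ} {f : ℕ → ℝ} (hf : ∀ n, 0 ≤ f n)
    (h : ∀ n ∈ s, f n ≠ 0 → n ∈ t) : ∑ n ∈ s, f n ≤ ∑ n ∈ t, f n := by
  rw [← sum_filter_ne_zero s]
  refine sum_le_sum_of_subset_of_nonneg (fun n hn => ?_) fun n _ _ => hf n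
  rw [mem_filter] at hn
  exact h n hn.1 hn.2

lemma logSum_le_logSum {f : ℕ → ℝ} (hf : ∀ n, 0 ≤ f n) {s t s' t' : ℝ}
    (h : ∀ n : ℕ, f n ≠ 0 → Real.exp s < n → (n : ℝ) ≤ Real.exp t →
      Real.exp s' < n ∧ (n : ℝ) ≤ Real.exp t') : logSum f s t ≤ logSum f s' t' := by
  refine sum_le_sum_of_support (fun n => div_nonneg (hf n) (Nat.cast_nonneg _)) fun n hn hfn => ?_
  rw [mem_Ioc_floor_exp] at hn ⊢
  exact h n (fun h0 => hfn (by rw [h0, zero_div])) hn.1 hn.2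

lemma vonMangoldt_ne_zero_two_le {n : ℕ} (h : vonMangoldt n ≠ 0) : 2 ≤ n := by
  rw [ArithmeticFunction.vonMangoldt_ne_zero_iff] at h
  exact h.two_le

/-- Mertens' theorem on the logarithmic scale. -/
lemma logSum_zero_bounds {t : ℝ} (ht : 0 ≤ t) :
    t - 2 ≤ logSum (fun n => vonMangoldt n) 0 t ∧ logSum (fun n => vonMangoldt n) 0 t ≤ t + 6 := by
  have he : 1 ≤ Real.exp t := Real.one_le_exp ht
  have hn : 0 < ⌊Real.exp t⌋₊ := Nat.floor_pos.2 he
  have h1 := sum_vonMangoldt_div_le ⌊Real.exp t⌋₊ hn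
  have h2 := le_sum_vonMangoldt_div ⌊Real.exp t⌋₊ hn
  have hn' : (1 : ℝ) ≤ ⌊Real.exp t⌋₊ := by exact_mod_cast hn
  have h3 : Real.log ⌊Real.exp t⌋₊ ≤ t := by
    rw [Real.log_le_iff_le_exp (by linarith)]; exact Nat.floor_le (by linarith)
  have h4 : t - 1 ≤ Real.log ⌊Real.exp t⌋₊ := by
    rw [Real.le_log_iff_exp_le (by linarith), Real.exp_sub]
    rw [div_le_iff₀ (Real.exp_pos _)]
    have h5 := Real.add_one_le_exp (1 : ℝ)
    have h6 := Nat.lt_floor_add_one (Real.exp t)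
    have h7 : (⌊Real.exp t⌋₊ : ℝ) * 2 ≤ ⌊Real.exp t⌋₊ * Real.exp 1 := by gcongr; linarith
    linarith
  have e : logSum (fun n => vonMangoldt n) 0 t =
      ∑ d ∈ Ioc 0 ⌊Real.exp t⌋₊, vonMangoldt d / d := by
    unfold logSum
    rw [Real.exp_zero, Nat.floor_one, ← sum_Ioc_consecutive _ zero_le_one hn,
      show Ioc 0 1 = ({1} : Finset ℕ) from rfl, sum_singleton]
    simp
  rw [e]
  constructor <;> linarith

lemma abs_logSum_sub_le {s t : ℝ} (hs : 0 ≤ s) (hst : s ≤ t) :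
    |logSum (fun n => vonMangoldt n) s t - (t - s)| ≤ 8 := by
  have h1 := logSum_zero_bounds hs
  have h2 := logSum_zero_bounds (hs.trans hst)
  have h3 := logSum_add_logSum (fun n => vonMangoldt n) hs hst
  rw [abs_le]
  constructor <;> linarith [h1.1, h1.2, h2.1, h2.2]

/-- The density of primes in the cell `jτ < log n ≤ (j + 1)τ`. -/
noncomputable def cellDensity (τ : ℝ) (j : ℕ) : ℝ :=
  logSum (fun n => vonMangoldt n) (j * τ) ((j + 1 : ℕ) * τ) / τ

lemma cellDensity_nonneg {τ : ℝ} (hτ : 0 < τ) (j : ℕ) : 0 ≤ cellDensity τ j :=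
  div_nonneg (logSum_nonneg (fun _ => ArithmeticFunction.vonMangoldt_nonneg) _ _) hτ.le

lemma sum_Ioc_cells (F : ℕ → ℝ) {τ : ℝ} (hτ : 0 ≤ τ) (p K : ℕ) :
    ∑ l ∈ range K, ∑ n ∈ Ioc ⌊Real.exp ((p + l : ℕ) * τ)⌋₊ ⌊Real.exp ((p + l + 1 : ℕ) * τ)⌋₊, F n =
    ∑ n ∈ Ioc ⌊Real.exp (p * τ)⌋₊ ⌊Real.exp ((p + K : ℕ) * τ)⌋₊, F n := by
  induction K with
  | zero => simp
  | succ K ih =>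
    rw [sum_range_succ, ih]
    refine sum_Ioc_consecutive _ (floor_exp_mono ?_) (floor_exp_mono ?_)
    · exact mul_le_mul_of_nonneg_right (by exact_mod_cast (by omega : p ≤ p + K)) hτ
    · exact mul_le_mul_of_nonneg_right (by exact_mod_cast (by omega : p + K ≤ p + K + 1)) hτ

lemma sum_cellDensity {τ : ℝ} (hτ : 0 < τ) (p K : ℕ) :
    ∑ l ∈ range K, cellDensity τ (p + l) =
      logSum (fun n => vonMangoldt n) (p * τ) ((p + K : ℕ) * τ) / τ := by
  unfold cellDensity
  rw [← sum_div]
  congr 1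
  exact sum_Ioc_cells (fun n => vonMangoldt n / n) hτ.le p K

lemma logSum_eq_windowAvg {τ : ℝ} (hτ : 0 < τ) (p : ℕ) {K : ℕ} (hK : 0 < K) :
    logSum (fun n => vonMangoldt n) (p * τ) ((p + K : ℕ) * τ) =
      τ * K * windowAvg (cellDensity τ) K p := by
  have hK0 : (0 : ℝ) < K := by exact_mod_cast hK
  unfold windowAvg
  rw [sum_cellDensity hτ]
  field_simp

lemma abs_sum_cellDensity_sub_le {τ : ℝ} (hτ : 0 < τ) (p K : ℕ) :
    |∑ l ∈ range K, cellDensity τ (p + l) - K| ≤ 8 / τ := by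
  rw [sum_cellDensity hτ]
  have h := abs_logSum_sub_le (s := p * τ) (t := (p + K : ℕ) * τ) (by positivity)
    (by gcongr; omega)
  have e : logSum (fun n => vonMangoldt n) (p * τ) ((p + K : ℕ) * τ) / τ - K =
      (logSum (fun n => vonMangoldt n) (p * τ) ((p + K : ℕ) * τ) -
        ((p + K : ℕ) * τ - p * τ)) / τ := by
    push_cast
    field_simp
    ring
  rw [e, abs_div, abs_of_pos hτ]
  gcongr

lemma sum_Ioc_convolution (A B : ℕ) :
    ∑ n ∈ Ioc A B, (vonMangoldt * vonMangoldt) n / (n : ℝ) =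
    ∑ d ∈ Ioc 0 B, vonMangoldt d / d *
      ∑ e ∈ Ioc 0 B with A < d * e ∧ d * e ≤ B, vonMangoldt e / e := by
  have h1 : ∀ n ∈ Ioc A B, (vonMangoldt * vonMangoldt) n / (n : ℝ) =
      ∑ p ∈ Ioc 0 B ×ˢ Ioc 0 B, if p.1 * p.2 = n then
        vonMangoldt p.1 / p.1 * (vonMangoldt p.2 / p.2) else 0 := by
    intro n hn
    rw [mem_Ioc] at hn
    rw [← sum_filter, ArithmeticFunction.mul_apply, sum_div]
    have hs : (n.divisorsAntidiagonal : Finset (ℕ × ℕ)) =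
        {p ∈ Ioc 0 B ×ˢ Ioc 0 B | p.1 * p.2 = n} := by
      ext p
      rw [Nat.mem_divisorsAntidiagonal, mem_filter, mem_product, mem_Ioc, mem_Ioc]
      constructor
      · rintro ⟨h, h0⟩
        have p1 : 0 < p.1 := Nat.pos_of_ne_zero fun h' => h0 (by rw [← h, h', zero_mul])
        have p2 : 0 < p.2 := Nat.pos_of_ne_zero fun h' => h0 (by rw [← h, h', mul_zero])
        refine ⟨⟨⟨p1, ?_⟩, p2, ?_⟩, h⟩
        · exact (Nat.le_mul_of_pos_right _ p2).trans (h.le.trans hn.2)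
        · exact (Nat.le_mul_of_pos_left _ p1).trans (h.le.trans hn.2)
      · rintro ⟨-, h⟩
        exact ⟨h, by omega⟩
    rw [hs]
    refine sum_congr rfl fun p hp => ?_
    rw [mem_filter] at hp
    rw [← hp.2]
    push_cast
    rw [mul_div_mul_comm]
  rw [sum_congr rfl h1, sum_comm, sum_product]
  refine sum_congr rfl fun d _ => ?_
  rw [mul_sum, sum_filter]
  refine sum_congr rfl fun e _ => ?_
  rw [sum_ite_eq]
  simp only [mem_Ioc]

lemma logSum_convolution_le (s t : ℝ) :
    logSum (fun n => (vonMangoldt * vonMangoldt) n) s t ≤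
      ∑ d ∈ Ioc 1 ⌊Real.exp t⌋₊, vonMangoldt d / d *
        logSum (fun n => vonMangoldt n) (s - Real.log d) (t - Real.log d) := by
  have hL : ∀ s t, 0 ≤ logSum (fun n => vonMangoldt n) s t :=
    logSum_nonneg fun _ => ArithmeticFunction.vonMangoldt_nonneg
  calc _ = _ := sum_Ioc_convolution _ _
    _ ≤ ∑ d ∈ Ioc 0 ⌊Real.exp t⌋₊, vonMangoldt d / d *
        logSum (fun n => vonMangoldt n) (s - Real.log d) (t - Real.log d) := by
        refine sum_le_sum fun d hd => ?_
        rw [mem_Ioc] at hd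
        have hd0 : (0 : ℝ) < d := by exact_mod_cast hd.1
        refine mul_le_mul_of_nonneg_left ?_
          (div_nonneg ArithmeticFunction.vonMangoldt_nonneg hd0.le)
        refine sum_le_sum_of_subset_of_nonneg (fun e he => ?_) fun e _ _ =>
          div_nonneg ArithmeticFunction.vonMangoldt_nonneg (Nat.cast_nonneg _)
        rw [mem_filter, Nat.floor_lt (Real.exp_pos _).le, Nat.le_floor_iff (Real.exp_pos _).le] at he
        rw [mem_Ioc_floor_exp, Real.exp_sub, Real.exp_sub, Real.exp_log hd0, div_lt_iff₀' hd0,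
          le_div_iff₀' hd0]
        exact_mod_cast he.2
    _ ≤ _ := by
        refine sum_le_sum_of_support (fun n => mul_nonneg (div_nonneg
          ArithmeticFunction.vonMangoldt_nonneg (Nat.cast_nonneg _)) (hL _ _)) fun n hn h0 => ?_
        have h2 : vonMangoldt n ≠ 0 := fun h => h0 (by rw [h]; simp)
        have := vonMangoldt_ne_zero_two_le h2
        rw [mem_Ioc] at hn ⊢
        omega

lemma logSum_convolution_cells_le {τ : ℝ} (hτ : 0 < τ) (k : ℕ) {K : ℕ} (hK : 0 < K) :
    logSum (fun n => (vonMangoldt * vonMangoldt) n) ((k + 1 : ℕ) * τ) ((k + K : ℕ) * τ) ≤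
      τ ^ 2 * K * ∑ i ∈ range (k + K), cellDensity τ i * windowAvg (cellDensity τ) K (k - i) := by
  refine (logSum_convolution_le _ _).trans ?_
  have e := sum_Ioc_cells (fun d => vonMangoldt d / d * logSum (fun n => vonMangoldt n)
    ((k + 1 : ℕ) * τ - Real.log d) ((k + K : ℕ) * τ - Real.log d)) hτ.le 0 (k + K)
  simp only [zero_add, CharP.cast_eq_zero, zero_mul, Real.exp_zero, Nat.floor_one] at e
  rw [← e, mul_sum]
  refine sum_le_sum fun i hi => ?_
  rw [mem_range] at hi
  have e2 : τ ^ 2 * K * (cellDensity τ i * windowAvg (cellDensity τ) K (k - i)) =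
      ∑ d ∈ Ioc ⌊Real.exp (i * τ)⌋₊ ⌊Real.exp ((i + 1 : ℕ) * τ)⌋₊, vonMangoldt d / d *
        logSum (fun n => vonMangoldt n) ((k - i : ℕ) * τ) ((k - i + K : ℕ) * τ) := by
    rw [logSum_eq_windowAvg hτ _ hK, ← sum_mul]
    unfold cellDensity logSum
    field_simp
  rw [e2]
  refine sum_le_sum fun d hd => mul_le_mul_of_nonneg_left ?_
    (div_nonneg ArithmeticFunction.vonMangoldt_nonneg (Nat.cast_nonneg _))
  rw [mem_Ioc_floor_exp] at hd
  have hd0 : (0 : ℝ) < d := (Real.exp_pos _).trans hd.1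
  have hd1 : i * τ < Real.log d := (Real.lt_log_iff_exp_lt hd0).2 hd.1
  have hd2 : Real.log d ≤ (i + 1 : ℕ) * τ := (Real.log_le_iff_le_exp hd0).2 hd.2
  refine logSum_le_logSum (fun _ => ArithmeticFunction.vonMangoldt_nonneg) fun n hn h1 h2 => ?_
  have hn2 := vonMangoldt_ne_zero_two_le hn
  refine ⟨?_, h2.trans (Real.exp_le_exp.2 ?_)⟩
  · rcases le_total i k with hik | hik
    · refine lt_of_le_of_lt (Real.exp_le_exp.2 ?_) h1
      rw [Nat.cast_sub hik]
      push_cast at hd2 ⊢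
      linarith
    · rw [Nat.sub_eq_zero_of_le hik]
      simp only [CharP.cast_eq_zero, zero_mul, Real.exp_zero]
      exact_mod_cast (by omega : 1 < n)
  · have : ((k + K : ℕ) : ℝ) * τ ≤ (i + (k - i + K) : ℕ) * τ :=
      mul_le_mul_of_nonneg_right (by exact_mod_cast (by omega : k + K ≤ i + (k - i + K))) hτ.le
    push_cast at this hd2 ⊢
    linarith

lemma logSum_selbergLam_cells_le {τ : ℝ} (hτ : 0 < τ) (k : ℕ) {K : ℕ} (hK : 0 < K) :
    logSum selbergLam ((k + 1 : ℕ) * τ) ((k + K : ℕ) * τ) ≤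
      τ ^ 2 * K * ((k + K) * windowAvg (cellDensity τ) K k +
        ∑ i ∈ range (k + K), cellDensity τ i * windowAvg (cellDensity τ) K (k - i)) := by
  have h1 : logSum selbergLam ((k + 1 : ℕ) * τ) ((k + K : ℕ) * τ) =
      logSum (fun n => vonMangoldt n * Real.log n) ((k + 1 : ℕ) * τ) ((k + K : ℕ) * τ) +
      logSum (fun n => (vonMangoldt * vonMangoldt) n) ((k + 1 : ℕ) * τ) ((k + K : ℕ) * τ) := by
    unfold logSum selbergLam
    rw [← sum_add_distrib]
    exact sum_congr rfl fun _ _ => add_div _ _ _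
  have h2 := logSum_convolution_cells_le hτ k hK
  have h3 : logSum (fun n => vonMangoldt n * Real.log n) ((k + 1 : ℕ) * τ) ((k + K : ℕ) * τ) ≤
      (k + K : ℕ) * τ * logSum (fun n => vonMangoldt n) (k * τ) ((k + K : ℕ) * τ) := by
    calc _ ≤ (k + K : ℕ) * τ * logSum (fun n => vonMangoldt n) ((k + 1 : ℕ) * τ)
          ((k + K : ℕ) * τ) := by
          unfold logSum
          rw [mul_sum]
          refine sum_le_sum fun n hn => ?_
          rw [mem_Ioc_floor_exp] at hn
          have hn0 : (0 : ℝ) < n := (Real.exp_pos _).trans hn.1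
          have : Real.log n ≤ (k + K : ℕ) * τ := (Real.log_le_iff_le_exp hn0).2 hn.2
          beta_reduce
          rw [mul_comm (vonMangoldt n), mul_div_assoc]
          exact mul_le_mul_of_nonneg_right this
            (div_nonneg ArithmeticFunction.vonMangoldt_nonneg hn0.le)
      _ ≤ _ := by
          gcongr
          refine logSum_le_logSum (fun _ => ArithmeticFunction.vonMangoldt_nonneg)
            fun n _ h1 h2 => ⟨lt_of_le_of_lt (Real.exp_le_exp.2 ?_) h1, h2⟩
          gcongr
          omega
  rw [logSum_eq_windowAvg hτ _ hK] at h3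
  rw [h1]
  push_cast at h2 h3 ⊢
  linarith

/-- The sequence `b` with its first `j₀` terms replaced by zero. -/
def truncate (j₀ : ℕ) (b : ℕ → ℝ) (j : ℕ) : ℝ := if j < j₀ then 0 else b j

lemma truncate_nonneg {b : ℕ → ℝ} (hb : ∀ j, 0 ≤ b j) (j₀ j : ℕ) : 0 ≤ truncate j₀ b j := by
  unfold truncate
  split_ifs
  exacts [le_rfl, hb j]

lemma truncate_le {b : ℕ → ℝ} (hb : ∀ j, 0 ≤ b j) (j₀ j : ℕ) : truncate j₀ b j ≤ b j := by
  unfold truncate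
  split_ifs
  exacts [hb j, le_rfl]

lemma truncate_of_le {b : ℕ → ℝ} {j₀ j : ℕ} (h : j₀ ≤ j) : truncate j₀ b j = b j := by
  rw [truncate, if_neg (by omega)]

lemma windowAvg_truncate {b : ℕ → ℝ} {j₀ i : ℕ} (h : j₀ ≤ i) (K : ℕ) :
    windowAvg (truncate j₀ b) K i = windowAvg b K i := by
  unfold windowAvg
  congr 1
  exact sum_congr rfl fun l _ => truncate_of_le (by omega)

lemma windowAvg_le_of_mem {a : ℕ → ℝ} {B : ℝ} {K i : ℕ} (hK : 0 < K)
    (h : ∀ j, i ≤ j → j < i + K → a j ≤ B) : windowAvg a K i ≤ B := by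
  unfold windowAvg
  rw [div_le_iff₀ (by exact_mod_cast hK)]
  calc _ ≤ ∑ l ∈ range K, B := sum_le_sum fun l hl => by
        rw [mem_range] at hl
        exact h _ (by omega) (by omega)
    _ = _ := by simp [mul_comm]

lemma sum_mul_windowAvg_le {b : ℕ → ℝ} (hb : ∀ j, 0 ≤ b j) {c B : ℝ} (hB : 0 ≤ B)
    (hs : ∀ w, ∑ i ∈ range w, b i ≤ w + c) {j₀ k K : ℕ} (hK : 0 < K) (hk : 2 * j₀ ≤ k)
    (hle : ∀ j, j₀ ≤ j → j < k + K → b j ≤ B) :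
    ∑ i ∈ range (k + K), b i * windowAvg b K (k - i) ≤
      ∑ i ∈ range (k + 1), windowAvg (truncate j₀ b) K i * truncate j₀ b (k - i) +
        B * (2 * j₀ + 2 * K + 3 * c) := by
  have hA := windowAvg_nonneg hb K
  have hT := truncate_nonneg hb j₀
  have hTA := windowAvg_nonneg hT K
  have hsA : ∀ w, ∑ i ∈ range w, windowAvg b K i ≤ w + K + c := fun w =>
    sum_windowAvg_le hb hK fun v _ => hs v
  have hAle : ∀ i, j₀ ≤ i → i ≤ k → windowAvg b K i ≤ B := fun i h1 h2 =>
    windowAvg_le_of_mem hK fun j h3 h4 => hle j (by omega) (by omega)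
  have h1 : ∑ i ∈ range (k + 1), b i * windowAvg b K (k - i) ≤
      ∑ i ∈ range (k + 1), truncate j₀ b i * windowAvg (truncate j₀ b) K (k - i) +
      (B * (j₀ + c) + B * (j₀ + K + c)) := by
    have h2 : ∀ i ∈ range (k + 1), b i * windowAvg b K (k - i) ≤
        truncate j₀ b i * windowAvg (truncate j₀ b) K (k - i) +
        ((if i < j₀ then B * b i else 0) +
          if k - i < j₀ then B * windowAvg b K (k - i) else 0) := by
      intro i hi
      rw [mem_range] at hi
      have hn := mul_nonneg (hT i) (hTA (k - i))
      rcases lt_or_ge i j₀ with h3 | h3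
      · rw [if_pos h3, if_neg (by omega)]
        have := mul_le_mul_of_nonneg_left (hAle (k - i) (by omega) (by omega)) (hb i)
        linarith
      · rcases lt_or_ge (k - i) j₀ with h4 | h4
        · rw [if_neg (by omega), if_pos h4]
          have := mul_le_mul_of_nonneg_right (hle i h3 (by omega)) (hA (k - i))
          linarith
        · rw [if_neg (by omega), if_neg (by omega), truncate_of_le h3, windowAvg_truncate h4]
          linarith
    refine (sum_le_sum h2).trans ?_
    rw [sum_add_distrib, sum_add_distrib]
    refine add_le_add le_rfl (add_le_add ?_ ?_)
    · rw [← sum_filter, ← mul_sum]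
      refine mul_le_mul_of_nonneg_left (le_trans (le_of_eq ?_) (hs j₀)) hB
      congr 1
      ext i
      rw [mem_filter, mem_range, mem_range]
      omega
    · have e := sum_range_reflect (fun i => if i < j₀ then B * windowAvg b K i else 0) (k + 1)
      simp only [Nat.add_sub_cancel] at e
      rw [e, ← sum_filter, ← mul_sum]
      refine mul_le_mul_of_nonneg_left (le_trans (le_of_eq ?_) (hsA j₀)) hB
      congr 1
      ext i
      rw [mem_filter, mem_range, mem_range]
      omega
  have h2 : ∑ i ∈ Ico (k + 1) (k + K), b i * windowAvg b K (k - i) ≤ B * (K + c) := by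
    have h0 : windowAvg b K 0 * K ≤ K + c := by
      unfold windowAvg
      rw [div_mul_cancel₀ _ (by exact_mod_cast hK.ne')]
      simpa using hs K
    calc _ ≤ ∑ i ∈ Ico (k + 1) (k + K), B * windowAvg b K 0 := sum_le_sum fun i hi => by
          rw [mem_Ico] at hi
          rw [Nat.sub_eq_zero_of_le (by omega)]
          exact mul_le_mul_of_nonneg_right (hle i (by omega) hi.2) (hA 0)
      _ = ((k + K - (k + 1) : ℕ) : ℝ) * (B * windowAvg b K 0) := by
          rw [sum_const, Nat.card_Ico, nsmul_eq_mul]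
      _ ≤ K * (B * windowAvg b K 0) :=
          mul_le_mul_of_nonneg_right (by exact_mod_cast (by omega)) (mul_nonneg hB (hA 0))
      _ = B * (windowAvg b K 0 * K) := by ring
      _ ≤ _ := mul_le_mul_of_nonneg_left h0 hB
  have e := sum_range_reflect
    (fun i => windowAvg (truncate j₀ b) K i * truncate j₀ b (k - i)) (k + 1)
  simp only [Nat.add_sub_cancel] at e
  have e2 : ∑ i ∈ range (k + 1), windowAvg (truncate j₀ b) K i * truncate j₀ b (k - i) =
      ∑ i ∈ range (k + 1), truncate j₀ b i * windowAvg (truncate j₀ b) K (k - i) := by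
    rw [← e]
    refine sum_congr rfl fun i hi => ?_
    rw [mem_range] at hi
    rw [Nat.sub_sub_self (by omega), mul_comm]
  rw [range_eq_Ico, ← sum_Ico_consecutive _ (Nat.zero_le (k + 1)) (by omega : k + 1 ≤ k + K),
    ← range_eq_Ico, e2]
  linarith

lemma primeLike_cells {τ ε : ℝ} {m K W j₀ : ℕ} (hτ : 0 < τ) (hε : 0 < ε) (hε6 : ε ≤ 1 / 10 ^ 6)
    (hK : 100 ≤ ε * K) (hKm : 100 * K ≤ ε * m) (hj₀ : 50 * j₀ ≤ ε * m) (hc : 800 / τ ≤ ε * m)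
    (hW0 : 0 < W) (hW : W ≤ ε * m) (hWτ : 8 / τ ≤ ε * W)
    (hb : ∀ j, j₀ ≤ j → j < 16 * m → cellDensity τ j ≤ 2 + ε)
    (hS : ∀ k, 4 * m ≤ k → k ≤ 8 * m + 1 → (2 - ε / 100) * ((k + 1 : ℕ) * τ) * ((K - 1) * τ) ≤
      logSum selbergLam ((k + 1 : ℕ) * τ) ((k + K : ℕ) * τ)) :
    PrimeLike (truncate j₀ (cellDensity τ)) m K W ε := by
  have hb0 := cellDensity_nonneg hτ
  have hK0 : 0 < K := by
    rcases Nat.eq_zero_or_pos K with h0 | h0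
    · rw [h0] at hK; norm_num at hK
    · exact h0
  have hKr : (0 : ℝ) < K := by exact_mod_cast hK0
  have hm0 : (0 : ℝ) ≤ m := Nat.cast_nonneg _
  have hεm : ε * m ≤ m := by nlinarith
  have hj₀m : j₀ ≤ m := by
    have h : (j₀ : ℝ) ≤ m := by linarith [(Nat.cast_nonneg j₀ : (0 : ℝ) ≤ j₀)]
    exact_mod_cast h
  have hKm' : K ≤ m := by
    have h : (K : ℝ) ≤ m := by linarith
    exact_mod_cast h
  have hK1 : (1 : ℝ) ≤ K := by exact_mod_cast hK0
  have hc0 : 0 ≤ 8 / τ := by positivity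
  have hc1 : 100 * (8 / τ) ≤ ε * m := by
    have : 100 * (8 / τ) = 800 / τ := by ring
    linarith
  have hs : ∀ w, ∑ i ∈ range w, cellDensity τ i ≤ w + 8 / τ := fun w => by
    have h := abs_le.1 (abs_sum_cellDensity_sub_le hτ 0 w)
    simp only [zero_add] at h
    linarith [h.2]
  refine ⟨hε, hε6, by linarith, by linarith, by linarith, hW0, hW, truncate_nonneg hb0 j₀,
    fun j hj => ?_, fun w _ => ?_, fun j hj => ?_, ?_, fun k hk1 hk2 => ?_⟩
  · unfold truncate
    split_ifs with h
    · linarith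
    · exact hb j (by omega) hj
  · refine (sum_le_sum fun i _ => truncate_le hb0 j₀ i).trans ((hs w).trans ?_)
    linarith
  · rw [mem_Ico] at hj
    rw [sum_congr rfl fun l _ => truncate_of_le (b := cellDensity τ) (by omega : j₀ ≤ j + l)]
    exact (abs_sum_cellDensity_sub_le hτ j W).trans hWτ
  · rw [sum_Ico_eq_sum_range, show 2 * m - m = m by omega,
      sum_congr rfl fun l _ => truncate_of_le (b := cellDensity τ) (by omega : j₀ ≤ m + l)]
    have h := abs_le.1 (abs_sum_cellDensity_sub_le hτ m m)
    linarith [h.2]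
  · have h1 := (hS k hk1 hk2).trans (logSum_selbergLam_cells_le hτ k hK0)
    have h2 := sum_mul_windowAvg_le hb0 (by norm_num : (0 : ℝ) ≤ 3) hs (j₀ := j₀) (k := k) hK0
      (by omega) fun j h3 h4 => (hb j h3 (by omega)).trans (by linarith)
    have h3 : windowAvg (cellDensity τ) K k ≤ 3 :=
      windowAvg_le_of_mem hK0 fun j h3 h4 => (hb j (by omega) (by omega)).trans (by linarith)
    rw [windowAvg_truncate (by omega : j₀ ≤ k)]
    set S := ∑ i ∈ range (k + 1), windowAvg (truncate j₀ (cellDensity τ)) K i *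
      truncate j₀ (cellDensity τ) (k - i)
    set S' := ∑ i ∈ range (k + K), cellDensity τ i * windowAvg (cellDensity τ) K (k - i)
    set A := windowAvg (cellDensity τ) K k
    have h4 : (2 - ε / 100) * ((k + 1 : ℕ) : ℝ) * (K - 1) ≤ K * ((k + K) * A + S') := by
      refine le_of_mul_le_mul_left ?_ (by positivity : 0 < τ ^ 2)
      linarith
    have hk : (k : ℝ) ≤ 8 * m + 1 := by exact_mod_cast hk2
    have hm1 : (1 : ℝ) ≤ m := by linarith
    push_cast at h4
    have h5 : 2 * k - ε * m / 2 ≤ (k + K) * A + S' := by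
      refine le_of_mul_le_mul_left (le_trans ?_ h4) hKr
      have hk0 : (0 : ℝ) ≤ k := Nat.cast_nonneg _
      have i1 : ε * (k * K) ≤ 9 * (ε * m * K) := by
        have : ε * K * k ≤ ε * K * (9 * m) := by gcongr; linarith
        linarith
      have i2 : ε * K ≤ ε * m * K := by
        have : ε * K * 1 ≤ ε * K * m := by gcongr
        linarith
      have i3 : 100 * (m : ℝ) ≤ ε * m * K := by
        have : 100 * (m : ℝ) ≤ ε * K * m := by gcongr
        linarith
      have i4 : 0 ≤ ε * k := by positivity
      linarith
    have h6 : (K : ℝ) * A ≤ K * 3 := by gcongr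
    linarith

lemma logSum_le_of_not_prime {C s t : ℝ} (hC : ∀ x, Chebyshev.psi x - Chebyshev.theta x ≤ C * √x)
    (h : ∀ p : ℕ, p.Prime → Real.exp s < p → ¬ (p : ℝ) ≤ Real.exp t) :
    logSum (fun n => vonMangoldt n) s t ≤ C * √(Real.exp t) / Real.exp s := by
  have h1 : logSum (fun n => vonMangoldt n) s t ≤
      1 / Real.exp s * ∑ n ∈ Ioc ⌊Real.exp s⌋₊ ⌊Real.exp t⌋₊, vonMangoldt n :=
    sum_div_nat_le (fun _ => ArithmeticFunction.vonMangoldt_nonneg) (Real.exp_pos s)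
      (Nat.lt_floor_add_one _)
  have h2 : ∑ n ∈ Ioc ⌊Real.exp s⌋₊ ⌊Real.exp t⌋₊, vonMangoldt n ≤ C * √(Real.exp t) := by
    refine le_trans ?_ (hC _)
    rw [Chebyshev.psi_sub_theta_eq_sum_not_prime]
    refine sum_le_sum_of_subset_of_nonneg (fun n hn => ?_)
      fun _ _ _ => ArithmeticFunction.vonMangoldt_nonneg
    have hn' := mem_Ioc_floor_exp.1 hn
    rw [mem_filter, mem_Ioc]
    rw [mem_Ioc] at hn
    exact ⟨⟨by omega, hn.2⟩, fun hp => h n hp hn'.1 hn'.2⟩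
  calc _ ≤ _ := h1
    _ ≤ 1 / Real.exp s * (C * √(Real.exp t)) :=
        mul_le_mul_of_nonneg_left h2 (by positivity)
    _ = _ := by ring

lemma cellDensity_le {τ B : ℝ} (hτ : 0 < τ) {j : ℕ} (hj : 0 < j)
    (h : logSum selbergLam (j * τ) (j * τ + τ) ≤ B * (j * τ) * τ) : cellDensity τ j ≤ B := by
  have hj0 : (0 : ℝ) < j := by exact_mod_cast hj
  have hy : 0 < j * τ := by positivity
  unfold cellDensity
  rw [div_le_iff₀ hτ]
  refine le_of_mul_le_mul_left ?_ hy
  have e : ((j + 1 : ℕ) : ℝ) * τ = j * τ + τ := by push_cast; ring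
  rw [e]
  refine le_trans ?_ (h.trans (le_of_eq (by ring)))
  have e2 : j * τ * logSum (fun n => vonMangoldt n) (j * τ) (j * τ + τ) =
      logSum (fun n => j * τ * vonMangoldt n) (j * τ) (j * τ + τ) := by
    unfold logSum
    rw [mul_sum]
    exact sum_congr rfl fun _ _ => (mul_div_assoc _ _ _).symm
  rw [e2]
  refine logSum_mono fun n h1 _ => ?_
  have hn0 : (0 : ℝ) < n := (Real.exp_pos _).trans h1
  have h3 : j * τ ≤ Real.log n := ((Real.lt_log_iff_exp_lt hn0).2 h1).le
  have h4 := mul_le_mul_of_nonneg_right h3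
    (ArithmeticFunction.vonMangoldt_nonneg (n := n))
  have h5 := convLam_nonneg n
  unfold selbergLam
  linarith

lemma mul_div_exp_le {C S U κ : ℝ} (hκ : κ ≤ 1 / 4) (hU : 64 ≤ U) (hC : |C| ≤ U) (hS0 : 0 ≤ S)
    (hS : S ≤ 2 * Real.exp (U / 2)) : C * S / Real.exp U ≤ Real.exp (-(κ * U)) := by
  rw [div_le_iff₀ (Real.exp_pos _)]
  calc _ ≤ |C| * (2 * Real.exp (U / 2)) := mul_le_mul (le_abs_self C) hS hS0 (abs_nonneg C)
    _ ≤ U * (2 * Real.exp (U / 2)) := by gcongr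
    _ ≤ Real.exp (U / 4) * Real.exp (U / 2) := by
        have := Real.quadratic_le_exp_of_nonneg (by linarith : 0 ≤ U / 4)
        have : U * 2 ≤ Real.exp (U / 4) := by nlinarith
        have := mul_le_mul_of_nonneg_right this (Real.exp_pos (U / 2)).le
        linarith
    _ = Real.exp (-(1 / 4 * U)) * Real.exp U := by
        rw [← Real.exp_add, ← Real.exp_add]; congr 1; ring
    _ ≤ Real.exp (-(κ * U)) * Real.exp U := by gcongr

set_option maxHeartbeats 1000000 in
/-- Primes in short intervals, on the logarithmic scale. -/
theorem exists_prime_log_interval : ∃ κ : ℝ, 0 < κ ∧ κ ≤ 1 ∧ ∃ U₀ : ℝ, ∀ U ≥ U₀,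
    ∃ p : ℕ, p.Prime ∧ Real.exp U < p ∧ (p : ℝ) ≤ Real.exp (U + Real.exp (-(κ * U))) := by
  obtain ⟨δ, hδ, y₀, hy₀, hS⟩ := exists_selberg_log (ε := 1 / 10 ^ 8) (by norm_num) (by norm_num)
  obtain ⟨C, hC⟩ := Chebyshev.psi_sub_theta_le_mul_sqrt
  set κ : ℝ := min (δ / 10 ^ 10) (1 / 4) with hκ
  have hκ0 : 0 < κ := lt_min (by positivity) (by norm_num)
  have hκ1 : κ ≤ 1 / 4 := min_le_right _ _
  have hκδ : κ * 10 ^ 10 ≤ δ := by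
    have : κ ≤ δ / 10 ^ 10 := min_le_left _ _
    rwa [le_div_iff₀ (by norm_num)] at this
  have hlim : Filter.Tendsto (fun U : ℝ => U * Real.exp (-(κ / 2) * U)) Filter.atTop (nhds 0) := by
    simpa using tendsto_rpow_mul_exp_neg_mul_atTop_nhds_zero 1 (κ / 2) (by positivity)
  have hev := (hlim.eventually (ge_mem_nhds (by norm_num : (0 : ℝ) < 1 / 10 ^ 20))).and
    ((Filter.eventually_ge_atTop ((10 : ℝ) ^ 20)).and
    ((Filter.eventually_ge_atTop (10 ^ 10 * y₀)).and (Filter.eventually_ge_atTop |C|)))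
  obtain ⟨U₀, hU₀⟩ := Filter.eventually_atTop.1 hev
  refine ⟨κ / 2, by positivity, by linarith, U₀, fun U hU => ?_⟩
  obtain ⟨hU1, hU2, hU3, hU4⟩ := hU₀ U hU
  have hU5 : 0 < U := by linarith
  set Q := Real.exp (κ / 2 * U) with hQ
  have hQ0 : 0 < Q := Real.exp_pos _
  have hQU : 10 ^ 20 * U ≤ Q := by
    rw [show -(κ / 2) * U = -(κ / 2 * U) by ring, Real.exp_neg, ← hQ, ← div_eq_mul_inv,
      div_le_iff₀ hQ0] at hU1
    linarith
  have hQ2 : Real.exp (κ * U) = Q ^ 2 := by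
    rw [hQ, ← Real.exp_nat_mul]; congr 1; push_cast; ring
  have hQQ : 10 ^ 40 * Q ≤ Q ^ 2 := by
    rw [sq]; exact mul_le_mul_of_nonneg_right (by linarith) hQ0.le
  set m : ℕ := ⌊Q ^ 2⌋₊ with hm
  have hm1 : (m : ℝ) ≤ Q ^ 2 := Nat.floor_le (by positivity)
  have hm2 : Q ^ 2 / 2 ≤ m := by
    have := Nat.lt_floor_add_one (Q ^ 2)
    linarith
  have hm0 : (0 : ℝ) < m := by linarith
  have hm0' : 0 < m := by exact_mod_cast hm0
  set τ := U / (8 * m) with hτ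
  have hτ0 : 0 < τ := by positivity
  have hτm : 8 * m * τ = U := by rw [hτ]; field_simp
  have hτ1 : 10 ^ 8 * τ ≤ 1 / Q := by
    rw [hτ, le_div_iff₀ hQ0, ← mul_div_assoc, div_mul_eq_mul_div, div_le_one (by positivity)]
    have : U * Q ≤ Q / 10 ^ 20 * Q := mul_le_mul_of_nonneg_right (by linarith) hQ0.le
    nlinarith
  have hQ1 : 1 / Q ≤ 1 / 10 ^ 10 :=
    one_div_le_one_div_of_le (by norm_num) (by linarith)
  have hτ2 : Real.exp (-(κ * U)) ≤ τ := by
    rw [Real.exp_neg, hQ2, hτ, le_div_iff₀ (by positivity), ← div_eq_inv_mul,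
      div_le_iff₀ (by positivity)]
    have : 8 * Q ^ 2 ≤ U * Q ^ 2 := by gcongr; linarith
    linarith
  obtain ⟨W, hW1, hW2⟩ : ∃ W : ℕ, 8 * 10 ^ 6 / τ ≤ W ∧ (W : ℝ) < 8 * 10 ^ 6 / τ + 1 :=
    ⟨_, Nat.le_ceil _, Nat.ceil_lt_add_one (by positivity)⟩
  obtain ⟨j₀, hj1, hj2⟩ : ∃ j₀ : ℕ, (m : ℝ) / 10 ^ 8 ≤ j₀ ∧ (j₀ : ℝ) < m / 10 ^ 8 + 1 :=
    ⟨_, Nat.le_ceil _, Nat.ceil_lt_add_one (by positivity)⟩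
  have hinv : 10 ^ 19 * (1 / τ) ≤ m := by
    rw [hτ, one_div_div, ← mul_div_assoc, div_le_iff₀ hU5]
    have : (m : ℝ) * 10 ^ 20 ≤ m * U := by gcongr
    linarith
  have hτW : 8 * 10 ^ 6 / τ = 8 * 10 ^ 6 * (1 / τ) := by ring
  have hτ8 : 8 / τ = 8 * (1 / τ) := by ring
  have hinv0 : 0 < 1 / τ := by positivity
  have hy : ∀ y, U / (8 * 10 ^ 8) ≤ y → y₀ ≤ y ∧ Real.exp (-(δ * y)) ≤ τ := by
    intro y h
    refine ⟨by linarith, le_trans (Real.exp_le_exp.2 ?_) hτ2⟩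
    have h1 := mul_le_mul hκδ h (by positivity) hδ.le
    have h2 : 0 ≤ κ * U := by positivity
    linarith
  have hj0 : 0 < j₀ := by
    have : (0 : ℝ) < j₀ := lt_of_lt_of_le (by positivity) hj1
    exact_mod_cast this
  have hyj : ∀ j : ℕ, (m : ℝ) / 10 ^ 8 ≤ j → U / (8 * 10 ^ 8) ≤ j * τ := by
    intro j hj
    have := mul_le_mul_of_nonneg_right hj hτ0.le
    linarith
  have H : PrimeLike (truncate j₀ (cellDensity τ)) m (10 ^ 8) W (1 / 10 ^ 6) := by
    refine primeLike_cells hτ0 (by norm_num) le_rfl (by norm_num) (by push_cast; linarith)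
      (by linarith) (by linarith [show 800 / τ = 800 * (1 / τ) by ring]) ?_ (by linarith)
      (by linarith) (fun j h1 h2 => ?_) fun k h1 h2 => ?_
    · have : (0 : ℝ) < W := lt_of_lt_of_le (by positivity) hW1
      exact_mod_cast this
    · have h3 : (j₀ : ℝ) ≤ j := by exact_mod_cast h1
      obtain ⟨h4, h5⟩ := hy _ (hyj j (hj1.trans h3))
      have h6 := cellDensity_le hτ0 (by omega) (hS _ τ h4 h5 (by linarith)).2
      linarith
    · have h3 : (m : ℝ) ≤ (k + 1 : ℕ) := by exact_mod_cast (by omega : m ≤ k + 1)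
      obtain ⟨h4, h5⟩ := hy _ (hyj (k + 1) (le_trans (by linarith) h3))
      have h6 := (hS _ (((10 ^ 8 : ℕ) - 1 : ℝ) * τ) h4 (h5.trans ?_) ?_).1
      · have e : ((k + 1 : ℕ) : ℝ) * τ + ((10 ^ 8 : ℕ) - 1 : ℝ) * τ = (k + 10 ^ 8 : ℕ) * τ := by
          push_cast; ring
        rw [e] at h6
        norm_num at h6 ⊢
        exact h6
      · push_cast; linarith
      · push_cast; linarith
  have h1 := H.lt_windowAvg
  rw [windowAvg_truncate] at h1
  swap
  · have : (j₀ : ℝ) ≤ (8 * m : ℕ) := by push_cast; linarith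
    exact_mod_cast this
  have h2 := logSum_eq_windowAvg hτ0 (8 * m) (by norm_num : 0 < 10 ^ 8)
  have e1 : ((8 * m : ℕ) : ℝ) * τ = U := by push_cast; exact hτm
  have e2 : ((8 * m + 10 ^ 8 : ℕ) : ℝ) * τ = U + 10 ^ 8 * τ := by push_cast; linarith
  rw [e1, e2] at h2
  by_contra hno
  push Not at hno
  have hQneg : Real.exp (-(κ / 2 * U)) = 1 / Q := by rw [Real.exp_neg, ← hQ, one_div]
  have h3 := logSum_le_of_not_prime (s := U) (t := U + 10 ^ 8 * τ) hC fun p hp hp1 hp2 =>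
    absurd (hp2.trans (Real.exp_le_exp.2 (by rw [hQneg]; linarith))) (not_le.2 (hno p hp hp1))
  have h4 : √(Real.exp (U + 10 ^ 8 * τ)) ≤ 2 * Real.exp (U / 2) := by
    rw [Real.sqrt_le_left (by positivity), mul_pow, ← Real.exp_nat_mul]
    rw [Real.exp_add, mul_comm]
    push_cast
    rw [mul_div_cancel₀ _ two_ne_zero]
    gcongr
    have : Real.exp (10 ^ 8 * τ) ≤ Real.exp 1 := Real.exp_le_exp.2 (by linarith)
    linarith [Real.exp_one_lt_three]
  have h5 : C * √(Real.exp (U + 10 ^ 8 * τ)) / Real.exp U ≤ τ := by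
    exact (mul_div_exp_le hκ1 (by linarith) hU4 (Real.sqrt_nonneg _) h4).trans hτ2
  rw [h2] at h3
  have h6 : τ * (10 ^ 8 : ℕ) * (1 / 10 ^ 6) <
      τ * (10 ^ 8 : ℕ) * windowAvg (cellDensity τ) (10 ^ 8) (8 * m) :=
    mul_lt_mul_of_pos_left h1 (by positivity)
  push_cast at h6 h3
  linarith

lemma card_divisors_prime_pow_mul {q k m : ℕ} (hq : q.Prime) (hm : ¬ q ∣ m) :
    (q ^ k * m).divisors.card = (k + 1) * m.divisors.card := by
  rw [Nat.Coprime.card_divisors_mul (((Nat.Prime.coprime_iff_not_dvd hq).2 hm).pow_left k),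
    Nat.divisors_prime_pow hq, card_map, card_range]

lemma card_divisors_mul_prime {m q : ℕ} (hm : m ≠ 0) (hq : q.Prime) :
    ((m * q).divisors.card : ℝ) =
      m.divisors.card * (((m.factorization q : ℝ) + 2) / (m.factorization q + 1)) := by
  obtain ⟨e, k, hk, rfl⟩ := Nat.exists_eq_pow_mul_and_not_dvd hm q hq.ne_one
  have hk0 : k ≠ 0 := fun h => hk (h ▸ dvd_zero q)
  have he : (q ^ e * k).factorization q = e := by
    rw [Nat.factorization_mul (pow_ne_zero _ hq.ne_zero) hk0, Finsupp.add_apply,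
      Nat.factorization_eq_zero_of_not_dvd hk, hq.factorization_pow]
    simp
  rw [he, show q ^ e * k * q = q ^ (e + 1) * k by ring, card_divisors_prime_pow_mul hq hk,
    card_divisors_prime_pow_mul hq hk]
  have : (e : ℝ) + 1 ≠ 0 := by positivity
  push_cast
  field_simp
  ring

lemma factorization_prod_primes {S : Finset ℕ} (hS : ∀ q ∈ S, q.Prime) (q : ℕ) :
    (∏ s ∈ S, s).factorization q = if q ∈ S then 1 else 0 := by
  rw [Nat.factorization_prod fun s hs => (hS s hs).ne_zero, Finsupp.finsetSum_apply,
    sum_congr rfl fun s hs => by rw [(hS s hs).factorization, Finsupp.single_apply]]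
  rw [sum_ite_eq']

lemma prod_primes_ne_zero {S : Finset ℕ} (hS : ∀ q ∈ S, q.Prime) : ∏ s ∈ S, s ≠ 0 :=
  prod_ne_zero_iff.2 fun s hs => (hS s hs).ne_zero

lemma card_divisors_mul_prod_primes {m : ℕ} (hm : m ≠ 0) {S : Finset ℕ}
    (hS : ∀ q ∈ S, q.Prime) :
    ((m * ∏ s ∈ S, s).divisors.card : ℝ) = m.divisors.card *
      ∏ s ∈ S, (((m.factorization s : ℝ) + 2) / (m.factorization s + 1)) := by
  induction S using Finset.induction_on with
  | empty => simp
  | insert q S hqS ih =>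
    have hS' : ∀ s ∈ S, s.Prime := fun s hs => hS s (mem_insert_of_mem hs)
    have h0 := prod_primes_ne_zero hS'
    rw [prod_insert hqS, prod_insert hqS, mul_comm q, ← mul_assoc,
      card_divisors_mul_prime (mul_ne_zero hm h0) (hS q (mem_insert_self _ _)), ih hS',
      Nat.factorization_mul hm h0, Finsupp.add_apply, factorization_prod_primes hS', if_neg hqS,
      add_zero]
    ring

/-- Multiply `n` by the primes in `S` and divide by those in `R`. -/
lemma exists_move {n : ℕ} (hn : n ≠ 0) {S R : Finset ℕ} (hS : ∀ q ∈ S, q.Prime)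
    (hR : ∀ q ∈ R, q.Prime) (hSR : Disjoint S R) (hRn : ∀ q ∈ R, q ∣ n) :
    ∃ m : ℕ, 0 < m ∧ m * ∏ q ∈ R, q = n * ∏ q ∈ S, q ∧
      (m.divisors.card : ℝ) *
        ∏ q ∈ R, (((n.factorization q : ℝ) + 1) / n.factorization q) =
      n.divisors.card * ∏ q ∈ S, (((n.factorization q : ℝ) + 2) / (n.factorization q + 1)) := by
  have hS0 := prod_primes_ne_zero hS
  have hR0 := prod_primes_ne_zero hR
  obtain ⟨k, hk⟩ := prod_primes_dvd n (fun q hq => (hR q hq).prime) hRn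
  have hk0 : k ≠ 0 := fun h => hn (by rw [hk, h, mul_zero])
  have hm0 : k * ∏ q ∈ S, q ≠ 0 := mul_ne_zero hk0 hS0
  have e : k * (∏ q ∈ S, q) * ∏ q ∈ R, q = n * ∏ q ∈ S, q := by
    rw [hk]; ring
  refine ⟨k * ∏ q ∈ S, q, Nat.pos_of_ne_zero hm0, e, ?_⟩
  rw [← card_divisors_mul_prod_primes hn hS, ← e, card_divisors_mul_prod_primes hm0 hR]
  congr 1
  refine prod_congr rfl fun q hq => ?_
  have h1 := congrArg (fun t => Nat.factorization t q) e
  simp only [Nat.factorization_mul hm0 hR0, Nat.factorization_mul hn hS0, Finsupp.add_apply,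
    factorization_prod_primes hR, factorization_prod_primes hS, if_pos hq,
    if_neg (disjoint_right.1 hSR hq), add_zero] at h1
  rw [← h1]
  push_cast
  ring

namespace HighlyComposite

lemma ne_zero {n : ℕ} (h : HighlyComposite n) : n ≠ 0 := h.1.ne'

lemma le_of_card_le {n m : ℕ} (h : HighlyComposite n) (hm : 0 < m)
    (hc : n.divisors.card ≤ m.divisors.card) : n ≤ m := by
  by_contra hlt
  have := h.2 m hm (by omega)
  omega

lemma prod_lt_prod {n : ℕ} (h : HighlyComposite n) {S R : Finset ℕ} (hS : ∀ q ∈ S, q.Prime)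
    (hR : ∀ q ∈ R, q.Prime) (hSR : Disjoint S R) (hRn : ∀ q ∈ R, q ∣ n)
    (hlt : ∏ q ∈ S, q < ∏ q ∈ R, q) :
    ∏ q ∈ S, (((n.factorization q : ℝ) + 2) / (n.factorization q + 1)) <
      ∏ q ∈ R, (((n.factorization q : ℝ) + 1) / n.factorization q) := by
  obtain ⟨m, hm, e, hd⟩ := exists_move h.ne_zero hS hR hSR hRn
  have hmn : m < n := by
    by_contra hge
    have h1 : n * ∏ q ∈ S, q < m * ∏ q ∈ R, q :=
      lt_of_lt_of_le (Nat.mul_lt_mul_of_pos_left hlt h.1) (Nat.mul_le_mul_right _ (by omega))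
    omega
  have h1 := h.2 m hm hmn
  have h2 : (m.divisors.card : ℝ) < n.divisors.card := by exact_mod_cast h1
  by_contra hge
  push Not at hge
  have hpos : 0 < ∏ q ∈ S, (((n.factorization q : ℝ) + 2) / (n.factorization q + 1)) :=
    prod_pos fun q _ => by positivity
  have h3 := mul_le_mul_of_nonneg_left hge (Nat.cast_nonneg m.divisors.card)
  have h4 := mul_lt_mul_of_pos_right h2 hpos
  linarith

lemma factorization_anti {n : ℕ} (h : HighlyComposite n) {q r : ℕ} (hq : q.Prime) (hr : r.Prime)
    (hqr : q ≤ r) : n.factorization r ≤ n.factorization q := by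
  rcases hqr.eq_or_lt with rfl | hlt
  · exact le_rfl
  by_contra hc
  have h0 : n.factorization r ≠ 0 := by omega
  have h1 := h.prod_lt_prod (S := {q}) (R := {r}) (by simpa) (by simpa)
    (by simpa using hlt.ne) (by simpa using Nat.dvd_of_factorization_pos h0) (by simpa)
  rw [prod_singleton, prod_singleton] at h1
  have h2 : (n.factorization q : ℝ) + 1 ≤ n.factorization r := by exact_mod_cast (by omega)
  have h3 : (0 : ℝ) ≤ n.factorization q := Nat.cast_nonneg _
  rw [div_lt_div_iff₀ (by linarith) (by linarith)] at h1
  nlinarith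

end HighlyComposite

lemma exists_primes_above (k : ℕ) {y : ℕ} (hy : 0 < y) :
    ∃ T : Finset ℕ, T.card = k ∧ ∀ q ∈ T, q.Prime ∧ y < q ∧ q ≤ 2 ^ k * y := by
  induction k generalizing y with
  | zero => exact ⟨∅, by simp⟩
  | succ k ih =>
    obtain ⟨q, hq, h1, h2⟩ := Nat.exists_prime_lt_and_le_two_mul y hy.ne'
    obtain ⟨T, hT, h3⟩ := ih hq.pos
    have hqT : q ∉ T := fun h => lt_irrefl _ (h3 q h).2.1
    have hpow : 2 ^ k * q ≤ 2 ^ (k + 1) * y := by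
      rw [pow_succ, mul_assoc]; exact Nat.mul_le_mul_left _ h2
    refine ⟨insert q T, by rw [card_insert_of_notMem hqT, hT], fun s hs => ?_⟩
    rcases mem_insert.1 hs with rfl | hs
    · exact ⟨hq, h1, (Nat.le_mul_of_pos_left s (by positivity)).trans hpow⟩
    · obtain ⟨h4, h5, h6⟩ := h3 s hs
      exact ⟨h4, h1.trans h5, h6.trans hpow⟩

lemma exists_prime_below {q : ℕ} (hq : 3 ≤ q) : ∃ t : ℕ, t.Prime ∧ t < q ∧ q ≤ 2 * t := by
  obtain ⟨t, ht, h1, h2⟩ := Nat.exists_prime_lt_and_le_two_mul ((q - 1) / 2) (by omega)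
  exact ⟨t, ht, by omega, by omega⟩

lemma exists_primes_below (k : ℕ) {q : ℕ} (hq : q.Prime) (hk : 2 ^ (k + 1) ≤ q) :
    ∃ T : Finset ℕ, T.card = k ∧ ∀ t ∈ T, t.Prime ∧ t ≤ q ∧ q ≤ 2 ^ k * t := by
  induction k generalizing q with
  | zero => exact ⟨∅, by simp⟩
  | succ k ih =>
    rw [pow_succ, pow_succ] at hk
    have h2k : 0 < 2 ^ k := by positivity
    obtain ⟨s, hs, h1, h2⟩ := exists_prime_below (by omega : 3 ≤ q)
    obtain ⟨T, hT, h3⟩ := ih hs (by rw [pow_succ]; omega)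
    have hqT : q ∉ T := fun h => by have := (h3 q h).2.1; omega
    refine ⟨insert q T, by rw [card_insert_of_notMem hqT, hT], fun t ht => ?_⟩
    rcases mem_insert.1 ht with rfl | ht
    · exact ⟨hq, le_rfl, Nat.le_mul_of_pos_left t (by positivity)⟩
    · obtain ⟨h4, h5, h6⟩ := h3 t ht
      refine ⟨h4, by omega, ?_⟩
      rw [pow_succ]
      linarith

lemma prod_le_pow_of_card {T : Finset ℕ} {B k : ℕ} (hT : T.card = k) (h : ∀ q ∈ T, q ≤ B) :
    ∏ q ∈ T, q ≤ B ^ k := by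
  calc ∏ q ∈ T, q ≤ ∏ _q ∈ T, B := prod_le_prod (fun _ _ => Nat.zero_le _) h
    _ = B ^ k := by rw [prod_const, hT]

lemma pow_le_prod_mul_of_card {T : Finset ℕ} {B c k : ℕ} (hT : T.card = k)
    (h : ∀ q ∈ T, B ≤ c * q) : B ^ k ≤ c ^ k * ∏ q ∈ T, q := by
  calc B ^ k = ∏ _q ∈ T, B := by rw [prod_const, hT]
    _ ≤ ∏ q ∈ T, c * q := prod_le_prod (fun _ _ => Nat.zero_le _) h
    _ = _ := by rw [prod_mul_distrib, prod_const, hT]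

lemma le_prod_ratio {T : Finset ℕ} {e k j : ℕ} {f : ℕ → ℕ} (hT : T.card = k)
    (he : ∀ q ∈ T, f q ≤ e) (hj : j = k) :
    (((e : ℝ) + 2) / (e + 1)) ^ j ≤ ∏ q ∈ T, (((f q : ℝ) + 2) / (f q + 1)) := by
  rw [hj, ← hT, ← prod_const]
  refine prod_le_prod (fun _ _ => by positivity) fun q hq => ?_
  have : (f q : ℝ) ≤ e := by exact_mod_cast he q hq
  rw [div_le_div_iff₀ (by positivity) (by positivity)]
  linarith

lemma prod_ratio_le {T : Finset ℕ} {e k j : ℕ} {f : ℕ → ℕ} (hT : T.card = k) (he0 : 0 < e)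
    (he : ∀ q ∈ T, e ≤ f q) (hj : j = k) :
    ∏ q ∈ T, (((f q : ℝ) + 1) / f q) ≤ (((e : ℝ) + 1) / e) ^ j := by
  rw [hj, ← hT, ← prod_const]
  refine prod_le_prod (fun _ _ => by positivity) fun q hq => ?_
  have h0 : (0 : ℝ) < e := by exact_mod_cast he0
  have : (e : ℝ) ≤ f q := by exact_mod_cast he q hq
  rw [div_le_div_iff₀ (by linarith) h0]
  linarith

namespace HighlyComposite

/-- `p` is the largest prime factor of `n`. -/
structure LargestPrime (n p : ℕ) : Prop where
  prime : p.Prime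
  dvd : p ∣ n
  not_dvd : ∀ q, q.Prime → p < q → ¬ q ∣ n

lemma exists_largestPrime {n : ℕ} (hn : 2 ≤ n) : ∃ p, LargestPrime n p := by
  have hne : n.primeFactors.Nonempty := Nat.nonempty_primeFactors.2 (by omega)
  have h1 := max'_mem n.primeFactors hne
  refine ⟨n.primeFactors.max' hne, Nat.prime_of_mem_primeFactors h1,
    Nat.dvd_of_mem_primeFactors h1, fun q hq hlt hd => ?_⟩
  have h2 := le_max' n.primeFactors q (Nat.mem_primeFactors.2 ⟨hq, hd, by omega⟩)
  omega

lemma LargestPrime.factorization_eq_zero {n p q : ℕ} (hp : LargestPrime n p) (hq : q.Prime)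
    (h : p < q) : n.factorization q = 0 :=
  Nat.factorization_eq_zero_of_not_dvd (hp.not_dvd q hq h)

variable {n p : ℕ}

lemma factorization_pos (h : HighlyComposite n) (hp : LargestPrime n p) {q : ℕ} (hq : q.Prime)
    (hqp : q ≤ p) : 0 < n.factorization q :=
  (hp.prime.factorization_pos_of_dvd h.ne_zero hp.dvd).trans_le
    (h.factorization_anti hq hp.prime hqp)

lemma factorization_two_le (h : HighlyComposite n) (hp : LargestPrime n p) :
    n.factorization 2 ≤ 2 * p := by
  obtain ⟨e, k, hk, hn⟩ := Nat.exists_eq_pow_mul_and_not_dvd h.ne_zero 2 (by norm_num)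
  have hk0 : 0 < k := Nat.pos_of_ne_zero fun h => hk (h ▸ dvd_zero 2)
  have he : n.factorization 2 = e := by
    rw [hn, Nat.factorization_mul (by positivity) hk0.ne', Finsupp.add_apply,
      Nat.factorization_eq_zero_of_not_dvd hk, Nat.prime_two.factorization_pow]
    simp
  rw [he]
  by_contra hlt
  obtain ⟨P, hP, h1, h2⟩ := Nat.exists_prime_lt_and_le_two_mul p hp.prime.ne_zero
  have hp2 := hp.prime.two_le
  have hPk : ¬ P ∣ 2 ^ (e - (p + 1)) * k := fun hd => hp.not_dvd P hP h1 (hd.trans (by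
    rw [hn]; exact Nat.mul_dvd_mul_right (pow_dvd_pow 2 (by omega)) k))
  have h3 := h.2 (P ^ 1 * (2 ^ (e - (p + 1)) * k)) (by have := hP.pos; positivity) (by
    have h4 : 2 ^ e = 2 ^ (p + 1) * 2 ^ (e - (p + 1)) := by rw [← pow_add]; congr 1; omega
    rw [hn, h4, mul_assoc]
    refine Nat.mul_lt_mul_of_pos_right ?_ (by positivity)
    have h5 : p < 2 ^ p := Nat.lt_two_pow_self
    have h6 : 2 ^ (p + 1) = 2 * 2 ^ p := by ring
    rw [pow_one]
    omega)
  rw [card_divisors_prime_pow_mul hP hPk, card_divisors_prime_pow_mul Nat.prime_two hk] at h3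
  rw [hn, card_divisors_prime_pow_mul Nat.prime_two hk, ← mul_assoc] at h3
  have h6 := lt_of_mul_lt_mul_right h3 (Nat.zero_le _)
  omega

lemma le_four_pow (h : HighlyComposite n) (hp : LargestPrime n p) : n ≤ 4 ^ (p * (2 * p)) := by
  calc n = ∏ q ∈ n.primeFactors, q ^ n.factorization q :=
        (Nat.prod_factorization_pow_eq_self h.ne_zero).symm
    _ ≤ ∏ q ∈ n.primeFactors, q ^ (2 * p) := prod_le_prod (fun _ _ => Nat.zero_le _) fun q hq => by
        have hq := Nat.prime_of_mem_primeFactors hq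
        exact Nat.pow_le_pow_right hq.pos ((h.factorization_anti Nat.prime_two hq hq.two_le).trans
          (h.factorization_two_le hp))
    _ = (∏ q ∈ n.primeFactors, q) ^ (2 * p) := prod_pow _ _ _
    _ ≤ (primorial p) ^ (2 * p) := by
        refine Nat.pow_le_pow_left ?_ _
        refine prod_le_prod_of_subset_of_one_le' (fun q hq => ?_) fun q hq _ => ?_
        · have hq1 := Nat.prime_of_mem_primeFactors hq
          rw [mem_filter, mem_range]
          refine ⟨?_, hq1⟩
          by_contra hlt
          exact hp.not_dvd q hq1 (by omega) (Nat.dvd_of_mem_primeFactors hq)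
        · exact (mem_filter.1 hq).2.one_lt.le
    _ ≤ (4 ^ p) ^ (2 * p) := Nat.pow_le_pow_left (primorial_le_four_pow p) _
    _ = _ := (pow_mul _ _ _).symm

lemma exists_two_le_factorization (h : HighlyComposite n) (hp : LargestPrime n p) {y : ℕ}
    (hy : 0 < y) (hyp : 16 * y ^ 2 < p) : ∃ q, q.Prime ∧ y < q ∧ 2 ≤ n.factorization q := by
  obtain ⟨T, hT, h1⟩ := exists_primes_above 2 hy
  by_contra hno
  push Not at hno
  have hle : ∀ q ∈ T, n.factorization q ≤ 1 := fun q hq => by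
    have := hno q (h1 q hq).1 (h1 q hq).2.1
    omega
  have hprod : ∏ q ∈ T, q < p := by
    refine (prod_le_pow_of_card hT fun q hq => (h1 q hq).2.2).trans_lt ?_
    calc (2 ^ 2 * y) ^ 2 = 16 * y ^ 2 := by ring
      _ < p := hyp
  have h2 := h.prod_lt_prod (S := T) (R := {p}) (fun q hq => (h1 q hq).1) (by simpa using hp.prime)
    (by
      rw [disjoint_singleton_right]
      intro hpT
      have h3 := (h1 p hpT).2.2
      nlinarith)
    (by simpa using hp.dvd) (by simpa)
  have h3 := le_prod_ratio hT hle rfl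
  have h4 := prod_ratio_le (T := {p}) (e := 1) (f := n.factorization) (card_singleton p) one_pos
    (fun q hq => by
      rw [mem_singleton.1 hq]
      exact hp.prime.factorization_pos_of_dvd h.ne_zero hp.dvd) rfl
  have h5 := (h3.trans_lt h2).trans_le h4
  norm_num at h5

lemma cube_le (h : HighlyComposite n) (hp : LargestPrime n p) {q : ℕ} (hq : q.Prime)
    (hq2 : 2 ≤ n.factorization q) : q ^ 3 ≤ 2 ^ 13 * p ^ 2 := by
  by_contra hlt
  push Not at hlt
  have hp2 := hp.prime.two_le
  have hq16 : 2 ^ (3 + 1) ≤ q := by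
    by_contra hc
    have h1 : q ^ 3 ≤ 16 ^ 3 := Nat.pow_le_pow_left (by omega) 3
    nlinarith
  obtain ⟨T, hT, h1⟩ := exists_primes_above 2 hp.prime.pos
  obtain ⟨R, hR, h2⟩ := exists_primes_below 3 hq hq16
  have hRf : ∀ t ∈ R, 2 ≤ n.factorization t := fun t ht =>
    hq2.trans (h.factorization_anti (h2 t ht).1 hq (h2 t ht).2.1)
  have hTf : ∀ t ∈ T, n.factorization t ≤ 0 := fun t ht =>
    (hp.factorization_eq_zero (h1 t ht).1 (h1 t ht).2.1).le
  have h3 := h.prod_lt_prod (S := T) (R := R) (fun q hq => (h1 q hq).1) (fun q hq => (h2 q hq).1)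
    (disjoint_left.2 fun t ht ht' => by have := hRf t ht'; have := hTf t ht; omega)
    (fun t ht => Nat.dvd_of_factorization_pos (by have := hRf t ht; omega)) (by
      have h3 := prod_le_pow_of_card hT fun q hq => (h1 q hq).2.2
      have h4 := pow_le_prod_mul_of_card hR fun q hq => (h2 q hq).2.2
      rw [show (2 ^ 2 * p) ^ 2 = 16 * p ^ 2 by ring] at h3
      norm_num at h4 hlt
      omega)
  have h4 := le_prod_ratio hT hTf rfl
  have h5 := prod_ratio_le hR two_pos hRf rfl
  have h6 := (h4.trans_lt h3).trans_le h5
  norm_num at h6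

lemma mul_lt_of_cube_le {p r : ℕ} (hp : 2 ^ 78 < p) (h1 : r ^ 3 ≤ 2 ^ 13 * p ^ 2) :
    2 ^ 6 * r < p := by
  by_contra hc
  push Not at hc
  have h2 : p ^ 3 ≤ (2 ^ 6 * r) ^ 3 := Nat.pow_le_pow_left hc 3
  have h3 : p ^ 3 = p * p ^ 2 := by ring
  have h4 : 2 ^ 78 * p ^ 2 ≤ p * p ^ 2 := Nat.mul_le_mul_right _ hp.le
  have h5 : 0 < p ^ 2 := by have : 0 < p := by omega
                            positivity
  rw [mul_pow] at h2
  omega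

end HighlyComposite

lemma exists_primes_log_interval {κ U₀ : ℝ} (hκ : 0 < κ) (hU₀ : ∀ U ≥ U₀, ∃ p : ℕ, p.Prime ∧
    Real.exp U < p ∧ (p : ℝ) ≤ Real.exp (U + Real.exp (-(κ * U)))) (k : ℕ) {U : ℝ} (hU : U₀ ≤ U) :
    ∃ T : Finset ℕ, T.card = k ∧ ∀ q ∈ T, q.Prime ∧ Real.exp U < q ∧
      (q : ℝ) ≤ Real.exp (U + k * Real.exp (-(κ * U))) := by
  induction k generalizing U with
  | zero => exact ⟨∅, by simp⟩
  | succ k ih =>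
    obtain ⟨p, hp, h1, h2⟩ := hU₀ U hU
    have hp0 : (0 : ℝ) < p := by exact_mod_cast hp.pos
    have hV1 : U < Real.log p := (Real.lt_log_iff_exp_lt hp0).2 h1
    have hV2 : Real.log p ≤ U + Real.exp (-(κ * U)) := (Real.log_le_iff_le_exp hp0).2 h2
    obtain ⟨T, hT, h3⟩ := ih (hU.trans hV1.le)
    rw [Real.exp_log hp0] at h3
    have hpT : p ∉ T := fun h => lt_irrefl _ (h3 p h).2.1
    have hpow : Real.exp (-(κ * Real.log p)) ≤ Real.exp (-(κ * U)) := by gcongr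
    have hk : (k : ℝ) * Real.exp (-(κ * Real.log p)) ≤ k * Real.exp (-(κ * U)) := by gcongr
    have hk0 : 0 ≤ (k : ℝ) * Real.exp (-(κ * U)) := by positivity
    refine ⟨insert p T, by rw [card_insert_of_notMem hpT, hT], fun s hs => ?_⟩
    rcases mem_insert.1 hs with rfl | hs
    · refine ⟨hp, h1, h2.trans (Real.exp_le_exp.2 ?_)⟩
      push_cast
      linarith
    · obtain ⟨h4, h5, h6⟩ := h3 s hs
      refine ⟨h4, h1.trans h5, h6.trans (Real.exp_le_exp.2 ?_)⟩
      push_cast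
      linarith

/-- Many primes just above and just below every large number. -/
theorem exists_prime_blocks : ∃ κ : ℝ, 0 < κ ∧ κ ≤ 1 ∧ ∃ U₀ : ℝ, ∀ U ≥ U₀, ∀ k : ℕ, ∀ η : ℝ,
    2 * k * Real.exp (-(κ * U)) ≤ η → η ≤ 1 / 2 →
    (∃ T : Finset ℕ, T.card = k ∧ ∀ q ∈ T, q.Prime ∧ Real.exp U < q ∧
      Real.log q ≤ U + η) ∧
    (∃ T : Finset ℕ, T.card = k ∧ ∀ q ∈ T, q.Prime ∧ U - η ≤ Real.log q ∧
      (q : ℝ) ≤ Real.exp U) := by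
  obtain ⟨κ, hκ, hκ1, U₀, hU₀⟩ := exists_prime_log_interval
  refine ⟨κ, hκ, hκ1, U₀ + 1, fun U hU k η h1 h2 => ⟨?_, ?_⟩⟩
  · obtain ⟨T, hT, h3⟩ := exists_primes_log_interval hκ hU₀ k (by linarith : U₀ ≤ U)
    refine ⟨T, hT, fun q hq => ?_⟩
    obtain ⟨h4, h5, h6⟩ := h3 q hq
    refine ⟨h4, h5, ((Real.log_le_iff_le_exp (by exact_mod_cast h4.pos)).2 h6).trans ?_⟩
    have : 0 ≤ k * Real.exp (-(κ * U)) := by positivity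
    linarith
  · obtain ⟨T, hT, h3⟩ := exists_primes_log_interval hκ hU₀ k (by linarith : U₀ ≤ U - η)
    refine ⟨T, hT, fun q hq => ?_⟩
    obtain ⟨h4, h5, h6⟩ := h3 q hq
    refine ⟨h4, ((Real.lt_log_iff_exp_lt (by exact_mod_cast h4.pos)).2 h5).le,
      h6.trans (Real.exp_le_exp.2 ?_)⟩
    have hη0 : 0 ≤ η := le_trans (by positivity) h1
    have h7 : Real.exp (-(κ * (U - η))) ≤ 2 * Real.exp (-(κ * U)) := by
      rw [show -(κ * (U - η)) = κ * η + -(κ * U) by ring, Real.exp_add]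
      gcongr
      have h8 : κ * η ≤ 1 / 2 := by nlinarith
      have h9 : Real.exp (1 / 2) ^ 2 < 2 ^ 2 := by
        rw [← Real.exp_nat_mul]
        norm_num
        linarith [Real.exp_one_lt_three]
      exact (Real.exp_le_exp.2 h8).trans (lt_of_pow_lt_pow_left₀ 2 (by norm_num) h9).le
    have : k * Real.exp (-(κ * (U - η))) ≤ k * (2 * Real.exp (-(κ * U))) := by gcongr
    linarith

lemma exists_nat_mul_sub_mul_le {P ρ : ℝ} (hρ : 0 < ρ) (h1 : ρ ≤ P) (h2 : P ≤ 3 * ρ) {D : ℕ}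
    (hD : 0 < D) : ∃ a b : ℕ, 0 < a ∧ a ≤ D ∧ b ≤ 4 * D ∧ |a * P - b * ρ| ≤ ρ / D := by
  obtain ⟨j, k, hk, hkD, h⟩ := Real.exists_int_int_abs_mul_sub_le (P / ρ) hD
  have hDr : (1 : ℝ) ≤ D := by exact_mod_cast hD
  have hk1 : (1 : ℝ) ≤ k := by exact_mod_cast hk
  have hkD' : (k : ℝ) ≤ D := by exact_mod_cast hkD
  have hx1 : 1 ≤ P / ρ := by rwa [le_div_iff₀ hρ, one_mul]
  have hx2 : P / ρ ≤ 3 := by rwa [div_le_iff₀ hρ]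
  have hle : 1 / ((D : ℝ) + 1) ≤ 1 / D := one_div_le_one_div_of_le (by linarith) (by linarith)
  have hle1 : 1 / (D : ℝ) ≤ 1 := by rw [div_le_one (by linarith)]; exact hDr
  obtain ⟨h3, h4⟩ := abs_le.1 h
  have h5 : 1 * 1 ≤ k * (P / ρ) := by gcongr
  have h6 : k * (P / ρ) ≤ D * 3 := by gcongr
  have hj0 : (0 : ℝ) ≤ j := by linarith
  have hjD : (j : ℝ) ≤ 4 * D := by linarith
  lift k to ℕ using hk.le
  lift j to ℕ using by exact_mod_cast hj0
  refine ⟨k, j, by exact_mod_cast hk, by exact_mod_cast hkD, by exact_mod_cast hjD, ?_⟩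
  push_cast at h
  have e : (k : ℝ) * P - j * ρ = (k * (P / ρ) - j) * ρ := by field_simp
  rw [e, abs_mul, abs_of_pos hρ]
  refine (mul_le_mul_of_nonneg_right (le_trans ?_ hle) hρ.le).trans_eq (one_div_mul_eq_div _ _)
  exact_mod_cast h

lemma two_pow_ne_three_halves_pow {a b : ℕ} (ha : 0 < a) : (2 : ℝ) ^ a ≠ (3 / 2) ^ b := by
  intro h
  rw [div_pow, eq_div_iff (by positivity), ← pow_add] at h
  have h1 : 2 ^ (a + b) = 3 ^ b := by exact_mod_cast h
  have h2 : Even (3 ^ b) := by rw [← h1]; exact (even_two.pow_of_ne_zero (by omega))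
  rw [Nat.even_pow] at h2
  exact absurd h2.1 (by decide)

namespace HighlyComposite

lemma exists_gt_of_prod_lt_prod {n : ℕ} (h : HighlyComposite n) {S R : Finset ℕ} {A B : ℝ}
    (hS : ∀ q ∈ S, q.Prime) (hR : ∀ q ∈ R, q.Prime) (hSR : Disjoint S R) (hRn : ∀ q ∈ R, q ∣ n)
    (hlt : ∏ q ∈ R, (((n.factorization q : ℝ) + 1) / n.factorization q) <
      ∏ q ∈ S, (((n.factorization q : ℝ) + 2) / (n.factorization q + 1)))
    (hA : ∀ q ∈ S, Real.log q ≤ A) (hB : ∀ q ∈ R, B ≤ Real.log q) :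
    ∃ m : ℕ, n < m ∧ n.divisors.card < m.divisors.card ∧
      Real.log m ≤ Real.log n + S.card * A - R.card * B := by
  obtain ⟨m, hm, e, hd⟩ := exists_move h.ne_zero hS hR hSR hRn
  have hRpos : 0 < ∏ q ∈ R, (((n.factorization q : ℝ) + 1) / n.factorization q) :=
    prod_pos fun q hq => by
      have : (0 : ℝ) < n.factorization q := by
        exact_mod_cast (hR q hq).factorization_pos_of_dvd h.ne_zero (hRn q hq)
      positivity
  have hdn : (0 : ℝ) < n.divisors.card := by
    exact_mod_cast card_pos.2 (Nat.nonempty_divisors.2 h.ne_zero)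
  have hcard : n.divisors.card < m.divisors.card := by
    have h1 := mul_lt_mul_of_pos_left hlt hdn
    rw [← hd] at h1
    exact_mod_cast lt_of_mul_lt_mul_right h1 hRpos.le
  refine ⟨m, lt_of_le_of_ne (h.le_of_card_le hm hcard.le) ?_, hcard, ?_⟩
  · rintro rfl
    exact lt_irrefl _ hcard
  have e2 : (m : ℝ) * ∏ q ∈ R, (q : ℝ) = n * ∏ q ∈ S, (q : ℝ) := by
    have := congrArg (Nat.cast : ℕ → ℝ) e
    push_cast at this
    exact this
  have hS0 : ∀ q ∈ S, (q : ℝ) ≠ 0 := fun q hq => by exact_mod_cast (hS q hq).ne_zero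
  have hR0 : ∀ q ∈ R, (q : ℝ) ≠ 0 := fun q hq => by exact_mod_cast (hR q hq).ne_zero
  have e3 := congrArg Real.log e2
  rw [Real.log_mul (by exact_mod_cast hm.ne') (prod_ne_zero_iff.2 hR0),
    Real.log_mul (by exact_mod_cast h.ne_zero) (prod_ne_zero_iff.2 hS0),
    Real.log_prod hR0, Real.log_prod hS0] at e3
  have h1 := sum_le_card_nsmul S _ A hA
  have h2 := card_nsmul_le_sum R _ B hB
  rw [nsmul_eq_mul] at h1 h2
  linarith

end HighlyComposite

lemma le_two_mul_of_log_le {x y : ℕ} (hx : 0 < x) (hy : 0 < y)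
    (h : Real.log x ≤ Real.log y + 1 / 2) : x ≤ 2 * y := by
  have hx' : (0 : ℝ) < x := by exact_mod_cast hx
  have hy' : (0 : ℝ) < y := by exact_mod_cast hy
  have h1 : Real.log x ≤ Real.log (2 * y) := by
    rw [Real.log_mul two_ne_zero hy'.ne']
    linarith [Real.log_two_gt_d9]
  exact_mod_cast (Real.log_le_log_iff hx' (by positivity)).1 h1

namespace HighlyComposite

lemma exists_highlyComposite_le {n m : ℕ} (h : HighlyComposite n) (hnm : n < m)
    (hd : n.divisors.card < m.divisors.card) : ∃ n₁, HighlyComposite n₁ ∧ n < n₁ ∧ n₁ ≤ m := by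
  classical
  have hex : ∃ k, n < k ∧ n.divisors.card < k.divisors.card := ⟨m, hnm, hd⟩
  obtain ⟨h1, h2⟩ := Nat.find_spec hex
  refine ⟨Nat.find hex, ⟨by omega, fun k hk hlt => ?_⟩, h1, Nat.find_min' hex ⟨hnm, hd⟩⟩
  rcases lt_trichotomy k n with hkn | rfl | hkn
  · exact (h.2 k hk hkn).trans h2
  · exact h2
  · have h3 := Nat.find_min hex hlt
    have : ¬ n.divisors.card < k.divisors.card := fun hc => h3 ⟨hkn, hc⟩
    omega

/-- Trading primes near the largest prime factor `p` of `n` against primes near the largest prime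
`r` whose square divides `n` produces a slightly larger integer with more divisors. -/
lemma exists_gt_of_blocks {n p r D : ℕ} {η : ℝ} (h : HighlyComposite n) (hp : LargestPrime n p)
    (hr : r.Prime) (hr2 : 2 ≤ n.factorization r) (hrp : 2 ^ 6 * r < p)
    (hrmax : ∀ s, s.Prime → r < s → n.factorization s ≤ 1)
    (hlog : Real.log p ≤ 3 * Real.log r) (hD : 0 < D) (hη0 : 0 ≤ η) (hη : η ≤ 1 / 2)
    (hblocks : ∀ U ≥ Real.log r, ∀ k ≤ 4 * D,
      (∃ T : Finset ℕ, T.card = k ∧ ∀ q ∈ T, q.Prime ∧ Real.exp U < q ∧ Real.log q ≤ U + η) ∧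
      (∃ T : Finset ℕ, T.card = k ∧ ∀ q ∈ T, q.Prime ∧ U - η ≤ Real.log q ∧
        (q : ℝ) ≤ Real.exp U)) :
    ∃ m : ℕ, n < m ∧ n.divisors.card < m.divisors.card ∧
      Real.log m ≤ Real.log n + (Real.log r / D + 5 * D * η) := by
  have hr0 : (0 : ℝ) < r := by exact_mod_cast hr.pos
  have hp0 : (0 : ℝ) < p := by exact_mod_cast hp.prime.pos
  have hlr : 0 < Real.log r := Real.log_pos (by exact_mod_cast hr.one_lt)
  have hrp' : Real.log r ≤ Real.log p := Real.log_le_log hr0 (by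
    have : r ≤ p := by omega
    exact_mod_cast this)
  obtain ⟨a, b, ha, haD, hbD, hab⟩ := exists_nat_mul_sub_mul_le hlr hrp' hlog hD
  obtain ⟨hab1, hab2⟩ := abs_le.1 hab
  have habη : ((a : ℝ) + b) * η ≤ 5 * D * η := by
    have h1 : (a : ℝ) ≤ D := by exact_mod_cast haD
    have h2 : (b : ℝ) ≤ 4 * D := by exact_mod_cast hbD
    exact mul_le_mul_of_nonneg_right (by linarith) hη0
  have hpa := hblocks _ hrp' a (by omega)
  have hrb := hblocks _ le_rfl b hbD
  rw [Real.exp_log hp0] at hpa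
  rw [Real.exp_log hr0] at hrb
  rcases lt_or_gt_of_ne (two_pow_ne_three_halves_pow (b := b) ha) with hlt | hlt
  · obtain ⟨S, hS, hS1⟩ := hrb.1
    obtain ⟨R, hR, hR1⟩ := hpa.2
    have hSr : ∀ q ∈ S, r < q := fun q hq => by exact_mod_cast (hS1 q hq).2.1
    have hS2 : ∀ q ∈ S, q ≤ 2 * r := fun q hq => by
      obtain ⟨h1, -, h2⟩ := hS1 q hq
      exact le_two_mul_of_log_le h1.pos hr.pos (by linarith)
    have hR2 : ∀ q ∈ R, p ≤ 2 * q := fun q hq => by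
      obtain ⟨h1, h2, -⟩ := hR1 q hq
      exact le_two_mul_of_log_le hp.prime.pos h1.pos (by linarith)
    have hRf : ∀ q ∈ R, 1 ≤ n.factorization q := fun q hq =>
      h.factorization_pos hp (hR1 q hq).1 (by exact_mod_cast (hR1 q hq).2.2)
    have h1 := le_prod_ratio hS (fun q hq => hrmax q (hS1 q hq).1 (hSr q hq)) rfl
    have h2 := prod_ratio_le hR one_pos hRf rfl
    obtain ⟨m, hm, hd, hl⟩ := h.exists_gt_of_prod_lt_prod (S := S) (R := R)
      (fun q hq => (hS1 q hq).1) (fun q hq => (hR1 q hq).1)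
      (disjoint_left.2 fun q hq hq' => by
        have := hS2 q hq
        have := hR2 q hq'
        have := hr.pos
        omega)
      (fun q hq => Nat.dvd_of_factorization_pos (by have := hRf q hq; omega))
      (h2.trans_lt (lt_of_lt_of_le (by norm_num; exact hlt) h1))
      (fun q hq => (hS1 q hq).2.2) (fun q hq => (hR1 q hq).2.1)
    refine ⟨m, hm, hd, ?_⟩
    rw [hS, hR] at hl
    linarith
  · obtain ⟨S, hS, hS1⟩ := hpa.1
    obtain ⟨R, hR, hR1⟩ := hrb.2
    have hSp : ∀ q ∈ S, p < q := fun q hq => by exact_mod_cast (hS1 q hq).2.1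
    have hRr : ∀ q ∈ R, q ≤ r := fun q hq => by exact_mod_cast (hR1 q hq).2.2
    have hRf : ∀ q ∈ R, 2 ≤ n.factorization q := fun q hq =>
      hr2.trans (h.factorization_anti (hR1 q hq).1 hr (hRr q hq))
    have h1 := le_prod_ratio hS (fun q hq =>
      (hp.factorization_eq_zero (hS1 q hq).1 (hSp q hq)).le) rfl
    have h2 := prod_ratio_le hR two_pos hRf rfl
    obtain ⟨m, hm, hd, hl⟩ := h.exists_gt_of_prod_lt_prod (S := S) (R := R)
      (fun q hq => (hS1 q hq).1) (fun q hq => (hR1 q hq).1)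
      (disjoint_left.2 fun q hq hq' => by
        have := hSp q hq
        have := hRr q hq'
        omega)
      (fun q hq => Nat.dvd_of_factorization_pos (by have := hRf q hq; omega))
      (h2.trans_lt (lt_of_lt_of_le (by norm_num; exact hlt) h1))
      (fun q hq => (hS1 q hq).2.2) (fun q hq => (hR1 q hq).2.1)
    refine ⟨m, hm, hd, ?_⟩
    rw [hS, hR] at hl
    linarith

/-- The largest prime whose square divides a highly composite number. -/
lemma exists_largest_two_le {n p y : ℕ} (h : HighlyComposite n) (hp : LargestPrime n p)
    (hy : 0 < y) (hyp : 16 * y ^ 2 < p) : ∃ r, r.Prime ∧ y < r ∧ 2 ≤ n.factorization r ∧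
      ∀ s, s.Prime → r < s → n.factorization s ≤ 1 := by
  obtain ⟨q, hq, hyq, hq2⟩ := h.exists_two_le_factorization hp hy hyp
  have hqA : q ∈ n.primeFactors.filter (2 ≤ n.factorization ·) := mem_filter.2
    ⟨Nat.mem_primeFactors.2 ⟨hq, Nat.dvd_of_factorization_pos (by omega), h.ne_zero⟩, hq2⟩
  have hmem := max'_mem _ ⟨q, hqA⟩
  have hle := le_max' _ q hqA
  refine ⟨_, Nat.prime_of_mem_primeFactors (mem_filter.1 hmem).1, hyq.trans_le hle,
    (mem_filter.1 hmem).2, fun s hs hlt => ?_⟩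
  by_contra hc
  have hsA : s ∈ n.primeFactors.filter (2 ≤ n.factorization ·) := mem_filter.2
    ⟨Nat.mem_primeFactors.2 ⟨hs, Nat.dvd_of_factorization_pos (by omega), h.ne_zero⟩, by omega⟩
  exact absurd (le_max' _ s hsA) (by omega)

lemma exists_gt_log_le {κ U₀ P Q : ℝ} (hκ : 0 < κ)
    (hU₀ : ∀ U ≥ U₀, ∀ k : ℕ, ∀ η : ℝ, 2 * k * Real.exp (-(κ * U)) ≤ η → η ≤ 1 / 2 →
      (∃ T : Finset ℕ, T.card = k ∧ ∀ q ∈ T, q.Prime ∧ Real.exp U < q ∧ Real.log q ≤ U + η) ∧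
      (∃ T : Finset ℕ, T.card = k ∧ ∀ q ∈ T, q.Prime ∧ U - η ≤ Real.log q ∧
        (q : ℝ) ≤ Real.exp U)) {n p : ℕ} (h : HighlyComposite n) (hp : LargestPrime n p)
    (hP : P = Real.log p) (hPU : U₀ ≤ P / 3) (hP78 : 78 < P) (hQ : Q = Real.exp (κ * P / 24))
    (hQP : 2 * P ≤ Q) :
    ∃ m : ℕ, n < m ∧ n.divisors.card < m.divisors.card ∧ Real.log m ≤ Real.log n + Q⁻¹ := by
  have hp0 : (0 : ℝ) < p := by exact_mod_cast hp.prime.pos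
  have hpP : Real.exp P = p := by rw [hP, Real.exp_log hp0]
  have hQ0 : 156 < Q := by linarith
  have hp78 : 2 ^ 78 < p := by
    have h1 : (2 : ℝ) ^ 78 < p := by
      rw [← hpP]
      calc (2 : ℝ) ^ 78 ≤ (Real.exp 1) ^ 78 := by
            gcongr
            linarith [Real.add_one_le_exp 1]
        _ = Real.exp 78 := by rw [← Real.exp_nat_mul]; norm_num
        _ < Real.exp P := Real.exp_lt_exp.2 hP78
    exact_mod_cast h1
  set y := ⌊Real.exp (P / 3)⌋₊ with hy
  have hE : 16 < Real.exp (P / 3) := by linarith [Real.add_one_le_exp (P / 3)]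
  have hy0 : 0 < y := Nat.floor_pos.2 (by linarith)
  have hyle : (y : ℝ) ≤ Real.exp (P / 3) := Nat.floor_le (by linarith)
  have hyp : 16 * y ^ 2 < p := by
    have h1 : (16 : ℝ) * y ^ 2 < p := by
      calc (16 : ℝ) * y ^ 2 ≤ 16 * Real.exp (P / 3) ^ 2 := by gcongr
        _ < Real.exp (P / 3) * Real.exp (P / 3) ^ 2 := by gcongr
        _ = Real.exp (P / 3) ^ 3 := by ring
        _ = p := by rw [← Real.exp_nat_mul, ← hpP]; congr 1; push_cast; ring
    exact_mod_cast h1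
  obtain ⟨r, hr, hyr, hr2, hrmax⟩ := h.exists_largest_two_le hp hy0 hyp
  have hr0 : (0 : ℝ) < r := by exact_mod_cast hr.pos
  have hρ : P / 3 ≤ Real.log r := (Real.le_log_iff_exp_le hr0).2 ((Nat.floor_lt (by linarith)).1 hyr).le
  have hrp := mul_lt_of_cube_le hp78 (h.cube_le hp hr hr2)
  have hρP : Real.log r ≤ P := by
    rw [hP]
    refine Real.log_le_log hr0 ?_
    have : r ≤ p := by omega
    exact_mod_cast this
  set D := ⌈Q ^ 2⌉₊ with hD
  have hD1 : Q ^ 2 ≤ D := Nat.le_ceil _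
  have hD2 : (D : ℝ) ≤ 2 * Q ^ 2 := by
    have h1 := (Nat.ceil_lt_add_one (by positivity : 0 ≤ Q ^ 2)).le
    have h2 : 1 ≤ Q ^ 2 := one_le_pow₀ (by linarith)
    linarith
  have hD0 : 0 < D := Nat.ceil_pos.2 (by positivity)
  have hQ8 : Real.exp (-(κ * (P / 3))) = (Q ^ 8)⁻¹ := by
    rw [hQ, ← Real.exp_nat_mul, ← Real.exp_neg]
    congr 1
    push_cast
    ring
  have hη : 8 * D * (Q ^ 8)⁻¹ ≤ 16 * (Q ^ 6)⁻¹ := by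
    calc 8 * D * (Q ^ 8)⁻¹ ≤ 8 * (2 * Q ^ 2) * (Q ^ 8)⁻¹ := by gcongr
      _ = 16 * (Q ^ 6)⁻¹ := by field_simp; ring
  have hQ6 : 16 * (Q ^ 6)⁻¹ ≤ 1 / 2 := by
    have h1 : Q ≤ Q ^ 6 := le_self_pow₀ (by linarith) (by norm_num)
    rw [← div_eq_mul_inv, div_le_iff₀ (by positivity)]
    linarith
  obtain ⟨m, hm, hd, hl⟩ := h.exists_gt_of_blocks hp hr hr2 hrp hrmax (by linarith) hD0
    (by positivity : 0 ≤ 8 * D * (Q ^ 8)⁻¹) (hη.trans hQ6) (fun U hU k hk =>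
      hU₀ U (by linarith) k _ (by
        rw [← hQ8]
        have h1 : (k : ℝ) ≤ 4 * D := by exact_mod_cast hk
        calc 2 * (k : ℝ) * Real.exp (-(κ * U)) ≤
              2 * (4 * D) * Real.exp (-(κ * (P / 3))) := by gcongr; linarith
          _ = _ := by ring) (hη.trans hQ6))
  refine ⟨m, hm, hd, hl.trans ?_⟩
  have h1 : Real.log r / D ≤ 1 / 2 * Q⁻¹ := by
    calc Real.log r / D ≤ (Q / 2) / Q ^ 2 := by gcongr; linarith
      _ = 1 / 2 * Q⁻¹ := by field_simp
  have h2 : 5 * D * (8 * D * (Q ^ 8)⁻¹) ≤ 1 / 2 * Q⁻¹ := by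
    calc 5 * D * (8 * D * (Q ^ 8)⁻¹) ≤ 5 * (2 * Q ^ 2) * (16 * (Q ^ 6)⁻¹) := by gcongr
      _ = 160 / Q ^ 3 * Q⁻¹ := by field_simp; norm_num
      _ ≤ 1 / 2 * Q⁻¹ := by
        refine mul_le_mul_of_nonneg_right ?_ (by positivity)
        have h3 : 156 ^ 3 ≤ Q ^ 3 := by gcongr
        rw [div_le_iff₀ (by positivity)]
        linarith
  linarith

end HighlyComposite

/-- Erdős, inequality (1): there is a constant `c > 0` such that every large
HCN `n` is followed by another HCN `n₁` with `n < n₁ < n + n·(log n)^{-c}`. -/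
theorem erdos_hcn_gap :
    ∃ c : ℝ, 0 < c ∧ ∃ N₀ : ℕ, ∀ n : ℕ, N₀ ≤ n → HighlyComposite n →
      ∃ n₁ : ℕ, HighlyComposite n₁ ∧ n < n₁ ∧
        (n₁ : ℝ) < (n : ℝ) + (n : ℝ) * Real.log n ^ (-c) := by
  obtain ⟨κ, hκ, -, U₀, hU₀⟩ := exists_prime_blocks
  have hlim : ∀ᶠ P : ℝ in Filter.atTop, 2 * P ≤ Real.exp (κ * P / 24) := by
    have h1 := (tendsto_rpow_mul_exp_neg_mul_atTop_nhds_zero 1 (κ / 24) (by positivity)).eventually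
      (eventually_le_nhds (by norm_num : (0 : ℝ) < 1 / 2))
    filter_upwards [h1] with P hP
    rw [Real.rpow_one, show -(κ / 24) * P = -(κ * P / 24) by ring, Real.exp_neg,
      ← div_eq_mul_inv, div_le_iff₀ (Real.exp_pos _)] at hP
    linarith
  obtain ⟨P₀, hP₀⟩ := Filter.eventually_atTop.1
    (hlim.and ((Filter.eventually_ge_atTop (3 * U₀)).and (Filter.eventually_gt_atTop 78)))
  refine ⟨κ / 192, by positivity, ⌈Real.exp (Real.exp (4 * P₀))⌉₊ + 2, fun n hn h => ?_⟩
  obtain ⟨p, hp⟩ := HighlyComposite.exists_largestPrime (by omega : 2 ≤ n)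
  have hn0 : (0 : ℝ) < n := by exact_mod_cast h.1
  have hp0 : (0 : ℝ) < p := by exact_mod_cast hp.prime.pos
  obtain ⟨P, hP⟩ : ∃ P, P = Real.log p := ⟨_, rfl⟩
  have hlogn : Real.log n ≤ Real.exp (4 * P) := by
    have h1 : (n : ℝ) ≤ 4 ^ (p * (2 * p)) := by exact_mod_cast h.le_four_pow hp
    have h2 := Real.log_le_log hn0 h1
    rw [Real.log_pow] at h2
    have h3 : Real.log 4 ≤ 1.4 := by
      rw [show (4 : ℝ) = 2 ^ 2 by norm_num, Real.log_pow]
      push_cast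
      linarith [Real.log_two_lt_d9]
    have hp2 : (2 : ℝ) ^ 2 ≤ (p : ℝ) ^ 2 := by
      gcongr
      exact_mod_cast hp.prime.two_le
    calc Real.log n ≤ (p * (2 * p) : ℕ) * Real.log 4 := h2
      _ ≤ (p * (2 * p) : ℕ) * 1.4 := by gcongr
      _ = 2.8 * (p : ℝ) ^ 2 := by push_cast; ring
      _ ≤ (p : ℝ) ^ 2 * (p : ℝ) ^ 2 := by gcongr; linarith
      _ = (p : ℝ) ^ 4 := by ring
      _ = Real.exp (4 * P) := by
        rw [hP, ← Real.exp_log hp0, ← Real.exp_nat_mul, Real.exp_log hp0]; norm_num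
  have hlogn0 : Real.exp (4 * P₀) ≤ Real.log n := by
    rw [Real.le_log_iff_exp_le hn0]
    refine (Nat.le_ceil _).trans ?_
    exact_mod_cast (by omega : _ ≤ n)
  have hPP : P₀ ≤ P := by linarith [Real.exp_le_exp.1 (hlogn0.trans hlogn)]
  obtain ⟨hQ, hPU, hP78⟩ := hP₀ P hPP
  obtain ⟨m, hnm, hd, hl⟩ := h.exists_gt_log_le hκ hU₀ hp hP (by linarith) hP78 rfl hQ
  obtain ⟨n₁, hn₁, hlt, hle⟩ := h.exists_highlyComposite_le hnm hd
  refine ⟨n₁, hn₁, hlt, ?_⟩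
  have hm0 : (0 : ℝ) < m := by exact_mod_cast (h.1.trans hnm)
  obtain ⟨z, hz⟩ : ∃ z, z = Real.exp (κ * P / 48) := ⟨_, rfl⟩
  have hzQ : Real.exp (κ * P / 24) = z ^ 2 := by
    rw [hz, ← Real.exp_nat_mul]; congr 1; push_cast; ring
  have hz0 : 0 < z := hz ▸ Real.exp_pos _
  have hz2 : 2 < z := by
    by_contra hc
    have : z ^ 2 ≤ 2 ^ 2 := by gcongr; linarith
    linarith
  rw [hzQ] at hl
  have h1 : (m : ℝ) ≤ n * Real.exp (z ^ 2)⁻¹ := by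
    rw [← Real.exp_log hm0]
    refine (Real.exp_le_exp.2 hl).trans ?_
    rw [Real.exp_add, Real.exp_log hn0]
  have h2 : Real.exp (z ^ 2)⁻¹ - 1 ≤ 2 * (z ^ 2)⁻¹ := by
    have h3 : |(z ^ 2)⁻¹| ≤ 1 := by
      rw [abs_of_pos (by positivity)]
      exact inv_le_one_of_one_le₀ (one_le_pow₀ (by linarith))
    have h4 := Real.abs_exp_sub_one_le h3
    rw [abs_of_pos (by positivity : 0 < (z ^ 2)⁻¹)] at h4
    exact (le_abs_self _).trans h4
  have h3 : z⁻¹ ≤ Real.log n ^ (-(κ / 192)) := by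
    rw [hz, ← Real.exp_neg]
    calc Real.exp (-(κ * P / 48)) = Real.exp (4 * P) ^ (-(κ / 192)) := by
          rw [← Real.exp_mul]; congr 1; ring
      _ ≤ _ := Real.rpow_le_rpow_of_nonpos ((Real.exp_pos _).trans_le hlogn0) hlogn
          (by linarith)
  have h4 : 2 * (z ^ 2)⁻¹ < z⁻¹ := by
    rw [← div_eq_mul_inv, div_lt_iff₀ (by positivity), pow_two, inv_mul_cancel_left₀ hz0.ne']
    exact hz2
  calc (n₁ : ℝ) ≤ m := by exact_mod_cast hle
    _ ≤ n + n * (Real.exp (z ^ 2)⁻¹ - 1) := by linarith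
    _ < _ := by gcongr; linarith
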